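/- Let f(x) = c_k x^k + ⋯ + c_1 x + c_0 ∈ ℤ[x] with c_k > 0 and k ≥ 1. Then r_f(N) = ∏_{p prime} (1 + (z_f(p) − 1)/(p − 1)²) · c_k^{−1/k} · (k/(k+1)) · N^{(k+1)/k}/log² N + O(N^{(k+1)/k} · log log N / log³ N), where the implied constant depends only on f. -/

import Mathlib

open Real Filter Asymptotics

/-- `zf f p` is the number of roots of `f` modulo `p`,
i.e. `#{r ∈ {0,…,p−1} : f(r) ≡ 0 (mod p)}`. -/
def zf (f : Polynomial ℤ) (p : ℕ) : ℕ :=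
  ((Finset.range p).filter fun r : ℕ => f.eval (r : ℤ) % (p : ℤ) = 0).card

/-- `rf f N` counts pairs of primes `p₁, p₂ ≤ N` whose difference `p₁ − p₂`
lies in the image `f(ℕ)` of the positive integers under `f`. -/
noncomputable def rf (f : Polynomial ℤ) (N : ℕ) : ℕ :=
  Nat.card {pq : ℕ × ℕ // pq.1.Prime ∧ pq.1 ≤ N ∧ pq.2.Prime ∧ pq.2 ≤ N ∧
    ∃ d : ℕ, 0 < d ∧ f.eval (d : ℤ) = (pq.1 : ℤ) - (pq.2 : ℤ)}

theorem per_sum_bound {q : ℕ} (h : ℕ → ℂ) (B : ℝ) (hB : ∀ n, ‖h n‖ ≤ B)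
    (hp : ∀ n, h (q + n) = h n) (h0 : ∑ k ∈ Finset.range q, h k = 0) (hq : 0 < q) (n : ℕ) :
    ‖∑ k ∈ Finset.range n, h k‖ ≤ B * q := by
  induction n using Nat.strong_induction_on with
  | _ n ih =>
    rcases lt_or_ge n q with hn | hn
    · calc _ ≤ ∑ k ∈ Finset.range n, B := norm_sum_le_of_le _ (fun k _ => hB k)
        _ = B * n := by simp [mul_comm]
        _ ≤ B * q := by
          have : (n : ℝ) ≤ q := by exact_mod_cast hn.le
          have := (norm_nonneg _).trans (hB 0)
          gcongr
    · obtain ⟨m, rfl⟩ := Nat.exists_eq_add_of_le hn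
      rw [Finset.sum_range_add, h0, zero_add, Finset.sum_congr rfl (fun k _ => hp k)]
      exact ih m (by omega)

noncomputable def kap {q : ℕ} (χ : DirichletCharacter ℂ q) : ℂ :=
  (∑ r ∈ Finset.range q, χ r) / q

theorem kap_norm {q : ℕ} (χ : DirichletCharacter ℂ q) : ‖kap χ‖ ≤ 1 := by
  rw [kap, norm_div, Complex.norm_natCast]
  refine div_le_one_of_le₀ ?_ (by positivity)
  calc _ ≤ ∑ k ∈ Finset.range q, (1 : ℝ) := norm_sum_le_of_le _ (fun k _ => χ.norm_le_one _)
    _ = _ := by simp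

theorem kap_zero {q : ℕ} [NeZero q] (χ : DirichletCharacter ℂ q) (h : χ ≠ 1) : kap χ = 0 := by
  have : ∑ r ∈ Finset.range q, χ r = ∑ a : ZMod q, χ a := by
    refine Finset.sum_bij' (fun r _ => (r : ZMod q)) (fun a _ => a.val) ?_ ?_ ?_ ?_ ?_
    · simp
    · intro a _; simpa using ZMod.val_lt a
    · intro r hr; exact ZMod.val_cast_of_lt (by simpa using hr)
    · simp
    · simp
  rw [kap, this, MulChar.sum_eq_zero_of_ne_one h, zero_div]

noncomputable def Efn {q : ℕ} (χ : DirichletCharacter ℂ q) (n : ℕ) : ℂ :=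
  ∑ k ∈ Finset.Icc 1 n, (χ k - kap χ)

theorem Efn_bound {q : ℕ} [NeZero q] (χ : DirichletCharacter ℂ q) (n : ℕ) : ‖Efn χ n‖ ≤ 4 * q := by
  have hq : 0 < q := Nat.pos_of_ne_zero (NeZero.ne q)
  have hb : ∀ n : ℕ, ‖χ n - kap χ‖ ≤ 2 := fun n =>
    (norm_sub_le _ _).trans (by linarith [χ.norm_le_one n, kap_norm χ])
  have h1 := per_sum_bound (q := q) (fun n => χ n - kap χ) 2 hb (by intro n; simp) (by
    rw [Finset.sum_sub_distrib]
    simp only [Finset.sum_const, Finset.card_range, nsmul_eq_mul, kap]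
    have : (q : ℂ) ≠ 0 := by exact_mod_cast hq.ne'
    field_simp; simp) hq (n + 1)
  have h2 : Efn χ n = ∑ k ∈ Finset.range (n + 1), (χ k - kap χ) - (χ (0:ℕ) - kap χ) := by
    rw [Finset.sum_range_succ', Efn, add_sub_cancel_right, Finset.range_eq_Ico,
      Finset.sum_Ico_add' (fun k : ℕ => χ k - kap χ) 0 n 1]
    rfl
  rw [h2]
  have h3 : (1:ℝ) ≤ q := by exact_mod_cast hq
  linarith [norm_sub_le (∑ k ∈ Finset.range (n + 1), (χ k - kap χ)) (χ (0:ℕ) - kap χ), hb 0]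

/-- the truncated error function -/
noncomputable def Tfn {q : ℕ} (χ : DirichletCharacter ℂ q) (y : ℕ) (t : ℝ) : ℂ :=
  if (y : ℝ) < t then Efn χ ⌊t⌋₊ - Efn χ y - kap χ * (t - ⌊t⌋₊ : ℝ) else 0

theorem Tfn_bound {q : ℕ} [NeZero q] (χ : DirichletCharacter ℂ q) (y : ℕ) (t : ℝ) :
    ‖Tfn χ y t‖ ≤ 9 * q := by
  have h3 : (1:ℝ) ≤ q := by exact_mod_cast Nat.pos_of_ne_zero (NeZero.ne q)
  rw [Tfn]; split_ifs with h
  · have ht : 0 ≤ t := (Nat.cast_nonneg y).trans h.le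
    have h4 : ‖kap χ * (t - ⌊t⌋₊ : ℝ)‖ ≤ 1 := by
      rw [norm_mul, Complex.norm_real, Real.norm_eq_abs, abs_of_nonneg (by linarith [Nat.floor_le ht])]
      have := Nat.lt_floor_add_one t
      have h6 := Nat.floor_le ht
      nlinarith [kap_norm χ, norm_nonneg (kap χ)]
    have := norm_sub_le (Efn χ ⌊t⌋₊) (Efn χ y)
    have := norm_sub_le (Efn χ ⌊t⌋₊ - Efn χ y) (kap χ * (t - ⌊t⌋₊ : ℝ))
    linarith [Efn_bound χ ⌊t⌋₊, Efn_bound χ y]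
  · simp

theorem Tfn_meas {q : ℕ} (χ : DirichletCharacter ℂ q) (y : ℕ) : Measurable (Tfn χ y) := by
  unfold Tfn
  refine Measurable.ite measurableSet_Ioi ?_ measurable_const
  refine ((Measurable.sub_const ?_ _).sub (measurable_const.mul ?_))
  · exact (measurable_from_nat (f := Efn χ)).comp Nat.measurable_floor
  · refine Complex.measurable_ofReal.comp (measurable_id.sub ?_)
    exact measurable_from_nat.comp Nat.measurable_floor

theorem Tfn_mellin_diff {q : ℕ} [NeZero q] (χ : DirichletCharacter ℂ q) (y : ℕ) (hy : 1 ≤ y) {s : ℂ}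
    (hs : s.re < 0) : DifferentiableAt ℂ (mellin (Tfn χ y)) s ∧ MellinConvergent (Tfn χ y) s := by
  have hl : MeasureTheory.LocallyIntegrableOn (Tfn χ y) (Set.Ioi 0) :=
    ((MeasureTheory.locallyIntegrable_const (9 * (q:ℝ))).mono
      (Tfn_meas χ y).aestronglyMeasurable (Eventually.of_forall (fun t => by
        simpa using (Tfn_bound χ y t)))).locallyIntegrableOn _
  have h1 : Tfn χ y =O[atTop] (fun t : ℝ => t ^ (-(0:ℝ))) := by
    refine IsBigO.of_bound (9 * q) (Eventually.of_forall fun t => ?_)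
    simpa using Tfn_bound χ y t
  have h2 : Tfn χ y =O[nhdsWithin 0 (Set.Ioi 0)] (fun t : ℝ => t ^ (-(s.re - 1))) := by
    refine IsBigO.of_bound 0 ?_
    have : Set.Iio (1:ℝ) ∈ nhds (0:ℝ) := Iio_mem_nhds one_pos
    filter_upwards [nhdsWithin_le_nhds this] with t ht
    have h1y : (1:ℝ) ≤ y := by exact_mod_cast hy
    have : ¬ ((y:ℝ) < t) := by simp at ht ⊢; linarith
    simp [Tfn, this]
  exact ⟨mellin_differentiableAt_of_isBigO_rpow hl h1 hs h2 (by linarith),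
    mellinConvergent_of_isBigO_rpow hl h1 hs h2 (by linarith)⟩

theorem int_piece (y : ℕ) (hy : 1 ≤ y) {s : ℂ} (hs : 1 < s.re) :
    MeasureTheory.IntegrableOn (fun t : ℝ => ((t : ℂ) - y) * (t : ℂ) ^ (-(s + 1))) (Set.Ioi (y:ℝ)) ∧
    ∫ t in Set.Ioi (y:ℝ), ((t : ℂ) - y) * (t : ℂ) ^ (-(s + 1)) = (y : ℂ) ^ (1 - s) / (s * (s - 1)) := by
  have hy0 : (0:ℝ) < y := by exact_mod_cast hy
  have i1 := integrableOn_Ioi_cpow_of_lt (a := -s) (by simpa using hs) hy0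
  have i2 := integrableOn_Ioi_cpow_of_lt (a := -(s+1)) (by simp; linarith) hy0
  have v1 := integral_Ioi_cpow_of_lt (a := -s) (by simpa using hs) hy0
  have v2 := integral_Ioi_cpow_of_lt (a := -(s+1)) (by simp; linarith) hy0
  have hyc : (y:ℂ) ≠ 0 := by exact_mod_cast hy0.ne'
  have e : Set.EqOn (fun t : ℝ => (t : ℂ) ^ (-s) - y * (t : ℂ) ^ (-(s + 1)))
      (fun t : ℝ => ((t : ℂ) - y) * (t : ℂ) ^ (-(s + 1))) (Set.Ioi (y:ℝ)) := by
    intro t ht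
    have ht0 : (t:ℂ) ≠ 0 := by exact_mod_cast (hy0.trans ht).ne'
    simp only
    rw [sub_mul, show -s = -(s+1) + 1 by ring, Complex.cpow_add _ _ ht0, Complex.cpow_one]; ring
  refine ⟨(i1.sub (i2.const_mul (y:ℂ))).congr_fun e measurableSet_Ioi, ?_⟩
  rw [← MeasureTheory.setIntegral_congr_fun measurableSet_Ioi e,
    MeasureTheory.integral_sub i1 (i2.const_mul _), MeasureTheory.integral_const_mul, v1, v2]
  have hs0 : s ≠ 0 := by rintro rfl; simp at hs; linarith
  have hs1 : s - 1 ≠ 0 := by intro h; rw [sub_eq_zero] at h; subst h; simp at hs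
  rw [show -s + 1 = 1 - s by ring, show -(s+1)+1 = (1 - s) - 1 by ring,
    Complex.ofReal_natCast, Complex.cpow_sub _ (1:ℂ) hyc, Complex.cpow_one]
  have hs2 : 1 - s ≠ 0 := by rw [← neg_sub]; exact neg_ne_zero.mpr hs1
  have hs3 : 1 - s - 1 ≠ 0 := by simpa using hs0
  field_simp
  ring

theorem Lfn_formula1 {q : ℕ} [NeZero q] (χ : DirichletCharacter ℂ q) (y : ℕ) (hy : 1 ≤ y) {s : ℂ}
    (hs : 1 < s.re) : χ.LFunction s = ∑ n ∈ Finset.Icc 1 y, χ n * (n:ℂ) ^ (-s)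
      + kap χ * (y : ℂ) ^ (1 - s) / (s - 1) + s * mellin (Tfn χ y) (-s) := by
  classical
  have hs0 : s ≠ 0 := by rintro rfl; simp at hs; linarith
  have hs1 : s - 1 ≠ 0 := by intro h; rw [sub_eq_zero] at h; subst h; simp at hs
  set g : ℕ → ℂ := fun n => if n ≤ y then 0 else χ n with hg
  set g' : ℕ → ℂ := fun n => if n ≤ y then χ n else 0 with hg'
  have sχ : LSeriesSummable (fun n : ℕ => χ n) s := ZMod.LSeriesSummable_of_one_lt_re χ hs
  have hb : ∀ n, ‖g n‖ ≤ 1 := by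
    intro n; simp only [hg]; split_ifs
    · simp
    · exact χ.norm_le_one _
  have sg : LSeriesSummable g s := LSeriesSummable_of_bounded_of_one_lt_re (fun n _ => hb n) hs
  have sg' : LSeriesSummable g' s := LSeriesSummable_of_bounded_of_one_lt_re (m := 1) (fun n _ => by
    simp only [hg']; split_ifs
    · exact χ.norm_le_one _
    · simp) hs
  have e1 : χ.LFunction s = LSeries g' s + LSeries g s := by
    rw [χ.LFunction_eq_LSeries hs, ← LSeries_add sg' sg]
    refine LSeries_congr (fun {n} _ => ?_) s
    simp only [hg, hg', Pi.add_apply]; split_ifs <;> simp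
  have e2 : LSeries g' s = ∑ n ∈ Finset.Icc 1 y, χ n * (n:ℂ) ^ (-s) := by
    rw [LSeries, tsum_eq_sum (s := Finset.Icc 1 y)]
    · refine Finset.sum_congr rfl fun n hn => ?_
      rw [Finset.mem_Icc] at hn
      rw [LSeries.term_of_ne_zero (by omega)]
      simp only [hg', hn.2, if_true]
      rw [Complex.cpow_neg, div_eq_mul_inv]
    · intro n hn
      rcases Nat.eq_zero_or_pos n with rfl | h
      · simp
      · rw [LSeries.term_of_ne_zero (by omega)]
        have : ¬ n ≤ y := fun h' => hn (Finset.mem_Icc.mpr ⟨h, h'⟩)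
        simp [hg', this]
  have hO : (fun n ↦ ∑ k ∈ Finset.Icc 1 n, g k) =O[atTop] fun n : ℕ ↦ (n : ℝ) ^ (1:ℝ) := by
    refine IsBigO.of_bound 1 (Eventually.of_forall fun n => ?_)
    calc _ ≤ ∑ k ∈ Finset.Icc 1 n, (1:ℝ) := norm_sum_le_of_le _ (fun k _ => hb k)
      _ = _ := by simp
  have e3 := LSeries_eq_mul_integral g zero_le_one hs sg hO
  have ps : ∀ t : ℝ, ∑ k ∈ Finset.Icc 1 ⌊t⌋₊, g k = Tfn χ y t +
      (Set.Ioi (y:ℝ)).indicator (fun t : ℝ => kap χ * ((t : ℂ) - y)) t := by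
    intro t
    by_cases h : (y:ℝ) < t
    · have hyt : y ≤ ⌊t⌋₊ := Nat.le_floor h.le
      rw [Set.indicator_of_mem (by exact h), Tfn, if_pos h]
      have a1 : ∑ k ∈ Finset.Icc 1 ⌊t⌋₊, g k = ∑ k ∈ Finset.Icc 1 ⌊t⌋₊, χ k - ∑ k ∈ Finset.Icc 1 y, χ k := by
        rw [eq_sub_iff_add_eq, ← Finset.sum_filter_add_sum_filter_not (Finset.Icc 1 ⌊t⌋₊) (· ≤ y) (fun k : ℕ => χ k)]
        simp only [hg, Finset.sum_ite, Finset.sum_const_zero, zero_add]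
        rw [add_comm]; congr 2
        ext k; simp; omega
      rw [a1, Efn, Efn, Finset.sum_sub_distrib, Finset.sum_sub_distrib]
      simp; ring
    · have : ∑ k ∈ Finset.Icc 1 ⌊t⌋₊, g k = 0 := by
        refine Finset.sum_eq_zero fun k hk => if_pos ?_
        have h1 : ⌊t⌋₊ ≤ y := Nat.floor_le_of_le (not_lt.mp h)
        exact (Finset.mem_Icc.mp hk).2.trans h1
      rw [this, Tfn, if_neg h, Set.indicator_of_notMem (by exact h), add_zero]
  have hmc : MeasureTheory.IntegrableOn (fun t : ℝ => Tfn χ y t * (t:ℂ) ^ (-(s+1))) (Set.Ioi 0) := by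
    have := (Tfn_mellin_diff χ y hy (s := -s) (by simp; linarith)).2
    refine MeasureTheory.IntegrableOn.congr_fun this (fun t _ => ?_) measurableSet_Ioi
    simp only [smul_eq_mul]; rw [mul_comm]; ring_nf
  have hy1 : (1:ℝ) ≤ y := by exact_mod_cast hy
  have sub : Set.Ioi (y:ℝ) ⊆ Set.Ioi 1 := Set.Ioi_subset_Ioi hy1
  have e4 : ∫ t in Set.Ioi (1:ℝ), Tfn χ y t * (t:ℂ) ^ (-(s+1)) = mellin (Tfn χ y) (-s) := by
    rw [mellin, MeasureTheory.setIntegral_eq_of_subset_of_forall_sdiff_eq_zero (s := Set.Ioi 1)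
      (t := Set.Ioi (0:ℝ)) measurableSet_Ioi (Set.Ioi_subset_Ioi zero_le_one)]
    · refine MeasureTheory.setIntegral_congr_fun measurableSet_Ioi fun t _ => ?_
      simp only [smul_eq_mul]; rw [mul_comm]; ring_nf
    · intro t ht
      simp only [Set.mem_sdiff, Set.mem_Ioi, not_lt] at ht
      simp [Tfn, not_lt.mpr (ht.2.trans hy1)]
  obtain ⟨ip1, ip2⟩ := int_piece y hy hs
  have ind : ∀ t : ℝ, (Set.Ioi (y:ℝ)).indicator (fun t : ℝ => kap χ * ((t : ℂ) - y)) t * (t:ℂ) ^ (-(s+1))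
      = (Set.Ioi (y:ℝ)).indicator (fun t : ℝ => kap χ * (((t : ℂ) - y) * (t:ℂ) ^ (-(s+1)))) t := by
    intro t; by_cases h : t ∈ Set.Ioi (y:ℝ)
    · simp only [Set.indicator_of_mem h]; ring
    · simp [Set.indicator_of_notMem h]
  have e5 : ∫ t in Set.Ioi (1:ℝ), (∑ k ∈ Finset.Icc 1 ⌊t⌋₊, g k) * (t:ℂ) ^ (-(s+1))
      = mellin (Tfn χ y) (-s) + kap χ * ((y : ℂ) ^ (1 - s) / (s * (s - 1))) := by
    simp only [ps, add_mul, ind]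
    rw [MeasureTheory.integral_add (hmc.mono_set (Set.Ioi_subset_Ioi zero_le_one)), e4,
      MeasureTheory.setIntegral_indicator measurableSet_Ioi, Set.inter_eq_self_of_subset_right sub,
      MeasureTheory.integral_const_mul, ip2]
    refine (MeasureTheory.integrableOn_indicator_iff measurableSet_Ioi).mpr ?_
    exact MeasureTheory.IntegrableOn.mono_set (ip1.const_mul _) Set.inter_subset_left
  rw [e1, e2, e3, e5]
  field_simp
  ring

theorem Lfn_entire {q : ℕ} [NeZero q] (χ : DirichletCharacter ℂ q) :
    ∃ J : ℂ → ℂ, Differentiable ℂ J ∧ ∀ s ≠ 1, J s = (s - 1) * χ.LFunction s := by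
  by_cases h : χ = 1
  · subst h
    refine ⟨DirichletCharacter.LFunctionTrivChar₁ q, DirichletCharacter.differentiable_LFunctionTrivChar₁ q, fun s hs => ?_⟩
    simp [DirichletCharacter.LFunctionTrivChar₁, Function.update_of_ne hs]
  · exact ⟨fun s => (s - 1) * χ.LFunction s,
      (differentiable_id.sub_const 1).mul (DirichletCharacter.differentiable_LFunction h), fun s _ => rfl⟩

theorem Lfn_formula {q : ℕ} [NeZero q] (χ : DirichletCharacter ℂ q) (y : ℕ) (hy : 1 ≤ y) {s : ℂ}
    (hs : 0 < s.re) (h1 : s ≠ 1) : χ.LFunction s = ∑ n ∈ Finset.Icc 1 y, χ n * (n:ℂ) ^ (-s)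
      + kap χ * (y : ℂ) ^ (1 - s) / (s - 1) + s * mellin (Tfn χ y) (-s) := by
  obtain ⟨J, hJ, hJe⟩ := Lfn_entire χ
  set U : Set ℂ := {s | 0 < s.re}
  have hU : IsOpen U := isOpen_lt continuous_const Complex.continuous_re
  have hUc : IsPreconnected U := (convex_halfSpace_re_gt 0).isPreconnected
  let G : ℂ → ℂ := fun s => (s - 1) * (∑ n ∈ Finset.Icc 1 y, χ n * (n:ℂ) ^ (-s)
      + s * mellin (Tfn χ y) (-s)) + kap χ * (y : ℂ) ^ (1 - s)
  have hG : DifferentiableOn ℂ G U := by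
    intro w hw
    refine DifferentiableAt.differentiableWithinAt ?_
    have d1 : DifferentiableAt ℂ (fun s => mellin (Tfn χ y) (-s)) w :=
      DifferentiableAt.comp (g := mellin (Tfn χ y)) (f := fun s => -s) w
        (Tfn_mellin_diff χ y hy (s := -w) (by simpa [U] using hw)).1 differentiableAt_id.neg
    have d2 : ∀ n ∈ Finset.Icc 1 y, DifferentiableAt ℂ (fun s => χ n * (n:ℂ) ^ (-s)) w := by
      intro n hn
      have : (n:ℂ) ≠ 0 := by have := (Finset.mem_Icc.mp hn).1; exact_mod_cast (by omega : n ≠ 0)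
      exact (differentiableAt_id.neg.const_cpow (Or.inl this)).const_mul _
    have d3 : DifferentiableAt ℂ (fun s => kap χ * (y : ℂ) ^ (1 - s)) w :=
      ((differentiableAt_id.const_sub 1).const_cpow (Or.inl (by exact_mod_cast (by omega : y ≠ 0)))).const_mul _
    exact ((differentiableAt_id.sub_const 1).mul ((DifferentiableAt.fun_sum d2).add
      (differentiableAt_id.mul d1))).add d3
  have key : Set.EqOn J G U := by
    refine (hJ.differentiableOn.analyticOnNhd hU).eqOn_of_preconnected_of_eventuallyEq
      (hG.analyticOnNhd hU) hUc (z₀ := 2) (by simp [U]) ?_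
    have : {s : ℂ | 1 < s.re} ∈ nhds (2:ℂ) :=
      (isOpen_lt continuous_const Complex.continuous_re).mem_nhds (by simp)
    filter_upwards [this] with w hw
    have hw1 : w ≠ 1 := by rintro rfl; simp at hw
    have := sub_ne_zero.mpr hw1
    rw [hJe w hw1, Lfn_formula1 χ y hy hw]
    simp only [G]; field_simp; ring
  have hk := key hs
  rw [hJe s h1] at hk
  have := sub_ne_zero.mpr h1
  rw [← mul_right_inj' this, hk]
  simp only [G]; field_simp; ring

theorem mellin_Tfn_bound {q : ℕ} [NeZero q] (χ : DirichletCharacter ℂ q) (y : ℕ) (hy : 1 ≤ y) {s : ℂ}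
    (hs : 0 < s.re) : ‖mellin (Tfn χ y) (-s)‖ ≤ 9 * q * ((y:ℝ) ^ (-s.re) / s.re) := by
  have hy0 : (0:ℝ) < y := by exact_mod_cast hy
  have i2 := integrableOn_Ioi_rpow_of_lt (a := -s.re - 1) (by linarith) hy0
  have v2 := integral_Ioi_rpow_of_lt (a := -s.re - 1) (by linarith) hy0
  rw [mellin, MeasureTheory.setIntegral_eq_of_subset_of_forall_sdiff_eq_zero (s := Set.Ioi (y:ℝ))
      (t := Set.Ioi (0:ℝ)) measurableSet_Ioi (Set.Ioi_subset_Ioi hy0.le)]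
  · calc _ ≤ ∫ t in Set.Ioi (y:ℝ), 9 * q * t ^ (-s.re - 1) := by
          refine MeasureTheory.norm_integral_le_of_norm_le (i2.const_mul _) ?_
          refine (MeasureTheory.ae_restrict_iff' measurableSet_Ioi).mpr (Eventually.of_forall fun t ht => ?_)
          have ht0 : 0 < t := hy0.trans ht
          rw [norm_smul, Complex.norm_cpow_eq_rpow_re_of_pos ht0, mul_comm]
          simp only [Complex.sub_re, Complex.neg_re, Complex.one_re]
          gcongr; exact Tfn_bound χ y t
      _ = _ := by
        rw [MeasureTheory.integral_const_mul, v2, show -s.re - 1 + 1 = -s.re by ring, neg_div_neg_eq]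
  · intro t ht
    simp [Tfn]
    intro h; exact absurd h (not_lt.mpr (by simpa using ht.2))

theorem L_upper (δ : ℝ) (hδ : 0 < δ) (hδ2 : δ ≤ 1 / 2) : ∃ C : ℝ, 1 ≤ C ∧ ∀ (q : ℕ) [NeZero q]
    (χ : DirichletCharacter ℂ q) (s : ℂ), 1 - δ ≤ s.re → s.re ≤ 4 → s ≠ 1 →
    ‖χ.LFunction s‖ ≤ C * (q * (|s.im| + 2)) ^ (2 * δ) * (1 + ‖kap χ‖ / ‖s - 1‖) := by
  refine ⟨2 * (1 + 1 / δ + 54), by have : 0 < 1 / δ := by positivity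
                                   linarith, ?_⟩
  intro q _ χ s h1 h3 hs1
  have hq : (1:ℝ) ≤ q := by exact_mod_cast Nat.pos_of_ne_zero (NeZero.ne q)
  set τ : ℝ := q * (|s.im| + 2) with hτ
  have hτq : 2 * (q:ℝ) ≤ τ := by rw [hτ]; nlinarith [abs_nonneg s.im]
  have hτ2 : 2 ≤ τ := by linarith
  set y := ⌈τ⌉₊ with hy
  have hy1 : τ ≤ y := Nat.le_ceil τ
  have hy2 : (y:ℝ) ≤ 2 * τ := by have := Nat.ceil_lt_add_one (by linarith : 0 ≤ τ); linarith
  have hyn : 1 ≤ y := by have : (1:ℝ) ≤ y := by linarith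
                         exact_mod_cast this
  have hy0 : (0:ℝ) < y := by linarith
  have hyy : (1:ℝ) ≤ y := by linarith
  have hs0 : 0 < s.re := by linarith
  have hyδ : 1 ≤ (y:ℝ) ^ δ := Real.one_le_rpow hyy hδ.le
  have hsq : (y:ℝ) ^ (2 * δ) = (y:ℝ) ^ δ * (y:ℝ) ^ δ := by rw [← Real.rpow_add hy0]; ring_nf
  have hY : (y:ℝ) ^ (2 * δ) ≤ 2 * τ ^ (2 * δ) := by
    calc (y:ℝ) ^ (2 * δ) ≤ (2 * τ) ^ (2 * δ) := by gcongr
      _ = 2 ^ (2 * δ) * τ ^ (2 * δ) := by rw [Real.mul_rpow (by norm_num) (by linarith)]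
      _ ≤ 2 ^ (1:ℝ) * τ ^ (2 * δ) := by
        gcongr
        · norm_num
        · linarith
      _ = _ := by norm_num
  have b1 : ‖∑ n ∈ Finset.Icc 1 y, χ n * (n:ℂ) ^ (-s)‖ ≤ (1 + 1 / δ) * (y:ℝ) ^ (2 * δ) := by
    calc _ ≤ ∑ n ∈ Finset.Icc 1 y, (y:ℝ) ^ δ * ((n:ℝ))⁻¹ := by
          refine norm_sum_le_of_le _ fun n hn => ?_
          have hn' := Finset.mem_Icc.mp hn
          have hn0 : (0:ℝ) < n := by exact_mod_cast hn'.1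
          have hn1 : (1:ℝ) ≤ n := by exact_mod_cast hn'.1
          have hny : (n:ℝ) ≤ y := by exact_mod_cast hn'.2
          rw [norm_mul, Complex.norm_natCast_cpow_of_pos (by omega)]
          calc _ ≤ 1 * (n:ℝ) ^ (δ - 1) := by
                refine mul_le_mul (χ.norm_le_one _) ?_ (by positivity) (by norm_num)
                exact Real.rpow_le_rpow_of_exponent_le hn1 (by simp; linarith)
            _ = (n:ℝ) ^ δ * (n:ℝ)⁻¹ := by rw [Real.rpow_sub_one hn0.ne']; ring
            _ ≤ _ := by gcongr
      _ = (y:ℝ) ^ δ * (harmonic y : ℝ) := by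
          rw [← Finset.mul_sum, harmonic_eq_sum_Icc]; push_cast; rfl
      _ ≤ (y:ℝ) ^ δ * (1 + Real.log y) := by gcongr; exact harmonic_le_one_add_log y
      _ ≤ (y:ℝ) ^ δ * ((1 + 1 / δ) * (y:ℝ) ^ δ) := by
          gcongr
          have := Real.log_le_rpow_div hy0.le hδ
          have h5 : (1 + 1 / δ) * (y:ℝ) ^ δ = (y:ℝ) ^ δ + (y:ℝ) ^ δ / δ := by ring
          linarith
      _ = _ := by rw [hsq]; ring
  have b2 : ‖kap χ * (y : ℂ) ^ (1 - s) / (s - 1)‖ ≤ (y:ℝ) ^ (2 * δ) * (‖kap χ‖ / ‖s - 1‖) := by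
    rw [norm_div, norm_mul, Complex.norm_natCast_cpow_of_pos (by omega), mul_comm ‖kap χ‖, mul_div_assoc]
    gcongr
    simp; linarith
  have b3 : ‖s * mellin (Tfn χ y) (-s)‖ ≤ 54 * (y:ℝ) ^ (2 * δ) := by
    have hsn : q * ‖s‖ ≤ 3 * y := by
      have := Complex.norm_le_abs_re_add_abs_im s
      rw [abs_of_pos hs0] at this
      have : q * ‖s‖ ≤ q * (3 * (|s.im| + 2)) := by gcongr; linarith [abs_nonneg s.im]
      linarith
    rw [norm_mul]
    calc _ ≤ ‖s‖ * (9 * q * ((y:ℝ) ^ (-s.re) / s.re)) := by gcongr; exact mellin_Tfn_bound χ y hyn hs0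
      _ ≤ ‖s‖ * (9 * q * ((y:ℝ) ^ (δ - 1) / (1 / 2))) := by
        gcongr
        · linarith
        · linarith
      _ = 18 * (q * ‖s‖) * (y:ℝ) ^ (δ - 1) := by ring
      _ ≤ 18 * (3 * y) * (y:ℝ) ^ (δ - 1) := by gcongr
      _ = 54 * (y:ℝ) ^ δ := by rw [Real.rpow_sub_one hy0.ne']; field_simp; norm_num
      _ ≤ _ := by rw [hsq]; nlinarith
  rw [Lfn_formula χ y hyn hs0 hs1]
  set κ := ‖kap χ‖ / ‖s - 1‖
  have hκ : 0 ≤ κ := by positivity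
  calc _ ≤ (1 + 1 / δ) * (y:ℝ) ^ (2 * δ) + (y:ℝ) ^ (2 * δ) * κ + 54 * (y:ℝ) ^ (2 * δ) :=
        (norm_add₃_le).trans (by linarith)
    _ ≤ (1 + 1 / δ + 54) * (y:ℝ) ^ (2 * δ) * (1 + κ) := by
      have : 0 < 1 / δ := by positivity
      have h6 : 0 ≤ (y:ℝ) ^ (2 * δ) * κ := by positivity
      nlinarith
    _ ≤ (1 + 1 / δ + 54) * (2 * τ ^ (2 * δ)) * (1 + κ) := by gcongr
    _ = _ := by ring

open ComplexOrder in
theorem cnn {z : ℂ} (h : 0 ≤ z) : ∃ r : ℝ, 0 ≤ r ∧ (r : ℂ) = z :=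
  ⟨z.re, (Complex.nonneg_iff.mp h).1, Complex.ext (by simp) (by simp [(Complex.nonneg_iff.mp h).2])⟩

open ComplexOrder in
theorem exp_alt {a : ℕ → ℂ} (ha : 0 ≤ a) (hab : LSeries.abscissaOfAbsConv a ≤ 1) (m : ℕ) :
    0 ≤ (-1) ^ m * iteratedDeriv m (fun s => Complex.exp (LSeries a s)) (2 : ℂ) := by
  have hab2 : LSeries.abscissaOfAbsConv a < ((2:ℝ):EReal) :=
    lt_of_le_of_lt hab (by exact_mod_cast (by norm_num : (1:ℝ) < 2))
  have key := fun n => LSeries.iteratedDeriv_alternating ha hab2 n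
  have hopen := LSeries_analyticOnNhd a
  have hD : AnalyticAt ℂ (LSeries a) (2:ℂ) := hopen 2 (by simpa using hab2)
  have hF : AnalyticAt ℂ (fun s => Complex.exp (LSeries a s)) (2:ℂ) := hD.cexp
  have hd : deriv (fun s => Complex.exp (LSeries a s)) =ᶠ[nhds (2:ℂ)]
      fun s => Complex.exp (LSeries a s) * deriv (LSeries a) s := by
    filter_upwards [hD.eventually_analyticAt] with s hs
    exact (hs.differentiableAt.hasDerivAt.cexp).deriv
  induction m using Nat.strong_induction_on with
  | _ m ih =>
    rcases m with _ | m
    · simp only [pow_zero, one_mul, iteratedDeriv_zero]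
      have h0 := key 0
      simp only [pow_zero, one_mul, iteratedDeriv_zero] at h0
      obtain ⟨r, hr, hr2⟩ := cnn h0
      norm_num at hr2
      rw [← hr2, ← Complex.ofReal_exp]
      exact_mod_cast (Real.exp_pos r).le
    · rw [iteratedDeriv_succ', hd.iteratedDeriv_eq, iteratedDeriv_fun_mul hF.contDiffAt
        hD.deriv.contDiffAt, Finset.mul_sum]
      refine Finset.sum_nonneg fun i hi => ?_
      have hi' : i ≤ m := by simpa [Nat.lt_succ_iff] using hi
      have e1 := ih i (by omega)
      have e2 := key (m - i + 1)
      rw [iteratedDeriv_succ'] at e2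
      norm_num at e2
      have : (-1:ℂ) ^ (m + 1) * ((m.choose i : ℂ) *
          iteratedDeriv i (fun s => Complex.exp (LSeries a s)) 2 * iteratedDeriv (m - i) (deriv (LSeries a)) 2)
          = (m.choose i : ℂ) * ((-1) ^ i * iteratedDeriv i (fun s => Complex.exp (LSeries a s)) 2 )
            * ((-1) ^ (m - i + 1) * iteratedDeriv (m - i) (deriv (LSeries a)) 2) := by
        rw [show m + 1 = i + (m - i + 1) by omega, pow_add]; ring
      rw [this]
      exact mul_nonneg (mul_nonneg (by positivity) e1) e2

/-- Real part of Estermann's argument. -/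
theorem est_real (b j : ℕ → ℝ) (K z : ℝ) (hb : ∀ m, 0 ≤ b m) (hb0 : 1 ≤ b 0) (hj0 : j 0 = b 0)
    (hj : ∀ m, j (m + 1) = b (m + 1) - b m) (hjK : ∀ m, |j m| ≤ K * (2 / 3) ^ m) (hz1 : 1 < z)
    (hz2 : z ≤ 5 / 4) (M : ℕ) :
    ∑' m, j m * z ^ m ≤ (∑' m, j m) * z ^ (M + 1) + 10 * K * (5 / 6) ^ (M + 1) - (z - 1) := by
  have hK : 0 ≤ K := by have := (abs_nonneg _).trans (hjK 0); simpa using this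
  have hz0 : 0 < z := by linarith
  have bnd : ∀ m, |j m * z ^ m| ≤ K * (5 / 6) ^ m := fun m => by
    rw [abs_mul, abs_of_pos (by positivity : 0 < z ^ m)]
    calc _ ≤ K * (2 / 3) ^ m * (5 / 4) ^ m := by gcongr; exact hjK m
      _ = _ := by rw [mul_assoc, ← mul_pow]; norm_num
  have g1 : Summable (fun m : ℕ => K * (2 / 3 : ℝ) ^ m) :=
    (summable_geometric_of_lt_one (by norm_num) (by norm_num)).mul_left _
  have g2 : Summable (fun m : ℕ => K * (5 / 6 : ℝ) ^ m) :=
    (summable_geometric_of_lt_one (by norm_num) (by norm_num)).mul_left _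
  have s1 : Summable j := Summable.of_norm_bounded g1 (fun m => hjK m)
  have s2 : Summable (fun m => j m * z ^ m) := Summable.of_norm_bounded g2 (fun m => bnd m)
  have tail : ∀ (u : ℕ → ℝ) (r : ℝ), 0 < r → r < 1 → (∀ m, |u m| ≤ K * r ^ m) → Summable u →
      |∑' m, u (m + (M + 2))| ≤ K * r ^ (M + 2) / (1 - r) := by
    intro u r hr0 hr hu _
    have g : HasSum (fun m : ℕ => K * r ^ (M + 2) * r ^ m) (K * r ^ (M + 2) / (1 - r)) := by
      simpa [div_eq_mul_inv] using (hasSum_geometric_of_lt_one hr0.le hr).mul_left (K * r ^ (M + 2))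
    rw [← Real.norm_eq_abs]
    refine tsum_of_norm_bounded g (fun m => ?_)
    rw [Real.norm_eq_abs]
    calc _ ≤ _ := hu _
      _ = _ := by rw [pow_add]; ring
  have p1 : ∀ n, ∑ m ∈ Finset.range (n + 1), j m = b n := by
    intro n; induction n with
    | zero => simp [hj0]
    | succ n ih => rw [Finset.sum_range_succ, ih, hj]; ring
  have p2 : ∀ n, ∑ m ∈ Finset.range (n + 2), j m * z ^ m ≤ b (n + 1) * z ^ (n + 1) - (z - 1) := by
    intro n; induction n with
    | zero => rw [Finset.sum_range_succ, Finset.sum_range_succ, hj, hj0]; simp; nlinarith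
    | succ n ih =>
      rw [Finset.sum_range_succ, hj]
      have : 0 ≤ b (n + 1) * z ^ (n + 1) * (z - 1) :=
        mul_nonneg (mul_nonneg (hb _) (by positivity)) (by linarith)
      have e : z ^ (n + 1 + 1) = z ^ (n + 1) * z := pow_succ _ _
      rw [show n + 2 = n + 1 + 1 from rfl] at ih ⊢
      rw [e]; linarith
  have q1 := s1.sum_add_tsum_nat_add (M + 2)
  have q2 := s2.sum_add_tsum_nat_add (M + 2)
  have t1 := (abs_le.mp (tail j (2 / 3) (by norm_num) (by norm_num) hjK s1)).1
  have t2 := (abs_le.mp (tail _ (5 / 6) (by norm_num) (by norm_num) bnd s2)).2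
  rw [p1 (M + 1)] at q1
  have p3 := p2 M
  have hbR : b (M + 1) ≤ (∑' m, j m) + 2 * K * (2 / 3) ^ (M + 1) := by
    have : K * (2 / 3) ^ (M + 2) / (1 - 2 / 3) = 2 * K * (2 / 3) ^ (M + 1) := by rw [pow_succ _ (M + 1)]; ring
    linarith
  have h5 : K * (5 / 6) ^ (M + 2) / (1 - 5 / 6) = 5 * K * (5 / 6) ^ (M + 1) := by rw [pow_succ _ (M + 1)]; ring
  have h6 : b (M + 1) * z ^ (M + 1) ≤ (∑' m, j m) * z ^ (M + 1) + 2 * K * (5 / 6) ^ (M + 1) := by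
    calc _ ≤ ((∑' m, j m) + 2 * K * (2 / 3) ^ (M + 1)) * z ^ (M + 1) := by gcongr
      _ = (∑' m, j m) * z ^ (M + 1) + 2 * K * ((2 / 3) ^ (M + 1) * z ^ (M + 1)) := by ring
      _ ≤ (∑' m, j m) * z ^ (M + 1) + 2 * K * ((2 / 3) ^ (M + 1) * (5 / 4) ^ (M + 1)) := by gcongr
      _ = _ := by rw [← mul_pow]; norm_num
  have : 0 ≤ K * (5 / 6) ^ (M + 1) := by positivity
  linarith

open ComplexOrder in
/-- Complex part of Estermann's argument. -/
theorem est_cplx {a : ℕ → ℂ} (ha : 0 ≤ a) (hab : LSeries.abscissaOfAbsConv a ≤ 1) (J : ℂ → ℂ)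
    (hJ : Differentiable ℂ J) (hJF : ∀ s : ℂ, 1 < s.re → J s = (s - 1) * Complex.exp (LSeries a s))
    (K : ℝ) (hK : ∀ s ∈ Metric.sphere (2:ℂ) (3 / 2), ‖J s‖ ≤ K) :
    (∀ x : ℝ, J x = (J x).re) ∧ ∀ x : ℝ, x < 1 → 3 / 4 ≤ x → ∀ M : ℕ,
      (J x).re ≤ ‖J 1‖ * (2 - x) ^ (M + 1) + 10 * K * (5 / 6) ^ (M + 1) - (1 - x) := by
  set F : ℂ → ℂ := fun s => Complex.exp (LSeries a s) with hFdef
  have hab2 : LSeries.abscissaOfAbsConv a < ((2:ℝ):EReal) :=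
    lt_of_le_of_lt hab (by exact_mod_cast (by norm_num : (1:ℝ) < 2))
  have hD : AnalyticAt ℂ (LSeries a) (2:ℂ) := LSeries_analyticOnNhd a 2 (by simpa using hab2)
  have hF : AnalyticAt ℂ F (2:ℂ) := hD.cexp
  have alt := exp_alt ha hab
  choose b' hb' hb'2 using fun m => cnn (alt m)
  set b : ℕ → ℝ := fun m => b' m / (m.factorial : ℝ) with hb
  set j : ℕ → ℝ := fun m => b m - (if m = 0 then 0 else b (m - 1)) with hj
  have hJm : ∀ m, ((m.factorial : ℂ))⁻¹ * (-1) ^ m * iteratedDeriv m J 2 = j m := by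
    intro m
    have e1 : J =ᶠ[nhds 2] fun s => (s - 1) * F s := by
      filter_upwards [(isOpen_lt continuous_const Complex.continuous_re).mem_nhds
        (show (1:ℝ) < (2:ℂ).re by norm_num)] with s hs using hJF s hs
    have hlin : ∀ m : ℕ, iteratedDeriv m (fun s : ℂ => s - 1) 2 = if m = 0 then 1 else if m = 1 then 1 else 0 := by
      intro m
      rcases m with _ | _ | m
      · norm_num
      · simp [iteratedDeriv_one]
      · rw [iteratedDeriv_succ', iteratedDeriv_succ']
        have : deriv (deriv fun s : ℂ => s - 1) = fun _ => 0 := by ext; simp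
        rw [this]; simp
    have hf : (m.factorial : ℂ) ≠ 0 := by exact_mod_cast m.factorial_ne_zero
    rw [e1.iteratedDeriv_eq, iteratedDeriv_fun_mul (by fun_prop) hF.contDiffAt]
    simp only [hlin]
    have r0 := hb'2 m
    rcases m with _ | m
    · simp [hj, hb]; simp at r0; rw [r0]
    · rw [Finset.sum_range_succ', Finset.sum_range_succ']
      have r1 := hb'2 m
      have hf' : (m.factorial : ℂ) ≠ 0 := by exact_mod_cast m.factorial_ne_zero
      have hm1 : (m:ℂ) + 1 ≠ 0 := by exact_mod_cast Nat.succ_ne_zero m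
      simp [hj, hb]
      rw [r0, r1, Nat.factorial_succ]
      push_cast
      field_simp
      ring
  have hser : ∀ z : ℝ, HasSum (fun m => ((j m * z ^ m : ℝ) : ℂ)) (J (2 - z)) := by
    intro z
    have := Complex.hasSum_taylorSeries_of_entire hJ 2 (2 - z)
    have e : (fun m => ((j m * z ^ m : ℝ) : ℂ)) = fun n : ℕ => ((n.factorial : ℂ))⁻¹ • (2 - (z:ℂ) - 2) ^ n • iteratedDeriv n J 2 := ?_
    · rw [e]; exact this
    funext m
    push_cast
    rw [← hJm m, show (2 - (z:ℂ) - 2) = (-1) * z by ring, mul_pow, smul_eq_mul, smul_eq_mul]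
    ring
  have hre : ∀ z : ℝ, J (2 - z) = ((∑' m, j m * z ^ m : ℝ) : ℂ) := fun z => by
    rw [← (hser z).tsum_eq, Complex.ofReal_tsum]
  have hx : ∀ x : ℝ, J x = ((∑' m, j m * (2 - x) ^ m : ℝ) : ℂ) := fun x => by
    rw [← hre (2 - x)]; congr 1; push_cast; ring
  refine ⟨fun x => by rw [hx x, Complex.ofReal_re], fun x hx1 hx2 M => ?_⟩
  have hK' : ∀ m, |j m| ≤ K * (2 / 3) ^ m := by
    intro m
    have c := Complex.norm_iteratedDeriv_le_of_forall_mem_sphere_norm_le m (by norm_num : (0:ℝ) < 3 / 2)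
      hJ.diffContOnCl hK
    have hf : (0:ℝ) < m.factorial := by exact_mod_cast m.factorial_pos
    rw [← Real.norm_eq_abs, ← Complex.norm_real, ← hJm m]
    simp only [norm_mul, norm_inv, norm_pow, norm_neg, norm_one, one_pow, mul_one, Complex.norm_natCast]
    calc _ ≤ (m.factorial : ℝ)⁻¹ * (m.factorial * K / (3 / 2) ^ m) := by gcongr
      _ = _ := by rw [div_pow, div_pow]; field_simp
  have hb0 : 1 ≤ b 0 := by
    have h0 := LSeries.iteratedDeriv_alternating ha hab2 0
    simp only [pow_zero, one_mul, iteratedDeriv_zero] at h0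
    obtain ⟨r, hr, hr2⟩ := cnn h0
    have := hb'2 0
    norm_num at hr2
    simp only [pow_zero, one_mul, iteratedDeriv_zero] at this
    rw [← hr2, ← Complex.ofReal_exp] at this
    simp only [hb, Nat.factorial_zero, Nat.cast_one, div_one]
    rw [Complex.ofReal_inj.mp this]
    exact Real.one_le_exp hr
  have main := est_real b j K (2 - x) (fun m => div_nonneg (hb' m) (by positivity)) hb0 (by simp [hj])
    (fun m => by simp [hj]) hK' (by linarith) (by linarith) M
  have h1 : J 1 = ((∑' m, j m : ℝ) : ℂ) := by
    have := hx 1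
    norm_num at this
    rw [this]
  rw [hx x, Complex.ofReal_re]
  have h2 : (∑' m, j m) ≤ ‖J 1‖ := by rw [h1, Complex.norm_real]; exact le_abs_self _
  have h3 : (∑' m, j m) * (2 - x) ^ (M + 1) ≤ ‖J 1‖ * (2 - x) ^ (M + 1) := by
    have : 0 ≤ (2 - x) ^ (M + 1) := pow_nonneg (by linarith) _
    gcongr
  linarith

theorem prod_one_sub_inv (S : Finset ℕ) : (∀ p ∈ S, 2 ≤ p) →
    1 / ((S.card : ℝ) + 1) ≤ ∏ p ∈ S, (1 - 1 / (p : ℝ)) := by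
  induction S using Finset.induction_on_max with
  | empty => simp
  | insert a s hs ih =>
    intro h
    have ih' := ih (fun p hp => h p (Finset.mem_insert_of_mem hp))
    have ha : a ∉ s := fun h => lt_irrefl _ (hs a h)
    rw [Finset.prod_insert ha, Finset.card_insert_of_notMem ha]
    have hc : s.card + 2 ≤ a := by
      have h2 : s ⊆ Finset.Ico 2 a := fun p hp =>
        Finset.mem_Ico.mpr ⟨h p (Finset.mem_insert_of_mem hp), hs p hp⟩
      have := Finset.card_le_card h2
      have := h a (Finset.mem_insert_self _ _)
      simp at *; omega
    have hc' : (s.card : ℝ) + 2 ≤ a := by exact_mod_cast hc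
    have hs0 : (0:ℝ) ≤ s.card := by positivity
    have h1 : 1 - 1 / ((s.card : ℝ) + 2) ≤ 1 - 1 / (a:ℝ) := by gcongr
    push_cast
    calc (1:ℝ) / (s.card + 1 + 1) = (1 - 1 / ((s.card : ℝ) + 2)) * (1 / (s.card + 1)) := by field_simp; ring
      _ ≤ _ := by
        refine mul_le_mul h1 ih' (by positivity) (le_trans ?_ h1)
        rw [sub_nonneg, div_le_one (by linarith)]; linarith

theorem omega_le (n : ℕ) (hn : 1 ≤ n) : (n.primeFactors.card : ℝ) ≤ 2 * Real.log n := by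
  have h1 : 2 ^ n.primeFactors.card ≤ n := by
    calc 2 ^ n.primeFactors.card = ∏ p ∈ n.primeFactors, 2 := by simp
      _ ≤ ∏ p ∈ n.primeFactors, p := Finset.prod_le_prod' fun p hp => (Nat.prime_of_mem_primeFactors hp).two_le
      _ ≤ n := Nat.le_of_dvd hn (Nat.prod_primeFactors_dvd n)
  have h2 : ((2:ℝ)) ^ n.primeFactors.card ≤ n := by exact_mod_cast h1
  have h3 := Real.log_le_log (by positivity) h2
  rw [Real.log_pow] at h3
  nlinarith [Real.log_two_gt_d9, (by positivity : (0:ℝ) ≤ n.primeFactors.card)]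

theorem phi_lower (n : ℕ) (hn : 1 ≤ n) :
    1 / (1 + 2 * Real.log n) ≤ ∏ p ∈ n.primeFactors, (1 - 1 / (p : ℝ)) := by
  refine le_trans ?_ (prod_one_sub_inv _ fun p hp => (Nat.prime_of_mem_primeFactors hp).two_le)
  have := omega_le n hn
  exact one_div_le_one_div_of_le (by positivity) (by linarith)

theorem L_upper' (δ : ℝ) (hδ : 0 < δ) (hδ2 : δ ≤ 1 / 2) : ∃ C : ℝ, 1 ≤ C ∧ ∀ (q : ℕ) [NeZero q]
    (χ : DirichletCharacter ℂ q) (s : ℂ), χ ≠ 1 → 1 - δ ≤ s.re → s.re ≤ 4 →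
    ‖χ.LFunction s‖ ≤ C * (q * (|s.im| + 2)) ^ (2 * δ) := by
  obtain ⟨C, hC, h⟩ := L_upper δ hδ hδ2
  refine ⟨C, hC, fun q _ χ s hχ h1 h2 => ?_⟩
  have hne : ∀ s : ℂ, 1 - δ ≤ s.re → s.re ≤ 4 → s ≠ 1 →
    ‖χ.LFunction s‖ ≤ C * (q * (|s.im| + 2)) ^ (2 * δ) := fun s h1 h2 h3 => by
      have := h q χ s h1 h2 h3
      rwa [kap_zero χ hχ, norm_zero, zero_div, add_zero, mul_one] at this
  by_cases hs : s = 1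
  · subst hs
    have hc : Continuous χ.LFunction := (DirichletCharacter.differentiable_LFunction hχ).continuous
    have t : Tendsto (fun x : ℝ => ‖χ.LFunction (1 + x)‖) (nhdsWithin 0 (Set.Ioi 0)) (nhds ‖χ.LFunction 1‖) := by
      have : Continuous fun x : ℝ => ‖χ.LFunction (1 + x)‖ := by fun_prop
      have := (this.tendsto 0).mono_left (nhdsWithin_le_nhds (s := Set.Ioi 0))
      simpa using this
    refine le_of_tendsto t ?_
    filter_upwards [Ioo_mem_nhdsGT (show (0:ℝ) < 1 by norm_num)] with x hx
    have := hne (1 + x) (by simp; linarith [hx.1]) (by simp; linarith [hx.2]) (by simpa using hx.1.ne')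
    simpa using this
  · exact hne s h1 h2 hs

noncomputable def zet1 : ℂ → ℂ := DirichletCharacter.LFunctionTrivChar₁ 1

theorem zet1_diff : Differentiable ℂ zet1 := DirichletCharacter.differentiable_LFunctionTrivChar₁ 1

theorem zet1_one : zet1 1 = 1 := by simp [zet1, DirichletCharacter.LFunctionTrivChar₁]

theorem zet1_ne {s : ℂ} (h : s ≠ 1) : zet1 s = (s - 1) * riemannZeta s := by
  simp [zet1, DirichletCharacter.LFunctionTrivChar₁, Function.update_of_ne h, DirichletCharacter.LFunctionTrivChar]

noncomputable def psiC {q1 q2 : ℕ} (χ1 : DirichletCharacter ℂ q1) (χ2 : DirichletCharacter ℂ q2) :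
    DirichletCharacter ℂ (q1 * q2) :=
  DirichletCharacter.changeLevel (dvd_mul_right q1 q2) χ1 *
    DirichletCharacter.changeLevel (dvd_mul_left q2 q1) χ2

theorem psiC_apply {q1 q2 : ℕ} (χ1 : DirichletCharacter ℂ q1) (χ2 : DirichletCharacter ℂ q2) (n : ℕ) :
    psiC χ1 χ2 n = χ1 n * χ2 n := by
  rw [psiC, MulChar.mul_apply]
  by_cases h : n.Coprime (q1 * q2)
  · have h1 := DirichletCharacter.changeLevel_eq_cast_of_dvd' χ1 (dvd_mul_right q1 q2)
      (a := n) (by exact_mod_cast Nat.isCoprime_iff_coprime.mpr h)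
    have h2 := DirichletCharacter.changeLevel_eq_cast_of_dvd' χ2 (dvd_mul_left q2 q1)
      (a := n) (by exact_mod_cast Nat.isCoprime_iff_coprime.mpr h)
    push_cast at h1 h2
    rw [h1, h2]
  · rw [MulChar.map_nonunit _ (by rwa [ZMod.isUnit_iff_coprime]), zero_mul]
    rw [Nat.coprime_mul_iff_right, not_and_or] at h
    rcases h with h | h
    · rw [MulChar.map_nonunit χ1 (by rwa [ZMod.isUnit_iff_coprime]), zero_mul]
    · rw [MulChar.map_nonunit χ2 (by rwa [ZMod.isUnit_iff_coprime]), mul_zero]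

noncomputable def Jf {q1 q2 : ℕ} [NeZero q1] [NeZero q2] (χ1 : DirichletCharacter ℂ q1)
    (χ2 : DirichletCharacter ℂ q2) (s : ℂ) : ℂ :=
  zet1 s * χ1.LFunction s * χ2.LFunction s * (psiC χ1 χ2).LFunction s

theorem quad_val {q : ℕ} (χ : DirichletCharacter ℂ q) (h : χ ^ 2 = 1) (n : ℕ) :
    ∃ r : ℝ, 0 ≤ r ∧ 1 + χ n = r := by
  rcases (MulChar.isQuadratic_iff_sq_eq_one.mpr h) n with h | h | h <;> rw [h]
  · exact ⟨1, by norm_num, by simp⟩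
  · exact ⟨2, by norm_num, by norm_num⟩
  · exact ⟨0, by norm_num, by simp⟩

theorem dlog_summable {q : ℕ} (χ : DirichletCharacter ℂ q) {s : ℂ} (hs : 1 < s.re) :
    LSeriesSummable (fun n => χ n * ArithmeticFunction.vonMangoldt n / Real.log n) s := by
  refine LSeriesSummable_of_bounded_of_one_lt_re (m := 1) (fun n hn => ?_) hs
  rw [norm_div, norm_mul, Complex.norm_real, Complex.norm_real, Real.norm_eq_abs, Real.norm_eq_abs,
    abs_of_nonneg (ArithmeticFunction.vonMangoldt_nonneg), abs_of_nonneg (Real.log_natCast_nonneg n)]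
  refine div_le_one_of_le₀ ?_ (Real.log_natCast_nonneg n)
  calc _ ≤ 1 * Real.log n := mul_le_mul (χ.norm_le_one _) ArithmeticFunction.vonMangoldt_le_log
        ArithmeticFunction.vonMangoldt_nonneg (by norm_num)
    _ = _ := one_mul _

noncomputable def acoef {q1 q2 : ℕ} (χ1 : DirichletCharacter ℂ q1)
    (χ2 : DirichletCharacter ℂ q2) (n : ℕ) : ℂ :=
  (1 + χ1 n) * (1 + χ2 n) * ArithmeticFunction.vonMangoldt n / Real.log n

open ComplexOrder in
theorem acoef_props {q1 q2 : ℕ} [NeZero q1] [NeZero q2] (χ1 : DirichletCharacter ℂ q1)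
    (χ2 : DirichletCharacter ℂ q2) (h1 : χ1 ^ 2 = 1) (h2 : χ2 ^ 2 = 1) :
    0 ≤ acoef χ1 χ2 ∧ LSeries.abscissaOfAbsConv (acoef χ1 χ2) ≤ 1 ∧
    ∀ s : ℂ, 1 < s.re → Jf χ1 χ2 s = (s - 1) * Complex.exp (LSeries (acoef χ1 χ2) s) := by
  have e : acoef χ1 χ2 = (fun n : ℕ => (1 : DirichletCharacter ℂ 1) n * ArithmeticFunction.vonMangoldt n / Real.log n)
      + (fun n : ℕ => χ1 n * ArithmeticFunction.vonMangoldt n / Real.log n)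
      + (fun n : ℕ => χ2 n * ArithmeticFunction.vonMangoldt n / Real.log n)
      + (fun n : ℕ => psiC χ1 χ2 n * ArithmeticFunction.vonMangoldt n / Real.log n) := by
    funext n
    simp only [acoef, Pi.add_apply, psiC_apply, MulChar.one_apply (isUnit_of_subsingleton _)]
    ring
  refine ⟨fun n => ?_, ?_, fun s hs => ?_⟩
  · obtain ⟨r1, hr1, e1⟩ := quad_val χ1 h1 n
    obtain ⟨r2, hr2, e2⟩ := quad_val χ2 h2 n
    rw [acoef, e1, e2]
    have : 0 ≤ r1 * r2 * ArithmeticFunction.vonMangoldt n / Real.log n :=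
      div_nonneg (mul_nonneg (mul_nonneg hr1 hr2) ArithmeticFunction.vonMangoldt_nonneg)
        (Real.log_natCast_nonneg n)
    have t2 : (0:ℂ) ≤ ((r1 * r2 * ArithmeticFunction.vonMangoldt n / Real.log n : ℝ) : ℂ) := by
      exact_mod_cast this
    simpa using t2
  · refine LSeries.abscissaOfAbsConv_le_of_forall_lt_LSeriesSummable (x := 1) fun y hy => ?_
    rw [e]
    have hy' : 1 < (y:ℂ).re := by simpa using hy
    exact (((dlog_summable _ hy').add (dlog_summable _ hy')).add (dlog_summable _ hy')).add
      (dlog_summable _ hy')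
  · have hne : s ≠ 1 := by rintro rfl; simp at hs
    rw [e, LSeries_add (((dlog_summable _ hs).add (dlog_summable _ hs)).add (dlog_summable _ hs))
      (dlog_summable _ hs), LSeries_add ((dlog_summable _ hs).add (dlog_summable _ hs)) (dlog_summable _ hs),
      LSeries_add (dlog_summable _ hs) (dlog_summable _ hs), Complex.exp_add, Complex.exp_add, Complex.exp_add]
    simp only [DirichletCharacter.LSeries_eq_exp_LSeries _ hs]
    rw [Jf, zet1_ne hne, ← DirichletCharacter.LFunction_modOne_eq (χ := 1)]
    simp only [DirichletCharacter.LFunction_eq_LSeries _ hs]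
    ring

theorem Jf_diff {q1 q2 : ℕ} [NeZero q1] [NeZero q2] (χ1 : DirichletCharacter ℂ q1)
    (χ2 : DirichletCharacter ℂ q2) (h1 : χ1 ≠ 1) (h2 : χ2 ≠ 1) (h3 : psiC χ1 χ2 ≠ 1) :
    Differentiable ℂ (Jf χ1 χ2) :=
  ((zet1_diff.mul (DirichletCharacter.differentiable_LFunction h1)).mul
    (DirichletCharacter.differentiable_LFunction h2)).mul (DirichletCharacter.differentiable_LFunction h3)

theorem Jf_bound : ∃ K0 : ℝ, 1 ≤ K0 ∧ ∀ (q1 q2 : ℕ) [NeZero q1] [NeZero q2] (χ1 : DirichletCharacter ℂ q1)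
    (χ2 : DirichletCharacter ℂ q2), χ1 ≠ 1 → χ2 ≠ 1 → psiC χ1 χ2 ≠ 1 →
    ∀ s ∈ Metric.sphere (2:ℂ) (3 / 2), ‖Jf χ1 χ2 s‖ ≤ K0 * (q1 * q2) ^ 2 := by
  obtain ⟨C, hC, hL⟩ := L_upper' (1 / 2) (by norm_num) le_rfl
  obtain ⟨Z, hZ⟩ := (isCompact_sphere (2:ℂ) (3 / 2)).exists_bound_of_continuousOn zet1_diff.continuous.continuousOn
  refine ⟨(|Z| + 1) * (4 * C) ^ 3, ?_, ?_⟩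
  · have : 1 ≤ (4 * C) ^ 3 := one_le_pow₀ (by linarith)
    nlinarith [abs_nonneg Z]
  intro q1 q2 _ _ χ1 χ2 h1 h2 h3 s hs
  have hs' : ‖s - 2‖ = 3 / 2 := by simpa [dist_eq_norm] using hs
  have hre : |s.re - 2| ≤ 3 / 2 := by simpa [hs'] using Complex.abs_re_le_norm (s - 2)
  have him : |s.im| ≤ 3 / 2 := by simpa [hs'] using Complex.abs_im_le_norm (s - 2)
  have b : ∀ (q : ℕ) [NeZero q] (χ : DirichletCharacter ℂ q), χ ≠ 1 → ‖χ.LFunction s‖ ≤ 4 * C * q := by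
    intro q _ χ hχ
    have := hL q χ s hχ (by linarith [(abs_le.mp hre).1]) (by linarith [(abs_le.mp hre).2])
    norm_num at this
    calc _ ≤ _ := this
      _ ≤ C * (q * (3 / 2 + 2)) := by gcongr
      _ ≤ _ := by nlinarith [(Nat.cast_nonneg q : (0:ℝ) ≤ q)]
  have b3 := b _ _ h3
  push_cast at b3
  have hz : ‖zet1 s‖ ≤ |Z| + 1 := (hZ s hs).trans (by linarith [le_abs_self Z])
  rw [Jf, norm_mul, norm_mul, norm_mul]
  calc _ ≤ (|Z| + 1) * (4 * C * q1) * (4 * C * q2) * (4 * C * (q1 * q2)) := by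
        gcongr
        · exact b _ _ h1
        · exact b _ _ h2
    _ = _ := by ring

theorem siegel_core (ε : ℝ) (hε : 0 < ε) (hε1 : ε ≤ 1) (q1 : ℕ) [NeZero q1] (χ1 : DirichletCharacter ℂ q1)
    (h1 : χ1 ≠ 1) (h1s : χ1 ^ 2 = 1) (β : ℝ) (hβ : 3 / 4 ≤ β) (hβ1 : β < 1) (hβε : 1 - β ≤ ε / 48) :
    ∃ c : ℝ, 0 < c ∧ ∀ (q2 : ℕ) [NeZero q2] (χ2 : DirichletCharacter ℂ q2), χ2 ≠ 1 → χ2 ^ 2 = 1 →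
    psiC χ1 χ2 ≠ 1 → 0 ≤ (Jf χ1 χ2 β).re → c * (q2:ℝ) ^ (-ε) ≤ ‖χ2.LFunction 1‖ := by
  obtain ⟨K0, hK0, hK⟩ := Jf_bound
  obtain ⟨C, hC, hL⟩ := L_upper' (ε / 4) (by linarith) (by linarith)
  set η := 1 - β with hη
  have hη0 : 0 < η := by linarith
  have hq1 : (1:ℝ) ≤ q1 := by exact_mod_cast Nat.pos_of_ne_zero (NeZero.ne q1)
  set A := 20 * K0 * q1 ^ 2 / η with hA
  have hA0 : 0 < A := by positivity
  set D := A ^ (ε / 8) * (‖χ1.LFunction 1‖ + 1) * (C * (2 * q1) ^ (ε / 2)) with hD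
  have hD0 : 0 < D := by positivity
  refine ⟨η / (2 * Real.exp 1) / D, by positivity, fun q2 _ χ2 h2 h2s h3 hJ => ?_⟩
  have hq2 : (1:ℝ) ≤ q2 := by exact_mod_cast Nat.pos_of_ne_zero (NeZero.ne q2)
  obtain ⟨a1, a2, a3⟩ := acoef_props χ1 χ2 h1s h2s
  set K := K0 * (q1 * q2 : ℝ) ^ 2 with hKd
  have est := (est_cplx a1 a2 (Jf χ1 χ2) (Jf_diff χ1 χ2 h1 h2 h3) a3 K
    (hK q1 q2 χ1 χ2 h1 h2 h3)).2 β hβ1 hβ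
  have hK1 : 1 ≤ K := by
    have : (1:ℝ) ≤ (q1 * q2 : ℝ) ^ 2 := one_le_pow₀ (by nlinarith)
    nlinarith
  set X := 20 * K / η with hX
  have hX1 : 1 ≤ X := by rw [hX, le_div_iff₀ hη0]; linarith
  have hX0 : 0 < X := by linarith
  have hlX : 0 ≤ Real.log X := Real.log_nonneg hX1
  set M := ⌈6 * Real.log X⌉₊ with hM
  have hM1 : 6 * Real.log X ≤ M := Nat.le_ceil _
  have hM2 : (M:ℝ) < 6 * Real.log X + 1 := Nat.ceil_lt_add_one (by positivity)
  have e1 := est M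
  have p1 : ((5:ℝ) / 6) ^ (M + 1) ≤ 1 / X := by
    have h56 : Real.log (5 / 6) ≤ -(1 / 6) := by
      have := Real.log_le_sub_one_of_pos (by norm_num : (0:ℝ) < 5 / 6); linarith
    calc ((5:ℝ) / 6) ^ (M + 1) = Real.exp (Real.log (5 / 6) * ((M + 1 : ℕ):ℝ)) := by
          rw [← Real.rpow_natCast, Real.rpow_def_of_pos (by norm_num)]
      _ ≤ Real.exp (- Real.log X) := by
          apply Real.exp_le_exp.mpr; push_cast; nlinarith
      _ = 1 / X := by rw [Real.exp_neg, Real.exp_log hX0, one_div]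
  have p2 : (2 - β) ^ (M + 1) ≤ Real.exp 1 * X ^ (ε / 8) := by
    have : 2 - β ≤ Real.exp η := by linarith [Real.add_one_le_exp η]
    calc (2 - β) ^ (M + 1) ≤ (Real.exp η) ^ (M + 1) := by gcongr; linarith
      _ = Real.exp (η * (M + 1)) := by rw [← Real.exp_nat_mul]; push_cast; ring_nf
      _ ≤ Real.exp (1 + Real.log X * (ε / 8)) := by
          apply Real.exp_le_exp.mpr; nlinarith
      _ = _ := by rw [Real.exp_add, Real.rpow_def_of_pos hX0]
  have p3 : 10 * K * (5 / 6) ^ (M + 1) ≤ η / 2 := by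
    calc _ ≤ 10 * K * (1 / X) := by gcongr
      _ = _ := by rw [hX]; field_simp; norm_num
  have p4 : η / 2 ≤ ‖Jf χ1 χ2 1‖ * (Real.exp 1 * X ^ (ε / 8)) := by
    have : ‖Jf χ1 χ2 1‖ * (2 - β) ^ (M + 1) ≤ ‖Jf χ1 χ2 1‖ * (Real.exp 1 * X ^ (ε / 8)) := by gcongr
    linarith
  have hq2p : (0:ℝ) < q2 := by linarith
  have p5 : X ^ (ε / 8) = A ^ (ε / 8) * (q2:ℝ) ^ (ε / 4) := by
    rw [show X = A * (q2:ℝ) ^ 2 by rw [hX, hA, hKd]; ring, Real.mul_rpow hA0.le (by positivity),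
      ← Real.rpow_natCast (q2:ℝ) 2, ← Real.rpow_mul hq2p.le]
    congr 2; push_cast; ring
  have p6 : ‖(psiC χ1 χ2).LFunction 1‖ ≤ C * (2 * q1) ^ (ε / 2) * (q2:ℝ) ^ (ε / 2) := by
    have := hL _ (psiC χ1 χ2) 1 h3 (by simp; linarith) (by simp)
    simp only [Complex.one_im, abs_zero, zero_add, Nat.cast_mul] at this
    rw [show (q1 * q2 : ℝ) * 2 = (2 * q1) * q2 by ring, show 2 * (ε / 4) = ε / 2 by ring,
      Real.mul_rpow (by positivity) (by positivity)] at this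
    linarith
  have p7 : ‖Jf χ1 χ2 1‖ ≤ (‖χ1.LFunction 1‖ + 1) * ‖χ2.LFunction 1‖ *
      (C * (2 * q1) ^ (ε / 2) * (q2:ℝ) ^ (ε / 2)) := by
    rw [Jf, norm_mul, norm_mul, norm_mul, zet1_one, norm_one, one_mul]
    gcongr; linarith
  have p8 : η / 2 ≤ ‖χ2.LFunction 1‖ * D * Real.exp 1 * (q2:ℝ) ^ ε := by
    calc _ ≤ _ := p4
      _ ≤ ((‖χ1.LFunction 1‖ + 1) * ‖χ2.LFunction 1‖ *
      (C * (2 * q1) ^ (ε / 2) * (q2:ℝ) ^ (ε / 2))) * (Real.exp 1 * (A ^ (ε / 8) * (q2:ℝ) ^ (ε / 4))) := by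
          rw [p5]; gcongr
      _ = ‖χ2.LFunction 1‖ * D * Real.exp 1 * ((q2:ℝ) ^ (ε / 2) * (q2:ℝ) ^ (ε / 4)) := by rw [hD]; ring
      _ ≤ _ := by
        gcongr
        rw [← Real.rpow_add hq2p]
        exact Real.rpow_le_rpow_of_exponent_le hq2 (by linarith)
  rw [Real.rpow_neg hq2p.le, div_div, ← div_eq_mul_inv, div_div, div_le_iff₀ (by positivity)]
  linarith

theorem quad_change {q1 : ℕ} [NeZero q1] (χ1 : DirichletCharacter ℂ q1) (h1 : χ1 ≠ 1)
    (h1s : χ1 ^ 2 = 1) (ε : ℝ) (hε : 0 < ε) : ∃ c : ℝ, 0 < c ∧ ∀ (q2 : ℕ) [NeZero q2]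
    (χ2 : DirichletCharacter ℂ q2), χ2 ≠ 1 → 
    psiC χ1 χ2 = 1 → c * (q2:ℝ) ^ (-ε) ≤ ‖χ2.LFunction 1‖ := by
  have hL1 : 0 < ‖χ1.LFunction 1‖ := norm_pos_iff.mpr (DirichletCharacter.LFunction_apply_one_ne_zero h1)
  have hq1 : (1:ℝ) ≤ q1 := by exact_mod_cast Nat.pos_of_ne_zero (NeZero.ne q1)
  set A := (1 + 4 / ε) * (q1:ℝ) ^ (ε / 2) with hA
  have hA0 : 0 < A := by positivity
  refine ⟨‖χ1.LFunction 1‖ / A ^ 2, by positivity, fun q2 _ χ2 h2 h => ?_⟩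
  have hq2 : (1:ℝ) ≤ q2 := by exact_mod_cast Nat.pos_of_ne_zero (NeZero.ne q2)
  have hc : DirichletCharacter.changeLevel (dvd_mul_left q2 q1) χ2 =
      DirichletCharacter.changeLevel (dvd_mul_right q1 q2) χ1 := by
    have e : DirichletCharacter.changeLevel (dvd_mul_right q1 q2) χ1 *
      DirichletCharacter.changeLevel (dvd_mul_right q1 q2) χ1 = 1 := by
      rw [← map_mul, ← sq, h1s, map_one]
    rw [psiC] at h
    exact mul_left_cancel (h.trans e.symm)
  have e1 := DirichletCharacter.LFunction_changeLevel (dvd_mul_right q1 q2) χ1 (s := 1) (Or.inl h1)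
  have e2 := DirichletCharacter.LFunction_changeLevel (dvd_mul_left q2 q1) χ2 (s := 1) (Or.inl h2)
  rw [hc, e1] at e2
  have hN : 1 ≤ q1 * q2 := Nat.pos_of_ne_zero (NeZero.ne _)
  set P := ∏ p ∈ (q1 * q2).primeFactors, (1 - 1 / (p : ℝ)) with hP
  have hPl := phi_lower (q1 * q2) hN
  have hp2 : ∀ p ∈ (q1 * q2).primeFactors, (2:ℝ) ≤ p := fun p hp => by
    exact_mod_cast (Nat.prime_of_mem_primeFactors hp).two_le
  have hfac : ∀ z : ℂ, ∀ p ∈ (q1 * q2).primeFactors, ‖z‖ ≤ 1 →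
      1 - 1 / (p:ℝ) ≤ ‖1 - z * (p:ℂ) ^ (-1:ℂ)‖ ∧ ‖1 - z * (p:ℂ) ^ (-1:ℂ)‖ ≤ (1 - 1 / (p:ℝ))⁻¹ := by
    intro z p hp hz
    have h2p := hp2 p hp
    have hn : ‖z * (p:ℂ) ^ (-1:ℂ)‖ ≤ 1 / p := by
      rw [Complex.cpow_neg_one, norm_mul, norm_inv, Complex.norm_natCast, one_div]
      exact mul_le_of_le_one_left (by positivity) hz
    have hpos : 0 < 1 - 1 / (p:ℝ) := by
      rw [sub_pos, div_lt_one (by linarith)]; linarith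
    constructor
    · have := norm_sub_norm_le (1:ℂ) (z * (p:ℂ) ^ (-1:ℂ)); rw [norm_one] at this; linarith
    · have := norm_sub_le (1:ℂ) (z * (p:ℂ) ^ (-1:ℂ)); rw [norm_one] at this
      refine this.trans ?_
      rw [le_inv_comm₀ (by positivity) hpos, ← one_div, le_div_iff₀ (by positivity)]
      have h0 : (0:ℝ) ≤ 1 / p := by positivity
      nlinarith
  have hpos : ∀ p ∈ (q1 * q2).primeFactors, 0 ≤ 1 - 1 / (p:ℝ) := fun p hp => by
    have := hp2 p hp
    rw [sub_nonneg, div_le_one (by linarith)]; linarith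
  have l1 : P ≤ ‖∏ p ∈ (q1 * q2).primeFactors, (1 - χ1 p * (p:ℂ) ^ (-1:ℂ))‖ := by
    rw [norm_prod]
    exact Finset.prod_le_prod hpos fun p hp => (hfac _ p hp (χ1.norm_le_one _)).1
  have l2 : ‖∏ p ∈ (q1 * q2).primeFactors, (1 - χ2 p * (p:ℂ) ^ (-1:ℂ))‖ ≤ P⁻¹ := by
    rw [norm_prod, hP, ← Finset.prod_inv_distrib]
    exact Finset.prod_le_prod (fun p _ => norm_nonneg _) fun p hp => (hfac _ p hp (χ2.norm_le_one _)).2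
  have hlog : 1 + 2 * Real.log ((q1 * q2 : ℕ):ℝ) ≤ A * (q2:ℝ) ^ (ε / 2) := by
    push_cast
    have hqq : (1:ℝ) ≤ q1 * q2 := by nlinarith
    have h5 := Real.log_le_rpow_div (by linarith : (0:ℝ) ≤ q1 * q2) (half_pos hε)
    have h6 : 1 ≤ (q1 * q2 : ℝ) ^ (ε / 2) := Real.one_le_rpow hqq (by positivity)
    rw [hA, mul_assoc, ← Real.mul_rpow (by positivity) (by positivity)]
    have : (q1 * q2 : ℝ) ^ (ε / 2) / (ε / 2) = 2 / ε * (q1 * q2 : ℝ) ^ (ε / 2) := by field_simp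
    have h8 : (4 / ε) = 2 * (2 / ε) := by ring
    rw [h8]
    nlinarith
  set Y := 1 + 2 * Real.log ((q1 * q2 : ℕ):ℝ) with hY
  have hY0 : 0 < Y := by have := Real.log_natCast_nonneg (q1 * q2); linarith
  have hP0 : 0 < P := lt_of_lt_of_le (by positivity) hPl
  have m1 : ‖χ1.LFunction 1‖ * P ≤ ‖χ2.LFunction 1‖ * P⁻¹ := by
    calc _ ≤ _ := mul_le_mul_of_nonneg_left l1 hL1.le
      _ = _ := by rw [← norm_mul, e2, norm_mul]
      _ ≤ _ := by gcongr
  have m2 : P⁻¹ ≤ Y := by rw [inv_le_comm₀ hP0 hY0, ← one_div]; exact hPl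
  have m3 : ‖χ1.LFunction 1‖ ≤ ‖χ2.LFunction 1‖ * Y ^ 2 := by
    calc ‖χ1.LFunction 1‖ = ‖χ1.LFunction 1‖ * P * P⁻¹ := by field_simp
      _ ≤ (‖χ2.LFunction 1‖ * P⁻¹) * P⁻¹ := by gcongr
      _ ≤ ‖χ2.LFunction 1‖ * Y * Y := by gcongr
      _ = _ := by ring
  have hq2p : (0:ℝ) < q2 := by linarith
  rw [Real.rpow_neg hq2p.le, ← div_eq_mul_inv, div_div, div_le_iff₀ (by positivity)]
  calc _ ≤ _ := m3
    _ ≤ ‖χ2.LFunction 1‖ * (A * (q2:ℝ) ^ (ε / 2)) ^ 2 := by gcongr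
    _ = _ := by rw [mul_pow, ← Real.rpow_natCast ((q2:ℝ) ^ (ε / 2)), ← Real.rpow_mul hq2p.le]; norm_num

theorem siegel (ε : ℝ) (hε : 0 < ε) (hε1 : ε ≤ 1) : ∃ c : ℝ, 0 < c ∧ ∀ (q : ℕ) [NeZero q]
    (χ : DirichletCharacter ℂ q), χ ≠ 1 → χ ^ 2 = 1 → c * (q:ℝ) ^ (-ε) ≤ ‖χ.LFunction 1‖ := by
  suffices h : (∃ (q1 : ℕ) (_ : NeZero q1) (χ1 : DirichletCharacter ℂ q1), χ1 ≠ 1 ∧ χ1 ^ 2 = 1) →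
      ∃ (q1 : ℕ) (_ : NeZero q1) (χ1 : DirichletCharacter ℂ q1) (β : ℝ), χ1 ≠ 1 ∧ χ1 ^ 2 = 1 ∧
      3 / 4 ≤ β ∧ β < 1 ∧ 1 - β ≤ ε / 48 ∧ ∀ (q2 : ℕ) [NeZero q2] (χ2 : DirichletCharacter ℂ q2), χ2 ≠ 1 →
      χ2 ^ 2 = 1 → psiC χ1 χ2 ≠ 1 → 0 ≤ (Jf χ1 χ2 β).re by
    by_cases he : ∃ (q1 : ℕ) (_ : NeZero q1) (χ1 : DirichletCharacter ℂ q1), χ1 ≠ 1 ∧ χ1 ^ 2 = 1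
    · obtain ⟨q1, _, χ1, β, a1, a2, a3, a4, a5, a6⟩ := h he
      obtain ⟨c1, hc1, b1⟩ := siegel_core ε hε hε1 q1 χ1 a1 a2 β a3 a4 a5
      obtain ⟨c2, hc2, b2⟩ := quad_change χ1 a1 a2 ε hε
      refine ⟨min c1 c2, lt_min hc1 hc2, fun q2 _ χ2 h2 h2s => ?_⟩
      by_cases hp : psiC χ1 χ2 = 1
      · exact le_trans (by gcongr; exact min_le_right _ _) (b2 q2 χ2 h2 hp)
      · exact le_trans (by gcongr; exact min_le_left _ _) (b1 q2 χ2 h2 h2s hp (a6 q2 χ2 h2 h2s hp))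
    · exact ⟨1, one_pos, fun q _ χ h1 h2 => (he ⟨q, inferInstance, χ, h1, h2⟩).elim⟩
  rintro ⟨q1, _, χ1, h1, h1s⟩
  have hη : ∃ β : ℝ, 3 / 4 ≤ β ∧ β < 1 ∧ 1 - β ≤ ε / 48 := ⟨1 - ε / 48, by linarith, by linarith, by linarith⟩
  by_cases hz : ∃ (q1 : ℕ) (_ : NeZero q1) (χ1 : DirichletCharacter ℂ q1) (β : ℝ), χ1 ≠ 1 ∧ χ1 ^ 2 = 1 ∧
      3 / 4 ≤ β ∧ β < 1 ∧ 1 - β ≤ ε / 48 ∧ zet1 β * χ1.LFunction β = 0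
  · obtain ⟨q1, _, χ1, β, a1, a2, a3, a4, a5, a6⟩ := hz
    refine ⟨q1, inferInstance, χ1, β, a1, a2, a3, a4, a5, fun q2 _ χ2 h2 h2s hp => ?_⟩
    rw [Jf, a6]; simp
  · push Not at hz
    obtain ⟨β, hb1, hb2, hb3⟩ := hη
    refine ⟨q1, inferInstance, χ1, β, h1, h1s, hb1, hb2, hb3, fun q2 _ χ2 h2 h2s hp => ?_⟩
    have hps : psiC χ1 χ2 ^ 2 = 1 := by
      rw [psiC, mul_pow, ← map_pow, ← map_pow, h1s, h2s, map_one, map_one, one_mul]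
    obtain ⟨a1, a2, a3⟩ := acoef_props χ1 χ2 h1s h2s
    have hd := Jf_diff χ1 χ2 h1 h2 hp
    have hreal := (est_cplx a1 a2 (Jf χ1 χ2) hd a3 _ (fun s hs => (Jf_bound.choose_spec.2 q1 q2 χ1 χ2 h1 h2 hp) s hs)).1
    have hne : ∀ x : ℝ, β ≤ x → Jf χ1 χ2 x ≠ 0 := by
      intro x hx
      rcases lt_or_ge x 1 with hx1 | hx1
      · have t1 := hz q1 inferInstance χ1 x h1 h1s (by linarith) hx1 (by linarith)
        have t2 := hz q2 inferInstance χ2 x h2 h2s (by linarith) hx1 (by linarith)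
        have t3 := hz (q1 * q2) inferInstance (psiC χ1 χ2) x hp hps (by linarith) hx1 (by linarith)
        rw [mul_ne_zero_iff] at t1 t2 t3
        exact mul_ne_zero (mul_ne_zero (mul_ne_zero t1.1 t1.2) t2.2) t3.2
      · have n : ∀ (q : ℕ) [NeZero q] (χ : DirichletCharacter ℂ q), χ ≠ 1 → χ.LFunction x ≠ 0 := fun q _ χ h =>
          DirichletCharacter.LFunction_ne_zero_of_one_le_re χ (Or.inl h) (by simpa using hx1)
        refine mul_ne_zero (mul_ne_zero (mul_ne_zero ?_ (n _ _ h1)) (n _ _ h2)) (n _ _ hp)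
        by_cases hx2 : (x:ℂ) = 1
        · rw [hx2, zet1_one]; exact one_ne_zero
        · rw [zet1_ne hx2]
          exact mul_ne_zero (sub_ne_zero.mpr hx2) (riemannZeta_ne_zero_of_one_le_re (by simpa using hx1))
    by_contra hneg
    push Not at hneg
    have h2pos : 0 ≤ (Jf χ1 χ2 ((2:ℝ):ℂ)).re := by
      rw [a3 _ (by norm_num)]
      have hab2 : LSeries.abscissaOfAbsConv (acoef χ1 χ2) < ((2:ℝ):EReal) :=
        lt_of_le_of_lt a2 (by exact_mod_cast (by norm_num : (1:ℝ) < 2))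
      have h0 := LSeries.iteratedDeriv_alternating a1 hab2 0
      simp only [pow_zero, one_mul, iteratedDeriv_zero] at h0
      obtain ⟨r, hr, hr2⟩ := cnn h0
      rw [← hr2, ← Complex.ofReal_exp, show (((2:ℝ):ℂ) - 1) = ((1:ℝ):ℂ) by norm_num, ← Complex.ofReal_mul,
        Complex.ofReal_re]
      positivity
    have hcont : Continuous fun x : ℝ => (Jf χ1 χ2 x).re :=
      Complex.continuous_re.comp (hd.continuous.comp Complex.continuous_ofReal)
    obtain ⟨x, hx, hx0⟩ := intermediate_value_Icc (by linarith : β ≤ 2) hcont.continuousOn ⟨hneg.le, h2pos⟩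
    apply hne x hx.1
    rw [hreal x]
    exact_mod_cast hx0

def good {q : ℕ} (χ : DirichletCharacter ℂ q) (t : ℝ) : Prop := χ ≠ 1 ∨ (q = 1 ∧ 1 ≤ |t|)

theorem disc_bound (σ : ℝ) (hσ : 0 < σ) (hσ1 : σ ≤ 1 / 8) : ∃ C : ℝ, 1 ≤ C ∧ ∀ (q : ℕ) [NeZero q]
    (χ : DirichletCharacter ℂ q) (s : ℂ), good χ s.im → 1 ≤ s.re → s.re ≤ 2 →
    ∀ w ∈ Metric.closedBall s (4 * σ),
      ‖χ.LFunction w‖ ≤ C * ((q * (|s.im| + 2) : ℝ) ^ σ) ^ 8 ∧ DifferentiableAt ℂ χ.LFunction w := by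
  obtain ⟨C, hC, hL⟩ := L_upper (4 * σ) (by linarith) (by linarith)
  refine ⟨6 * C, by linarith, fun q _ χ s hg h1 h2 w hw => ?_⟩
  have hq : (1:ℝ) ≤ q := by exact_mod_cast Nat.pos_of_ne_zero (NeZero.ne q)
  have hw' : ‖w - s‖ ≤ 1 / 2 := by
    have : ‖w - s‖ ≤ 4 * σ := by simpa [dist_eq_norm] using hw
    linarith
  have hw4 : ‖w - s‖ ≤ 4 * σ := by simpa [dist_eq_norm] using hw
  have hre := (Complex.abs_re_le_norm (w - s)).trans hw4
  have him := (Complex.abs_im_le_norm (w - s)).trans hw'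
  rw [Complex.sub_re, abs_le] at hre
  rw [Complex.sub_im] at him
  have him2 : |w.im| ≤ |s.im| + 1 := by
    have := abs_sub_abs_le_abs_sub w.im s.im; linarith
  set τ : ℝ := q * (|s.im| + 2) with hτ
  have hτ0 : 0 < τ := by positivity
  have b1 : (q * (|w.im| + 2) : ℝ) ^ (2 * (4 * σ)) ≤ 2 * (τ ^ σ) ^ 8 := by
    calc _ ≤ (2 * τ) ^ (2 * (4 * σ)) := by
          refine Real.rpow_le_rpow (by positivity) ?_ (by positivity)
          rw [hτ]; nlinarith [abs_nonneg s.im]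
      _ = 2 ^ (2 * (4 * σ)) * (τ ^ σ) ^ 8 := by
          rw [Real.mul_rpow (by norm_num) hτ0.le, ← Real.rpow_natCast (τ ^ σ), ← Real.rpow_mul hτ0.le]
          congr 2; push_cast; ring
      _ ≤ 2 ^ (1:ℝ) * (τ ^ σ) ^ 8 := by
          gcongr
          · norm_num
          · linarith
      _ = _ := by norm_num
  have hT : 0 ≤ (τ ^ σ) ^ 8 := by positivity
  rcases hg with hg | ⟨rfl, ht⟩
  · refine ⟨?_, DirichletCharacter.differentiable_LFunction hg w⟩
    by_cases hw1 : w = 1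
    · subst hw1
      have hcl : Tendsto (fun x : ℝ => ‖χ.LFunction (1 + x)‖) (nhdsWithin 0 (Set.Ioi 0)) (nhds ‖χ.LFunction 1‖) := by
        have hc : Continuous χ.LFunction := (DirichletCharacter.differentiable_LFunction hg).continuous
        have : Continuous fun x : ℝ => ‖χ.LFunction (1 + x)‖ := by fun_prop
        have := (this.tendsto 0).mono_left (nhdsWithin_le_nhds (s := Set.Ioi 0))
        simpa using this
      refine le_of_tendsto hcl ?_
      filter_upwards [Ioo_mem_nhdsGT (show (0:ℝ) < 1 by norm_num)] with x hx
      have := hL q χ (1 + x) (by simp; linarith [hx.1]) (by simp; linarith [hx.2]) (by simpa using hx.1.ne')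
      rw [kap_zero χ hg, norm_zero, zero_div, add_zero, mul_one] at this
      calc _ ≤ _ := this
        _ ≤ C * (2 * (τ ^ σ) ^ 8) := by gcongr; simpa using b1
        _ ≤ _ := by nlinarith
    · have := hL q χ w (by linarith) (by linarith) hw1
      rw [kap_zero χ hg, norm_zero, zero_div, add_zero, mul_one] at this
      calc _ ≤ _ := this
        _ ≤ C * (2 * (τ ^ σ) ^ 8) := by gcongr
        _ ≤ _ := by nlinarith
  · have hwi : 1 / 2 ≤ |w.im| := by
      have := abs_sub_abs_le_abs_sub s.im w.im; rw [abs_sub_comm] at this; linarith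
    have hw1 : w ≠ 1 := by rintro rfl; norm_num at hwi
    have hn : 1 / 2 ≤ ‖w - 1‖ := hwi.trans (by simpa using Complex.abs_im_le_norm (w - 1))
    refine ⟨?_, DirichletCharacter.differentiableAt_LFunction χ w (Or.inl hw1)⟩
    have := hL 1 χ w (by linarith) (by linarith) hw1
    calc _ ≤ _ := this
      _ ≤ C * (2 * (τ ^ σ) ^ 8) * (1 + 1 / (1 / 2)) := by
        gcongr
        exact kap_norm χ
      _ = _ := by ring

theorem deriv_bound (σ : ℝ) (hσ : 0 < σ) (hσ1 : σ ≤ 1 / 8) : ∃ C : ℝ, 1 ≤ C ∧ ∀ (q : ℕ) [NeZero q]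
    (χ : DirichletCharacter ℂ q) (s : ℂ), good χ s.im → 1 ≤ s.re → s.re ≤ 2 →
      ‖deriv χ.LFunction s‖ ≤ C * ((q * (|s.im| + 2) : ℝ) ^ σ) ^ 8 := by
  obtain ⟨C, hC, hL⟩ := disc_bound σ hσ hσ1
  refine ⟨C / (4 * σ), ?_, fun q _ χ s hg h1 h2 => ?_⟩
  · rw [le_div_iff₀ (by positivity)]; linarith
  have h := hL q χ s hg h1 h2
  have := Complex.norm_deriv_le_of_forall_mem_sphere_norm_le (f := χ.LFunction) (c := s) (R := 4 * σ)
    (C := C * ((q * (|s.im| + 2) : ℝ) ^ σ) ^ 8) (by positivity)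
    (DifferentiableOn.diffContOnCl_ball (U := Metric.closedBall s (4 * σ)) (fun w hw => (h w hw).2.differentiableWithinAt)
      le_rfl)
    (fun w hw => (h w (Metric.sphere_subset_closedBall hw)).1)
  calc _ ≤ _ := this
    _ = _ := by ring

theorem mvt_bound {q : ℕ} [NeZero q] (χ : DirichletCharacter ℂ q) (K : ℝ) (S : Set ℂ) (hS : Convex ℝ S)
    (hd : ∀ w ∈ S, DifferentiableAt ℂ χ.LFunction w ∧ ‖deriv χ.LFunction w‖ ≤ K) {x y : ℂ} (hx : x ∈ S)
    (hy : y ∈ S) : ‖χ.LFunction y - χ.LFunction x‖ ≤ K * ‖y - x‖ :=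
  hS.norm_image_sub_le_of_norm_deriv_le (fun w hw => (hd w hw).1) (fun w hw => (hd w hw).2) hx hy

theorem fact1 : ∃ c : ℝ, 0 < c ∧ ∀ (q : ℕ) [NeZero q] (χ : DirichletCharacter ℂ q) (s : ℂ), 1 < s.re →
    s.re ≤ 2 → c * (s.re - 1) ≤ ‖χ.LFunction s‖ := by
  obtain ⟨C, hC, hL⟩ := L_upper (1 / 2) (by norm_num) le_rfl
  refine ⟨1 / (4 * C), by positivity, fun q _ χ s h1 h2 => ?_⟩
  have e : ∀ (q : ℕ) [NeZero q] (χ : DirichletCharacter ℂ q) (s : ℂ), 1 < s.re → ‖χ.LFunction s‖ =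
      Real.exp (LSeries (fun n => χ n * ArithmeticFunction.vonMangoldt n / Real.log n) s).re := fun q _ χ s h => by
    rw [DirichletCharacter.LFunction_eq_LSeries χ h, ← DirichletCharacter.LSeries_eq_exp_LSeries χ h,
      Complex.norm_exp]
  have h1' : 1 < ((s.re : ℝ) : ℂ).re := by simpa using h1
  have z := hL 1 1 (s.re : ℂ) (by simp; linarith) (by simp; linarith) (by
    intro h; rw [← Complex.ofReal_one, Complex.ofReal_inj] at h; linarith)
  have hz : ‖(1 : DirichletCharacter ℂ 1).LFunction (s.re : ℂ)‖ ≤ 4 * C / (s.re - 1) := by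
    calc _ ≤ _ := z
      _ ≤ C * 2 * (2 / (s.re - 1)) := by
        norm_num
        gcongr
        have hn : ‖((s.re:ℝ):ℂ) - 1‖ = s.re - 1 := by
          rw [← Complex.ofReal_one, ← Complex.ofReal_sub, Complex.norm_real, Real.norm_eq_abs, abs_of_pos (by linarith)]
        rw [hn, show 2 / (s.re - 1) = 1 / (s.re - 1) + 1 / (s.re - 1) by ring]
        gcongr
        · rw [le_div_iff₀ (by linarith)]; linarith
        · exact kap_norm _
      _ = _ := by ring
  rw [e 1 1 _ h1'] at hz
  rw [e q χ s h1]
  set D := LSeries (fun n => χ n * ArithmeticFunction.vonMangoldt n / Real.log n) s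
  set Z := LSeries (fun n : ℕ => (1 : DirichletCharacter ℂ 1) n * ArithmeticFunction.vonMangoldt n / Real.log n) (s.re : ℂ)
  have hDZ : ‖D‖ ≤ Z.re := by
    have s1 := dlog_summable χ h1
    have s2 := dlog_summable (1 : DirichletCharacter ℂ 1) h1'
    have hZ : HasSum (fun n => (LSeries.term (fun n : ℕ => (1 : DirichletCharacter ℂ 1) n *
      ArithmeticFunction.vonMangoldt n / Real.log n) (s.re : ℂ) n).re) Z.re := Complex.hasSum_re s2.hasSum
    refine tsum_of_norm_bounded hZ fun n => ?_
    rcases eq_or_ne n 0 with rfl | hn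
    · simp
    rw [LSeries.term_of_ne_zero hn, LSeries.term_of_ne_zero hn]
    have hn0 : (0:ℝ) ≤ n := by positivity
    rw [norm_div, norm_div, norm_mul, Complex.norm_natCast_cpow_of_pos (Nat.pos_of_ne_zero hn), Complex.norm_real,
      Complex.norm_real, Real.norm_eq_abs, Real.norm_eq_abs,
      abs_of_nonneg (ArithmeticFunction.vonMangoldt_nonneg), abs_of_nonneg (Real.log_natCast_nonneg n),
      MulChar.one_apply (isUnit_of_subsingleton _), one_mul, ← Complex.ofReal_natCast, ← Complex.ofReal_cpow hn0,
      ← Complex.ofReal_div, ← Complex.ofReal_div, Complex.ofReal_re]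
    have := Real.log_natCast_nonneg n
    gcongr
    exact mul_le_of_le_one_left ArithmeticFunction.vonMangoldt_nonneg (χ.norm_le_one _)
  have hD : -Z.re ≤ D.re := by
    have := (abs_le.mp (Complex.abs_re_le_norm D)).1; linarith
  calc 1 / (4 * C) * (s.re - 1) = (4 * C / (s.re - 1))⁻¹ := by rw [inv_div]; ring
    _ ≤ (Real.exp Z.re)⁻¹ := by gcongr
    _ = Real.exp (-Z.re) := by rw [Real.exp_neg]
    _ ≤ _ := Real.exp_le_exp.mpr hD

theorem prod341 (σ : ℝ) (hσ : 0 < σ) (hσ1 : σ ≤ 1 / 8) (κ : ℝ) (hκ : 0 < κ) (hκ1 : κ ≤ 1) : ∃ c : ℝ, 0 < c ∧ c ≤ 1 ∧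
    ∀ (q : ℕ) [NeZero q] (χ : DirichletCharacter ℂ q) (t x : ℝ), 0 < x → x ≤ 1 → good χ t →
    (χ ^ 2 ≠ 1 ∨ κ ≤ |t| * ((q * (|t| + 2) : ℝ) ^ σ) ^ 9) →
    x ^ 3 * c ^ 4 ≤ (‖χ.LFunction (1 + x + Complex.I * t)‖ * ((q * (|t| + 2) : ℝ) ^ σ) ^ 11) ^ 4 := by
  obtain ⟨C, hC, hL⟩ := L_upper (4 * σ) (by linarith) (by linarith)
  refine ⟨κ / (3 * C), by positivity, by rw [div_le_one (by positivity)]; linarith, fun q _ χ t x hx hx1 hg hcase => ?_⟩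
  have hq : (1:ℝ) ≤ q := by exact_mod_cast Nat.pos_of_ne_zero (NeZero.ne q)
  set τ : ℝ := q * (|t| + 2) with hτ
  have hτ1 : 1 ≤ τ := by rw [hτ]; nlinarith [abs_nonneg t]
  have hT1 : 1 ≤ τ ^ σ := Real.one_le_rpow hτ1 hσ.le
  have e8 : τ ^ (2 * (4 * σ)) = (τ ^ σ) ^ 8 := by
    rw [← Real.rpow_natCast (τ ^ σ), ← Real.rpow_mul (by linarith)]; congr 1; push_cast; ring
  set T := τ ^ σ with hT
  have key := DirichletCharacter.norm_LFunction_product_ge_one χ hx t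
  have ha : ‖DirichletCharacter.LFunctionTrivChar q (1 + x)‖ ≤ 2 * C * T ^ 8 / x := by
    have h := hL q 1 (1 + x) (by simp; linarith) (by simp; linarith) (by simpa using hx.ne')
    calc _ ≤ _ := h
      _ ≤ C * T ^ 8 * (1 / x + 1 / x) := by
        have hn : ‖(1 + x : ℂ) - 1‖ = x := by simp [abs_of_pos hx]
        rw [hn, ← e8]
        gcongr
        · simp [hτ]; gcongr; linarith [abs_nonneg t]
        · rw [le_div_iff₀ hx]; linarith
        · exact kap_norm _
      _ = _ := by ring
  have hb : ‖(χ ^ 2).LFunction (1 + x + 2 * Complex.I * t)‖ ≤ 4 * C / κ * T ^ 17 := by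
    have h := hL q (χ ^ 2) (1 + x + 2 * Complex.I * t) (by simp; linarith) (by simp; linarith) (by
      intro h; have := congrArg Complex.re h; simp at this; linarith)
    have hK : ‖kap (χ ^ 2)‖ / ‖(1 + x + 2 * Complex.I * t : ℂ) - 1‖ ≤ T ^ 9 / κ := by
      by_cases h2 : χ ^ 2 = 1
      · have hk : κ ≤ |t| * T ^ 9 := by
          rcases hcase with h | h
          · exact absurd h2 h
          · exact h
        have ht : 0 < |t| := by
          by_contra h0
          have : |t| = 0 := le_antisymm (not_lt.mp h0) (abs_nonneg t)
          rw [this] at hk; linarith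
        have hn : |t| ≤ ‖(1 + x + 2 * Complex.I * t : ℂ) - 1‖ := by
          refine le_trans ?_ (Complex.abs_im_le_norm _)
          simp [abs_mul]; linarith
        calc _ ≤ 1 / |t| := by gcongr; exact kap_norm _
          _ ≤ _ := by rw [div_le_div_iff₀ ht hκ]; linarith
      · rw [kap_zero _ h2, norm_zero, zero_div]; positivity
    have hT9 : 1 ≤ T ^ 9 / κ := by
      rw [le_div_iff₀ hκ]; exact (by linarith : 1 * κ ≤ 1).trans (one_le_pow₀ hT1)
    have b1 : (q * (|(1 + x + 2 * Complex.I * t : ℂ).im| + 2) : ℝ) ^ (2 * (4 * σ)) ≤ 2 * T ^ 8 := by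
      calc _ ≤ (2 * τ) ^ (2 * (4 * σ)) := by
            refine Real.rpow_le_rpow (by positivity) ?_ (by positivity)
            rw [hτ]; simp [abs_mul]; nlinarith [abs_nonneg t]
        _ = 2 ^ (2 * (4 * σ)) * T ^ 8 := by
            rw [Real.mul_rpow (by norm_num) (by linarith), e8]
        _ ≤ 2 ^ (1:ℝ) * T ^ 8 := by
            gcongr
            · norm_num
            · linarith
        _ = _ := by norm_num
    calc _ ≤ _ := h
      _ ≤ C * (2 * T ^ 8) * (T ^ 9 / κ + T ^ 9 / κ) := by gcongr
      _ = _ := by ring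
  set ℓ := ‖χ.LFunction (1 + x + Complex.I * t)‖
  rw [norm_mul, norm_mul, norm_pow, norm_pow] at key
  have h1 : 1 ≤ (2 * C * T ^ 8 / x) ^ 3 * ℓ ^ 4 * (4 * C / κ * T ^ 17) := by
    refine key.le.trans ?_
    gcongr
  have e : (2 * C * T ^ 8 / x) ^ 3 * ℓ ^ 4 * (4 * C / κ * T ^ 17) = (32 * C ^ 4 * T ^ 41 * ℓ ^ 4) / (κ * x ^ 3) := by
    field_simp; ring
  rw [e, le_div_iff₀ (by positivity), one_mul] at h1
  have hκ4 : κ ^ 4 ≤ κ := by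
    calc κ ^ 4 ≤ κ ^ 1 := pow_le_pow_of_le_one hκ.le hκ1 (by norm_num)
      _ = κ := pow_one κ
  have hT41 : T ^ 41 ≤ T ^ 44 := pow_le_pow_right₀ hT1 (by norm_num)
  calc x ^ 3 * (κ / (3 * C)) ^ 4 = x ^ 3 * κ ^ 4 / (81 * C ^ 4) := by field_simp; ring
    _ ≤ 32 * C ^ 4 * T ^ 41 * ℓ ^ 4 / (81 * C ^ 4) := div_le_div_of_nonneg_right ((mul_le_mul_of_nonneg_left hκ4 (by positivity)).trans (by linarith)) (by positivity)
    _ = 32 / 81 * (T ^ 41 * ℓ ^ 4) := by field_simp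
    _ ≤ 1 * (T ^ 44 * ℓ ^ 4) := by gcongr; norm_num
    _ = _ := by ring

theorem case_i (σ : ℝ) (hσ : 0 < σ) (hσ1 : σ ≤ 1 / 8) (κ : ℝ) (hκ : 0 < κ) (hκ1 : κ ≤ 1) : ∃ c : ℝ, 0 < c ∧
    ∀ (q : ℕ) [NeZero q] (χ : DirichletCharacter ℂ q) (s : ℂ), 1 < s.re → s.re ≤ 2 → good χ s.im →
    (χ ^ 2 ≠ 1 ∨ κ ≤ |s.im| * ((q * (|s.im| + 2) : ℝ) ^ σ) ^ 9) →
    c ≤ ‖χ.LFunction s‖ * ((q * (|s.im| + 2) : ℝ) ^ σ) ^ 68 := by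
  obtain ⟨c, hc, hc1, h341⟩ := prod341 σ hσ hσ1 κ hκ hκ1
  obtain ⟨C', hC', hder⟩ := deriv_bound σ hσ hσ1
  obtain ⟨C, hC, hdisc⟩ := disc_bound σ hσ hσ1
  refine ⟨c ^ 4 / (16 * C' ^ 3), by positivity, fun q _ χ s h1 h2 hg hcase => ?_⟩
  have hq : (1:ℝ) ≤ q := by exact_mod_cast Nat.pos_of_ne_zero (NeZero.ne q)
  have h := fun x hx hx1 => h341 q χ s.im x hx hx1 hg hcase
  have hd : ∀ w ∈ {w : ℂ | 1 ≤ w.re ∧ w.re ≤ 2 ∧ w.im = s.im}, DifferentiableAt ℂ χ.LFunction w ∧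
      ‖deriv χ.LFunction w‖ ≤ C' * ((q * (|s.im| + 2) : ℝ) ^ σ) ^ 8 := by
    rintro w ⟨hw1, hw2, hw3⟩
    rw [← hw3] at hg ⊢
    exact ⟨(hdisc q χ w hg hw1 hw2 w (Metric.mem_closedBall_self (by positivity))).2, hder q χ w hg hw1 hw2⟩
  have hconv : Convex ℝ {w : ℂ | 1 ≤ w.re ∧ w.re ≤ 2 ∧ w.im = s.im} :=
    (convex_halfSpace_re_ge 1).inter ((convex_halfSpace_re_le 2).inter
      (convex_hyperplane Complex.imLm.isLinear s.im))
  have hτ1 : 1 ≤ (q * (|s.im| + 2) : ℝ) := by nlinarith [abs_nonneg s.im]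
  have hT1 : 1 ≤ (q * (|s.im| + 2) : ℝ) ^ σ := Real.one_le_rpow hτ1 hσ.le
  set T := (q * (|s.im| + 2) : ℝ) ^ σ
  set y := c / (2 * C' * T ^ 19) with hy
  have hT0 : 0 < T := by linarith
  have hy0 : 0 < y := by positivity
  have hy1 : y ≤ 1 := by
    rw [hy, div_le_one (by positivity)]
    nlinarith [one_le_pow₀ hT1 (n := 19)]
  have low : ∀ x, y ^ 4 ≤ x → x ≤ 1 → y ^ 3 * c ≤ ‖χ.LFunction (1 + x + Complex.I * s.im)‖ * T ^ 11 := by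
    intro x hx hx1
    have := h x (lt_of_lt_of_le (by positivity) hx) hx1
    refine le_of_pow_le_pow_left₀ (n := 4) (by norm_num) (by positivity) (le_trans ?_ this)
    calc (y ^ 3 * c) ^ 4 = (y ^ 4) ^ 3 * c ^ 4 := by ring
      _ ≤ _ := by gcongr
  have hs : (1 + ((s.re - 1 : ℝ) : ℂ) + Complex.I * s.im) = s := by
    apply Complex.ext <;> simp
  have fin : y ^ 3 * c / 2 ≤ ‖χ.LFunction s‖ * T ^ 11 := by
    rcases le_or_gt (y ^ 4) (s.re - 1) with hx | hx
    · have := low (s.re - 1) hx (by linarith)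
      rw [hs] at this
      have : 0 ≤ y ^ 3 * c := by positivity
      linarith
    · have l0 := low (y ^ 4) le_rfl (pow_le_one₀ hy0.le hy1)
      have m := mvt_bound χ _ _ hconv hd (x := s) (y := 1 + (y ^ 4 : ℝ) + Complex.I * s.im) ⟨h1.le, h2, rfl⟩
        ⟨by simp [← Complex.ofReal_pow]; positivity, by simp [← Complex.ofReal_pow]; linarith [pow_le_one₀ hy0.le hy1 (n := 4)], by simp [← Complex.ofReal_pow]⟩
      have hn : ‖(1 + (y ^ 4 : ℝ) + Complex.I * s.im : ℂ) - s‖ ≤ y ^ 4 := by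
        nth_rw 2 [← hs]
        rw [show (1 + (y ^ 4 : ℝ) + Complex.I * s.im : ℂ) - (1 + ((s.re - 1 : ℝ) : ℂ) + Complex.I * s.im) = ((y ^ 4 - (s.re - 1) : ℝ) : ℂ) by push_cast; ring, Complex.norm_real, Real.norm_eq_abs, abs_of_pos (by linarith)]
        linarith
      have := norm_sub_norm_le (χ.LFunction (1 + (y ^ 4 : ℝ) + Complex.I * s.im)) (χ.LFunction s)
      have a : C' * T ^ 8 * ‖(1 + (y ^ 4 : ℝ) + Complex.I * s.im : ℂ) - s‖ ≤ C' * T ^ 8 * y ^ 4 := by gcongr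
      have b : C' * T ^ 8 * y ^ 4 * T ^ 11 = y ^ 3 * c / 2 := by
        rw [hy]; field_simp
      have d : ‖χ.LFunction (1 + (y ^ 4 : ℝ) + Complex.I * s.im)‖ * T ^ 11 ≤ (‖χ.LFunction s‖ + C' * T ^ 8 * y ^ 4) * T ^ 11 := by
        gcongr; linarith
      linarith
  calc c ^ 4 / (16 * C' ^ 3) = (y ^ 3 * c / 2) * T ^ 57 := by rw [hy]; field_simp; norm_num
    _ ≤ ‖χ.LFunction s‖ * T ^ 11 * T ^ 57 := by gcongr
    _ = _ := by ring

theorem L_lower (δ : ℝ) (hδ : 0 < δ) (hδ1 : δ ≤ 1) : ∃ c : ℝ, 0 < c ∧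
    ∀ (q : ℕ) [NeZero q] (χ : DirichletCharacter ℂ q) (s : ℂ), 1 < s.re → s.re ≤ 2 → good χ s.im →
    c ≤ ‖χ.LFunction s‖ * (q * (|s.im| + 2) : ℝ) ^ δ := by
  set σ := δ / 68 with hσ
  have hσ0 : 0 < σ := by positivity
  have hσ1 : σ ≤ 1 / 8 := by rw [hσ]; linarith
  obtain ⟨C', hC', hder⟩ := deriv_bound σ hσ0 hσ1
  obtain ⟨C, hC, hdisc⟩ := disc_bound σ hσ0 hσ1
  obtain ⟨cs, hcs, hsieg⟩ := siegel σ hσ0 (by linarith)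
  obtain ⟨c1, hc1, hf1⟩ := fact1
  set κ := min 1 (cs / (4 * C')) with hκ
  have hκ0 : 0 < κ := by positivity
  obtain ⟨c2, hc2, hci⟩ := case_i σ hσ0 hσ1 κ hκ0 (min_le_left _ _)
  refine ⟨min c2 (min (cs / 2) (c1 * (cs / (4 * C')))), by positivity, fun q _ χ s h1 h2 hg => ?_⟩
  have hq : (1:ℝ) ≤ q := by exact_mod_cast Nat.pos_of_ne_zero (NeZero.ne q)
  have hτ1 : 1 ≤ (q * (|s.im| + 2) : ℝ) := by nlinarith [abs_nonneg s.im]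
  have hT1 : 1 ≤ (q * (|s.im| + 2) : ℝ) ^ σ := Real.one_le_rpow hτ1 hσ0.le
  have e : (q * (|s.im| + 2) : ℝ) ^ δ = ((q * (|s.im| + 2) : ℝ) ^ σ) ^ 68 := by
    rw [← Real.rpow_natCast, ← Real.rpow_mul (by linarith)]; congr 1; push_cast; rw [hσ]; ring
  rw [e]
  by_cases hcase : χ ^ 2 ≠ 1 ∨ κ ≤ |s.im| * ((q * (|s.im| + 2) : ℝ) ^ σ) ^ 9
  · exact (min_le_left _ _).trans (hci q χ s h1 h2 hg hcase)
  rw [not_or, not_not, not_le] at hcase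
  obtain ⟨hχ2, ht⟩ := hcase
  have hχ : χ ≠ 1 := by
    rcases hg with hg | ⟨_, h⟩
    · exact hg
    · exfalso
      have : (1:ℝ) ≤ |s.im| * ((q * (|s.im| + 2) : ℝ) ^ σ) ^ 9 := by
        nlinarith [one_le_pow₀ hT1 (n := 9)]
      linarith [min_le_left 1 (cs / (4 * C'))]
  have hd : ∀ w ∈ {w : ℂ | 1 ≤ w.re ∧ w.re ≤ 2 ∧ -|s.im| ≤ w.im ∧ w.im ≤ |s.im|}, DifferentiableAt ℂ χ.LFunction w ∧
      ‖deriv χ.LFunction w‖ ≤ C' * ((q * (|s.im| + 2) : ℝ) ^ σ) ^ 8 := by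
    rintro w ⟨hw1, hw2, hw3, hw4⟩
    refine ⟨(hdisc q χ w (Or.inl hχ) hw1 hw2 w (Metric.mem_closedBall_self (by positivity))).2, (hder q χ w (Or.inl hχ) hw1 hw2).trans ?_⟩
    have := abs_le.mpr ⟨hw3, hw4⟩
    gcongr
  have hconv : Convex ℝ {w : ℂ | 1 ≤ w.re ∧ w.re ≤ 2 ∧ -|s.im| ≤ w.im ∧ w.im ≤ |s.im|} :=
    (convex_halfSpace_re_ge 1).inter ((convex_halfSpace_re_le 2).inter
      ((convex_halfSpace_im_ge _).inter (convex_halfSpace_im_le _)))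
  have hs1 : cs ≤ ‖χ.LFunction 1‖ * (q * (|s.im| + 2) : ℝ) ^ σ := by
    have := hsieg q χ hχ hχ2
    rw [Real.rpow_neg (by positivity), ← div_eq_mul_inv, div_le_iff₀ (by positivity)] at this
    refine this.trans ?_
    gcongr
    nlinarith [abs_nonneg s.im]
  set T := (q * (|s.im| + 2) : ℝ) ^ σ
  have hT0 : 0 < T := by linarith
  have ht' : |s.im| * T ^ 9 < cs / (4 * C') := ht.trans_le (min_le_right _ _)
  rcases le_or_gt ((s.re - 1) * T ^ 9) (cs / (4 * C')) with hx | hx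
  · have m := mvt_bound χ _ _ hconv hd (x := s) (y := 1) ⟨h1.le, h2, neg_abs_le _, le_abs_self _⟩
      ⟨by simp, by simp, by simp, by simp⟩
    have hn : ‖1 - s‖ ≤ (s.re - 1) + |s.im| := by
      refine (Complex.norm_le_abs_re_add_abs_im _).trans ?_
      simp only [Complex.sub_re, Complex.one_re, Complex.sub_im, Complex.one_im, zero_sub, abs_neg]
      rw [abs_sub_comm, abs_of_pos (by linarith)]
    have a := norm_sub_norm_le (χ.LFunction 1) (χ.LFunction s)
    have b : (‖χ.LFunction 1‖ - ‖χ.LFunction s‖) * T ≤ cs / 2 := by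
      calc _ ≤ C' * T ^ 8 * ((s.re - 1) + |s.im|) * T := by
            gcongr
            exact a.trans (m.trans (by gcongr))
        _ = C' * ((s.re - 1) * T ^ 9 + |s.im| * T ^ 9) := by ring
        _ ≤ C' * (cs / (4 * C') + cs / (4 * C')) := by gcongr
        _ = _ := by field_simp; norm_num
    calc _ ≤ cs / 2 := (min_le_right _ _).trans (min_le_left _ _)
      _ ≤ ‖χ.LFunction s‖ * T ^ 1 := by rw [pow_one]; linarith
      _ ≤ _ := by gcongr <;> norm_num
  · calc _ ≤ c1 * (cs / (4 * C')) := (min_le_right _ _).trans (min_le_right _ _)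
      _ ≤ c1 * ((s.re - 1) * T ^ 9) := by gcongr
      _ = (c1 * (s.re - 1)) * T ^ 9 := by ring
      _ ≤ ‖χ.LFunction s‖ * T ^ 68 := by
        gcongr
        · exact hf1 q χ s h1 h2
        norm_num

/-- log-derivative bound -/
theorem dlog_bound (m : ℕ) : ∃ C : ℝ, 0 < C ∧ ∀ (q : ℕ) [NeZero q] (χ : DirichletCharacter ℂ q) (s : ℂ),
    1 < s.re → s.re ≤ 2 → good χ s.im →
    ‖iteratedDeriv m (fun w => -deriv χ.LFunction w / χ.LFunction w) s‖ ≤ C * (q * (|s.im| + 2) : ℝ) ^ (1 / 2 : ℝ) := by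
  set σ : ℝ := 1 / (18 * (m + 1)) with hσ
  have hσ0 : 0 < σ := by positivity
  have hσ1 : σ ≤ 1 / 8 := by
    rw [hσ]; gcongr; linarith [(Nat.cast_nonneg m : (0:ℝ) ≤ m)]
  obtain ⟨C, hC, hdisc⟩ := disc_bound σ hσ0 hσ1
  obtain ⟨c, hc, hlow⟩ := L_lower σ hσ0 (by linarith)
  set K := C / (2 * σ) + c / (4 * σ) with hK
  have hK0 : 0 < K := by positivity
  refine ⟨m.factorial * (2 * K / c) ^ (m + 1), by positivity, fun q _ χ s h1 h2 hg => ?_⟩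
  have hq : (1:ℝ) ≤ q := by exact_mod_cast Nat.pos_of_ne_zero (NeZero.ne q)
  have hd := hdisc q χ s hg h1.le h2
  have hl := hlow q χ s h1 h2 hg
  have hτ1 : 1 ≤ (q * (|s.im| + 2) : ℝ) := by nlinarith [abs_nonneg s.im]
  have hT1 : 1 ≤ (q * (|s.im| + 2) : ℝ) ^ σ := Real.one_le_rpow hτ1 hσ0.le
  have e : (q * (|s.im| + 2) : ℝ) ^ (1 / 2 : ℝ) = ((q * (|s.im| + 2) : ℝ) ^ σ) ^ (9 * (m + 1)) := by
    rw [← Real.rpow_natCast, ← Real.rpow_mul (by linarith)]; congr 1; push_cast; rw [hσ]; field_simp; norm_num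
  rw [e]
  set T := (q * (|s.im| + 2) : ℝ) ^ σ
  have hT0 : 0 < T := by linarith
  set r := c / (2 * K * T ^ 9) with hr
  have hr0 : 0 < r := by positivity
  have hr2 : r ≤ 2 * σ := by
    rw [hr, div_le_iff₀ (by positivity)]
    have h1 : c / 2 ≤ 2 * σ * K := by
      rw [hK]
      have : 2 * σ * (C / (2 * σ) + c / (4 * σ)) = C + c / 2 := by field_simp; ring
      linarith
    have : 2 * σ * K * 1 ≤ 2 * σ * K * T ^ 9 := by gcongr; exact one_le_pow₀ hT1
    linarith
  have hder : ∀ w ∈ Metric.closedBall s (2 * σ), ‖deriv χ.LFunction w‖ ≤ K * T ^ 8 := by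
    intro w hw
    have hsub : Metric.closedBall w (2 * σ) ⊆ Metric.closedBall s (4 * σ) := by
      refine Metric.closedBall_subset_closedBall' ?_
      rw [Metric.mem_closedBall] at hw; linarith
    have := Complex.norm_deriv_le_of_forall_mem_sphere_norm_le (f := χ.LFunction) (c := w) (R := 2 * σ)
      (C := C * T ^ 8) (by positivity)
      (DifferentiableOn.diffContOnCl_ball (U := Metric.closedBall w (2 * σ)) (fun z hz => (hd z (hsub hz)).2.differentiableWithinAt)
      le_rfl) (fun z hz => (hd z (hsub (Metric.sphere_subset_closedBall hz))).1)
    calc _ ≤ _ := this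
      _ = C / (2 * σ) * T ^ 8 := by ring
      _ ≤ _ := by gcongr; rw [hK]; linarith [show 0 < c / (4 * σ) by positivity]
  have hlw : ∀ w ∈ Metric.closedBall s r, c / (2 * T) ≤ ‖χ.LFunction w‖ := by
    intro w hw
    have hs2 := Metric.closedBall_subset_closedBall hr2 (x := s)
    have m := mvt_bound χ (K * T ^ 8) (Metric.closedBall s r) (convex_closedBall s r)
      (fun z hz => ⟨(hd z (Metric.closedBall_subset_closedBall (by linarith) hz)).2, hder z (hs2 hz)⟩)
      hw (Metric.mem_closedBall_self hr0.le)
    have hws : ‖s - w‖ ≤ r := by rw [norm_sub_rev]; simpa [dist_eq_norm] using hw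
    have : K * T ^ 8 * ‖s - w‖ ≤ c / (2 * T) := by
      calc _ ≤ K * T ^ 8 * r := by gcongr
        _ = _ := by rw [hr]; field_simp
    have a := norm_sub_norm_le (χ.LFunction s) (χ.LFunction w)
    have b : c / T ≤ ‖χ.LFunction s‖ := by rwa [div_le_iff₀ hT0]
    have : c / T = c / (2 * T) + c / (2 * T) := by field_simp; norm_num
    linarith
  have hsub : Metric.closedBall s r ⊆ Metric.closedBall s (2 * σ) := Metric.closedBall_subset_closedBall hr2
  have hDL : DifferentiableOn ℂ (deriv χ.LFunction) (Metric.ball s (4 * σ)) :=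
    DifferentiableOn.deriv (fun w hw => (hd w (Metric.ball_subset_closedBall hw)).2.differentiableWithinAt) Metric.isOpen_ball
  have hball : Metric.closedBall s r ⊆ Metric.ball s (4 * σ) := Metric.closedBall_subset_ball (by linarith)
  have := Complex.norm_iteratedDeriv_le_of_forall_mem_sphere_norm_le (f := fun w => -deriv χ.LFunction w / χ.LFunction w)
    (c := s) (R := r) (C := K * T ^ 8 / (c / (2 * T))) m hr0
    (DifferentiableOn.diffContOnCl_ball (U := Metric.closedBall s r) (fun z hz => by
      refine DifferentiableWithinAt.div ((hDL z (hball hz)).mono hball).neg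
        (hd z (Metric.ball_subset_closedBall (hball hz))).2.differentiableWithinAt ?_
      have := hlw z hz
      have h0 : 0 < c / (2 * T) := by positivity
      exact norm_pos_iff.mp (h0.trans_le this)) le_rfl)
    (fun z hz => by
      have hz' := Metric.sphere_subset_closedBall hz
      rw [norm_div, norm_neg]
      have := hlw z hz'
      have := hder z (hsub hz')
      gcongr)
  calc _ ≤ _ := this
    _ = m.factorial * (2 * K / c) ^ (m + 1) * T ^ (9 * (m + 1)) := by
      have e1 : K * T ^ 8 / (c / (2 * T)) = 2 * K / c * T ^ 9 := by field_simp
      have e2 : r = (2 * K / c * T ^ 9)⁻¹ := by rw [hr]; field_simp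
      rw [e1, e2, inv_pow, div_inv_eq_mul, pow_mul, mul_assoc, ← pow_succ', mul_pow]; ring
    _ = _ := by ring

open ArithmeticFunction in
/-- coefficients `χ Λ` -/
noncomputable def aχ {q : ℕ} (χ : DirichletCharacter ℂ q) : ℕ → ℂ := fun n => χ n * (vonMangoldt n : ℂ)

open ArithmeticFunction in
noncomputable def aζ : ℕ → ℂ := fun n => (vonMangoldt n : ℂ) - 1

theorem aχ_abs {q : ℕ} (χ : DirichletCharacter ℂ q) : LSeries.abscissaOfAbsConv (aχ χ) ≤ 1 :=
  LSeries.abscissaOfAbsConv_le_of_forall_lt_LSeriesSummable fun y hy => by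
    refine DirichletCharacter.LSeriesSummable_twist_vonMangoldt χ (s := (y : ℂ)) (by simpa using hy)

theorem aζ_summable {s : ℂ} (hs : 1 < s.re) : LSeriesSummable aζ s :=
  (ArithmeticFunction.LSeriesSummable_vonMangoldt hs).sub (LSeriesSummable_one_iff.mpr hs)

theorem aζ_abs : LSeries.abscissaOfAbsConv aζ ≤ 1 :=
  LSeries.abscissaOfAbsConv_le_of_forall_lt_LSeriesSummable fun y hy => by
    refine aζ_summable (s := (y : ℂ)) (by simpa using hy)

theorem ev_re {s : ℂ} (hs : 1 < s.re) : ∀ᶠ w in nhds s, 1 < w.re :=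
  (isOpen_lt continuous_const Complex.continuous_re).mem_nhds hs

theorem aχ_series {q : ℕ} [NeZero q] (χ : DirichletCharacter ℂ q) {s : ℂ} (hs : 1 < s.re) :
    LSeries (aχ χ) s = -deriv χ.LFunction s / χ.LFunction s := by
  have := DirichletCharacter.LSeries_twist_vonMangoldt_eq χ hs
  rw [DirichletCharacter.LFunction_eq_LSeries χ hs]
  have e : deriv χ.LFunction s = deriv (LSeries fun n => χ n) s :=
    Filter.EventuallyEq.deriv_eq ((ev_re hs).mono fun w hw => DirichletCharacter.LFunction_eq_LSeries χ hw)
  rw [e]; exact this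

theorem aχ_bound (m : ℕ) : ∃ C : ℝ, 0 < C ∧ ∀ (q : ℕ) [NeZero q] (χ : DirichletCharacter ℂ q) (s : ℂ),
    1 < s.re → s.re ≤ 2 → good χ s.im →
    ‖LSeries (LSeries.logMul^[m] (aχ χ)) s‖ ≤ C * (q * (|s.im| + 2) ^ (1 / 2 : ℝ)) := by
  obtain ⟨C, hC, h⟩ := dlog_bound m
  refine ⟨C, hC, fun q _ χ s h1 h2 hg => ?_⟩
  have := h q χ s h1 h2 hg
  have hq : (1:ℝ) ≤ q := by exact_mod_cast Nat.pos_of_ne_zero (NeZero.ne q)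
  have e : iteratedDeriv m (fun w => -deriv χ.LFunction w / χ.LFunction w) s = iteratedDeriv m (LSeries (aχ χ)) s :=
    Filter.EventuallyEq.iteratedDeriv_eq m ((ev_re h1).mono fun w hw => (aχ_series χ hw).symm)
  rw [e, LSeries_iteratedDeriv m ((aχ_abs χ).trans_lt (by exact_mod_cast h1)), norm_mul, norm_pow, norm_neg, norm_one,
    one_pow, one_mul, Real.mul_rpow (by positivity) (by positivity)] at this
  refine this.trans ?_
  gcongr
  calc (q:ℝ) ^ (1 / 2 : ℝ) ≤ (q:ℝ) ^ (1:ℝ) := Real.rpow_le_rpow_of_exponent_le hq (by norm_num)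
    _ = q := Real.rpow_one _

theorem aζ_iter (m : ℕ) {s : ℂ} (h1 : 1 < s.re) :
    ‖LSeries (LSeries.logMul^[m] aζ) s‖ = ‖iteratedDeriv m (LSeries aζ) s‖ := by
  rw [LSeries_iteratedDeriv m (aζ_abs.trans_lt (by exact_mod_cast h1)), norm_mul, norm_pow, norm_neg, norm_one,
    one_pow, one_mul]

theorem zeta_far (m : ℕ) : ∃ C : ℝ, 0 < C ∧ ∀ (s : ℂ), 1 < s.re → s.re ≤ 2 → 1 ≤ |s.im| →
    ‖LSeries (LSeries.logMul^[m] aζ) s‖ ≤ C * (|s.im| + 2) ^ (1 / 2 : ℝ) := by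
  obtain ⟨C, hC, h⟩ := aχ_bound m
  obtain ⟨C2, hC2, hdisc⟩ := disc_bound (1 / 16) (by norm_num) (by norm_num)
  refine ⟨C + m.factorial * C2 * 4 ^ m, by positivity, fun s h1 h2 ht => ?_⟩
  have a := h 1 1 s h1 h2 (Or.inr ⟨rfl, ht⟩)
  have hd := hdisc 1 1 s (Or.inr ⟨rfl, ht⟩) h1.le h2
  have b := Complex.norm_iteratedDeriv_le_of_forall_mem_sphere_norm_le (f := (1 : DirichletCharacter ℂ 1).LFunction)
    (c := s) (R := 4 * (1 / 16)) m (by norm_num)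
    (DifferentiableOn.diffContOnCl_ball (U := Metric.closedBall s (4 * (1 / 16))) (fun z hz => (hd z hz).2.differentiableWithinAt) le_rfl)
    (fun z hz => (hd z (Metric.sphere_subset_closedBall hz)).1)
  have s1 : LSeries.abscissaOfAbsConv (1 : ℕ → ℂ) < s.re := by
    rw [LSeries.abscissaOfAbsConv_one]; exact_mod_cast h1
  have s2 : LSeries.abscissaOfAbsConv (aχ (1 : DirichletCharacter ℂ 1)) < s.re := (aχ_abs _).trans_lt (by exact_mod_cast h1)
  have e1 : iteratedDeriv m (1 : DirichletCharacter ℂ 1).LFunction s = iteratedDeriv m (LSeries 1) s :=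
    Filter.EventuallyEq.iteratedDeriv_eq m ((ev_re h1).mono fun w hw => by
      rw [DirichletCharacter.LFunction_eq_LSeries _ hw]
      refine LSeries_congr (fun {n} _ => ?_) w
      simp [MulChar.one_apply (isUnit_of_subsingleton _)])
  have e2 : aζ = aχ (1 : DirichletCharacter ℂ 1) - 1 := by
    funext n
    simp [aζ, aχ, MulChar.one_apply (isUnit_of_subsingleton _)]
  have e3 : iteratedDeriv m (LSeries aζ) s = iteratedDeriv m (LSeries (aχ (1 : DirichletCharacter ℂ 1))) s - iteratedDeriv m (LSeries 1) s := by
    rw [← iteratedDeriv_sub]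
    · refine Filter.EventuallyEq.iteratedDeriv_eq m ((ev_re h1).mono fun w hw => ?_)
      rw [e2, LSeries_sub]
      · rfl
      · exact DirichletCharacter.LSeriesSummable_twist_vonMangoldt _ hw
      · exact LSeriesSummable_one_iff.mpr hw
    · exact (LSeries_analyticOnNhd _ s s2).contDiffAt
    · exact (LSeries_analyticOnNhd _ s s1).contDiffAt
  rw [aζ_iter m h1, e3]
  rw [LSeries_iteratedDeriv m s2]
  refine (norm_sub_le _ _).trans ?_
  rw [norm_mul, norm_pow, norm_neg, norm_one, one_pow, one_mul, ← e1, add_mul]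
  refine add_le_add (by simpa using a) (b.trans (le_of_eq ?_))
  have : ((((1:ℕ):ℝ) * (|s.im| + 2)) ^ (1 / 16 : ℝ)) ^ 8 = (|s.im| + 2) ^ (1 / 2 : ℝ) := by
    rw [← Real.rpow_natCast, ← Real.rpow_mul (by positivity)]; norm_num
  rw [this]
  have : (4:ℝ) * (1 / 16) = 1 / 4 := by norm_num
  rw [this, one_div_pow]; field_simp

theorem zeta_near (m : ℕ) : ∃ C : ℝ, 0 < C ∧ ∀ (s : ℂ), 1 < s.re → s.re ≤ 2 → |s.im| ≤ 1 →
    ‖LSeries (LSeries.logMul^[m] aζ) s‖ ≤ C := by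
  set G : ℂ → ℂ := fun s => -deriv zet1 s / zet1 s - dslope zet1 1 s with hG
  have hnz : ∀ s : ℂ, 1 ≤ s.re → zet1 s ≠ 0 := by
    intro s hs
    rcases eq_or_ne s 1 with rfl | h
    · rw [zet1_one]; exact one_ne_zero
    · rw [zet1_ne h]
      exact mul_ne_zero (sub_ne_zero.mpr h) (riemannZeta_ne_zero_of_one_le_re hs)
  have hdd : Differentiable ℂ (dslope zet1 1) := by
    have := (Complex.differentiableOn_dslope (f := zet1) (s := Set.univ) (c := 1) univ_mem).mpr zet1_diff.differentiableOn
    exact differentiableOn_univ.mp this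
  have hd1 : Differentiable ℂ (deriv zet1) := fun z => (zet1_diff.analyticAt z).deriv.differentiableAt
  have hA : ∀ s : ℂ, 1 ≤ s.re → AnalyticAt ℂ G s := fun s hs =>
    (((hd1.analyticAt s).neg.div (zet1_diff.analyticAt s) (hnz s hs))).sub (hdd.analyticAt s)
  have hGe : ∀ s : ℂ, 1 < s.re → LSeries aζ s = G s := by
    intro s hs
    have h1 : s ≠ 1 := by rintro rfl; simp at hs
    have e1 : LSeries aζ s = -deriv riemannZeta s / riemannZeta s - riemannZeta s := by
      rw [← ArithmeticFunction.LSeries_vonMangoldt_eq_deriv_riemannZeta_div hs, ← LSeries_one_eq_riemannZeta hs, ← LSeries_sub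
        (ArithmeticFunction.LSeriesSummable_vonMangoldt hs) (LSeriesSummable_one_iff.mpr hs)]
      rfl
    have e2 : deriv zet1 s = riemannZeta s + (s - 1) * deriv riemannZeta s := by
      have : zet1 =ᶠ[nhds s] fun s => (s - 1) * riemannZeta s := by
        filter_upwards [isOpen_ne.mem_nhds h1] with w hw using zet1_ne hw
      rw [this.deriv_eq]
      have := ((hasDerivAt_id s).sub_const 1).mul (differentiableAt_riemannZeta h1).hasDerivAt
      have := this.deriv
      simp only [id, one_mul] at this
      exact this
    have hz := riemannZeta_ne_zero_of_one_lt_re hs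
    have hs1 : s - 1 ≠ 0 := sub_ne_zero.mpr h1
    rw [e1, hG]
    simp only
    rw [dslope_of_ne _ h1, slope_def_field, zet1_one, e2, zet1_ne h1]
    field_simp
    ring
  have hc : ContinuousOn (iteratedDeriv m G) (Set.Icc 1 2 ×ℂ Set.Icc (-1) 1) := by
    intro s hs
    rw [iteratedDeriv_eq_iterate]
    exact ((hA s (Complex.mem_reProdIm.mp hs).1.1).iterated_deriv m).continuousAt.continuousWithinAt
  obtain ⟨C, hC⟩ := (isCompact_Icc.reProdIm isCompact_Icc).exists_bound_of_continuousOn hc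
  refine ⟨max C 1, by positivity, fun s h1 h2 ht => ?_⟩
  rw [aζ_iter m h1, Filter.EventuallyEq.iteratedDeriv_eq m ((ev_re h1).mono fun w hw => hGe w hw)]
  exact (hC s (Complex.mem_reProdIm.mpr ⟨⟨h1.le, h2⟩, abs_le.mp ht⟩)).trans (le_max_left _ _)

theorem aζ_bound (m : ℕ) : ∃ C : ℝ, 0 < C ∧ ∀ (s : ℂ), 1 < s.re → s.re ≤ 2 →
    ‖LSeries (LSeries.logMul^[m] aζ) s‖ ≤ C * (|s.im| + 2) ^ (1 / 2 : ℝ) := by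
  obtain ⟨C1, h1, H1⟩ := zeta_far m
  obtain ⟨C2, h2, H2⟩ := zeta_near m
  refine ⟨C1 + C2, by positivity, fun s hs hs2 => ?_⟩
  have hb : 1 ≤ (|s.im| + 2) ^ (1 / 2 : ℝ) := Real.one_le_rpow (by linarith [abs_nonneg s.im]) (by norm_num)
  rcases le_total 1 |s.im| with h | h
  · have := H1 s hs hs2 h; nlinarith
  · have := H2 s hs hs2 h; nlinarith

theorem abel_anti (b : ℕ → ℂ) (w : ℕ → ℝ) (y x : ℕ) (M : ℝ) (hM : ∀ z, y ≤ z → z ≤ x → ‖∑ n ∈ Finset.Ioc y z, b n‖ ≤ M)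
    (hw0 : ∀ n, y < n → n ≤ x → 0 ≤ w n) (hw : ∀ n, y < n → n < x → w (n + 1) ≤ w n) (hyx : y < x) :
    ‖∑ n ∈ Finset.Ioc y x, (w n : ℂ) * b n‖ ≤ M * w (y + 1) := by
  have key : ∀ z, y + 1 ≤ z → z ≤ x → ‖∑ n ∈ Finset.Ioc y z, (w n : ℂ) * b n - w z * ∑ n ∈ Finset.Ioc y z, b n‖
      ≤ M * (w (y + 1) - w z) := by
    intro z hz
    induction z, hz using Nat.le_induction with
    | base => intro _; simp
    | succ z hz ih =>
      intro hzx
      have h1 := ih (by omega)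
      have h2 := hM z (by omega) (by omega)
      have h3 := hw z (by omega) (by omega)
      rw [Finset.sum_Ioc_succ_top (by omega : y ≤ z), Finset.sum_Ioc_succ_top (by omega : y ≤ z)]
      set P := ∑ n ∈ Finset.Ioc y z, (w n : ℂ) * b n
      set S := ∑ n ∈ Finset.Ioc y z, b n
      calc _ = ‖(P - w z * S) + ((w z - w (z + 1) : ℝ) : ℂ) * S‖ := by congr 1; push_cast; ring
        _ ≤ M * (w (y + 1) - w z) + (w z - w (z + 1)) * M := by
          refine (norm_add_le _ _).trans (add_le_add h1 ?_)
          rw [norm_mul, Complex.norm_real, Real.norm_eq_abs, abs_of_nonneg (by linarith)]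
          gcongr
        _ = _ := by ring
  have h1 := key x hyx le_rfl
  have h2 : ‖(w x : ℂ) * ∑ n ∈ Finset.Ioc y x, b n‖ ≤ w x * M := by
    rw [norm_mul, Complex.norm_real, Real.norm_eq_abs, abs_of_nonneg (hw0 x hyx le_rfl)]
    exact mul_le_mul_of_nonneg_left (hM x hyx.le le_rfl) (hw0 x hyx le_rfl)
  have := norm_sub_norm_le (∑ n ∈ Finset.Ioc y x, (w n : ℂ) * b n) (w x * ∑ n ∈ Finset.Ioc y x, b n)
  linarith

noncomputable def fej (u : ℝ) : ℂ := (Set.Ioc 0 1).indicator (fun _ => (1:ℂ)) u - (Set.Ioc 0 1).indicator (fun t : ℝ => (t : ℂ) ^ (1:ℂ)) u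

theorem fej_mellin (s : ℂ) (hs : 0 < s.re) : HasMellin fej s (1 / s - 1 / (s + 1)) := by
  have h1 := hasMellin_one_Ioc hs
  have h2 := hasMellin_cpow_Ioc (1:ℂ) (s := s) (by simp; linarith)
  have := hasMellin_sub h1.1 h2.1
  rw [h1.2, h2.2] at this
  exact this

theorem fej_val {u : ℝ} (hu : 0 < u) : fej u = ((max 0 (1 - u) : ℝ) : ℂ) := by
  unfold fej
  rcases le_or_gt u 1 with h | h
  · have hm : u ∈ Set.Ioc (0:ℝ) 1 := ⟨hu, h⟩
    rw [Set.indicator_of_mem hm, Set.indicator_of_mem hm, max_eq_right (by linarith)]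
    simp
  · rw [Set.indicator_of_notMem (by simp [h]), Set.indicator_of_notMem (by simp [h]), max_eq_left (by linarith)]
    simp

theorem fej_cont {u : ℝ} (hu : 0 < u) : ContinuousAt fej u := by
  have : fej =ᶠ[nhds u] fun u => ((max 0 (1 - u) : ℝ) : ℂ) := by
    filter_upwards [lt_mem_nhds hu] with w hw using fej_val hw
  refine ContinuousAt.congr ?_ this.symm
  fun_prop

theorem ker_norm (σ t : ℝ) (hσ : 1 ≤ σ) : ‖1 / (σ + t * Complex.I : ℂ) - 1 / (σ + t * Complex.I + 1)‖ ≤ (1 + t ^ 2)⁻¹ := by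
  set s : ℂ := σ + t * Complex.I with hs
  have hre : s.re = σ := by simp [hs]
  have him : s.im = t := by simp [hs]
  have h0 : s ≠ 0 := by intro h; rw [h] at hre; simp at hre; linarith
  have h1 : s + 1 ≠ 0 := by intro h; have := congrArg Complex.re h; simp [hre] at this; linarith
  have e : 1 / s - 1 / (s + 1) = 1 / (s * (s + 1)) := by field_simp; ring
  have n1 : √(1 + t ^ 2) ≤ ‖s‖ := by
    rw [Complex.norm_eq_sqrt_sq_add_sq]; apply Real.sqrt_le_sqrt; rw [hre, him]; nlinarith
  have n2 : √(1 + t ^ 2) ≤ ‖s + 1‖ := by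
    rw [Complex.norm_eq_sqrt_sq_add_sq]; apply Real.sqrt_le_sqrt
    simp only [Complex.add_re, Complex.one_re, Complex.add_im, Complex.one_im, add_zero, hre, him]; nlinarith
  rw [e, norm_div, norm_one, one_div, norm_mul]
  apply inv_anti₀ (by positivity)
  calc 1 + t ^ 2 = √(1 + t ^ 2) * √(1 + t ^ 2) := (Real.mul_self_sqrt (by positivity)).symm
    _ ≤ _ := by gcongr

theorem ker_cont (σ : ℝ) (hσ : 1 ≤ σ) : Continuous fun t : ℝ => 1 / (σ + t * Complex.I : ℂ) - 1 / (σ + t * Complex.I + 1) := by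
  refine Continuous.sub (Continuous.div₀ (by fun_prop) (by fun_prop) fun t h => ?_)
    (Continuous.div₀ (by fun_prop) (by fun_prop) fun t h => ?_)
  · have := congrArg Complex.re h; simp at this; linarith
  · have := congrArg Complex.re h; simp at this; linarith

theorem ker_int (σ : ℝ) (hσ : 1 ≤ σ) : MeasureTheory.Integrable fun t : ℝ => 1 / (σ + t * Complex.I : ℂ) - 1 / (σ + t * Complex.I + 1) :=
  integrable_inv_one_add_sq.mono' (ker_cont σ hσ).aestronglyMeasurable (MeasureTheory.ae_of_all _ fun t => ker_norm σ t hσ)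

theorem fej_inv (σ : ℝ) (hσ : 1 ≤ σ) {u : ℝ} (hu : 0 < u) :
    ∫ t : ℝ, (u : ℂ) ^ (-(σ + t * Complex.I : ℂ)) * (1 / (σ + t * Complex.I : ℂ) - 1 / (σ + t * Complex.I + 1)) =
      (2 * π) * ((max 0 (1 - u) : ℝ) : ℂ) := by
  have hm : ∀ t : ℝ, mellin fej (σ + t * Complex.I) = 1 / (σ + t * Complex.I : ℂ) - 1 / (σ + t * Complex.I + 1) :=
    fun t => (fej_mellin _ (by simp; linarith)).2
  have := mellinInv_mellin_eq σ fej hu (fej_mellin σ (by simp; linarith)).1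
    (by unfold Complex.VerticalIntegrable; simp_rw [hm]; exact ker_int σ hσ) (fej_cont hu)
  rw [fej_val hu, mellinInv] at this
  simp_rw [hm] at this
  rw [← this]
  have hp : (π : ℂ) ≠ 0 := by exact_mod_cast Real.pi_ne_zero
  simp only [smul_eq_mul, Complex.real_smul]
  push_cast
  rw [← mul_assoc, mul_one_div_cancel (by simpa using hp), one_mul]

theorem tauber : ∃ C : ℝ, 0 < C ∧ ∀ (b : ℕ → ℂ) (K σ : ℝ), 0 ≤ K → 1 ≤ σ → LSeriesSummable b σ →
    (∀ t : ℝ, ‖LSeries b (σ + t * Complex.I)‖ ≤ K * (|t| + 2) ^ (1 / 2 : ℝ)) → ∀ y : ℕ, 1 ≤ y →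
    ‖∑ n ∈ Finset.Icc 1 y, b n * ((1 - n / y : ℝ) : ℂ)‖ ≤ C * K * (y : ℝ) ^ σ := by
  have hint : MeasureTheory.Integrable fun t : ℝ => 2 * (1 + ‖t‖ ^ 2) ^ (-(3 / 2 : ℝ) / 2) :=
    (integrable_rpow_neg_one_add_norm_sq (E := ℝ) (μ := MeasureTheory.volume) (r := 3 / 2) (by norm_num)).const_mul 2
  set J := ∫ t : ℝ, 2 * (1 + ‖t‖ ^ 2) ^ (-(3 / 2 : ℝ) / 2) with hJ
  have hJ0 : 0 ≤ J := MeasureTheory.integral_nonneg fun t => by positivity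
  refine ⟨J + 1, by positivity, fun b K σ hK hσ hsum hb y hy => ?_⟩
  have hy0 : (0:ℝ) < y := by exact_mod_cast hy
  set I : ℝ → ℂ := fun t => 1 / (σ + t * Complex.I : ℂ) - 1 / (σ + t * Complex.I + 1) with hI
  have hIc : Continuous I := ker_cont σ hσ
  have hIi : MeasureTheory.Integrable I := ker_int σ hσ
  set G : ℕ → ℝ → ℂ := fun n t => LSeries.term b (σ + t * Complex.I) n * ((y : ℂ) ^ (σ + t * Complex.I : ℂ) * I t) with hG
  have hGn : ∀ n t, ‖G n t‖ = ‖LSeries.term b σ n‖ * ((y:ℝ) ^ σ * ‖I t‖) := by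
    intro n t
    rw [hG]
    simp only
    rw [norm_mul, norm_mul, Complex.norm_natCast_cpow_of_pos hy, LSeries.norm_term_eq, LSeries.norm_term_eq]
    simp
  have hv : ∀ n, ∫ t, G n t = (2 * π) * (if n = 0 then 0 else b n * ((max 0 (1 - n / y) : ℝ) : ℂ)) := by
    intro n
    rcases eq_or_ne n 0 with rfl | hn
    · simp [hG]
    have hn0 : (0:ℝ) < n := by exact_mod_cast Nat.pos_of_ne_zero hn
    have := fej_inv σ hσ (u := n / y) (by positivity)
    rw [if_neg hn, ← mul_assoc, mul_comm _ (b n), mul_assoc, ← this, ← MeasureTheory.integral_const_mul]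
    congr 1
    funext t
    rw [hG]
    simp only
    rw [LSeries.term_of_ne_zero hn, ← mul_assoc, ← mul_assoc]
    congr 1
    rw [Complex.ofReal_div, Complex.ofReal_natCast, Complex.ofReal_natCast, Complex.cpow_neg, ← Complex.ofReal_natCast, ← Complex.ofReal_natCast,
      Complex.div_cpow_ofReal_nonneg hn0.le hy0.le, inv_div]
    ring
  have hGi : ∀ n, MeasureTheory.Integrable (G n) := by
    intro n
    refine MeasureTheory.Integrable.mono' (g := fun t => ‖LSeries.term b σ n‖ * ((y:ℝ) ^ σ * ‖I t‖)) ((hIi.norm.const_mul _).const_mul _) ?_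
      (MeasureTheory.ae_of_all _ fun t => (hGn n t).le)
    apply Continuous.aestronglyMeasurable
    rw [hG]
    refine Continuous.mul ?_ (Continuous.mul ?_ hIc)
    · rcases eq_or_ne n 0 with rfl | hn
      · simp only [LSeries.term_zero]; exact continuous_const
      · simp only [LSeries.term_of_ne_zero hn]
        refine Continuous.div₀ continuous_const (Continuous.const_cpow (by fun_prop) (Or.inl (by exact_mod_cast hn))) fun t h => ?_
        rw [Complex.cpow_eq_zero_iff] at h
        exact hn (by exact_mod_cast h.1)
    · exact Continuous.const_cpow (by fun_prop) (Or.inl (by exact_mod_cast hy0.ne'))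
  have hS := MeasureTheory.hasSum_integral_of_summable_integral_norm hGi (by
    simp_rw [hGn, MeasureTheory.integral_const_mul]
    exact hsum.norm.mul_right _)
  have hfin : HasSum (fun n => ∫ t, G n t) (∑ n ∈ Finset.Icc 1 y, (2 * π : ℂ) * (b n * ((1 - n / y : ℝ) : ℂ))) := by
    have : ∀ n ∈ Finset.Icc 1 y, (2 * π : ℂ) * (b n * ((1 - n / y : ℝ) : ℂ)) = ∫ t, G n t := by
      intro n hn
      rw [Finset.mem_Icc] at hn
      rw [hv, if_neg (by omega), max_eq_right]
      rw [sub_nonneg, div_le_one hy0]; exact_mod_cast hn.2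
    rw [Finset.sum_congr rfl this]
    refine hasSum_sum_of_ne_finset_zero fun n hn => ?_
    rw [hv]
    rcases eq_or_ne n 0 with rfl | h0
    · simp
    have : y < n := by
      by_contra h; exact hn (Finset.mem_Icc.mpr ⟨Nat.one_le_iff_ne_zero.mpr h0, by omega⟩)
    rw [max_eq_left]
    · simp
    · rw [sub_nonpos, one_le_div hy0]; exact_mod_cast this.le
  have heq := hfin.unique hS
  rw [← Finset.mul_sum] at heq
  have hbound : ‖∫ t, ∑' n, G n t‖ ≤ K * (y:ℝ) ^ σ * J := by
    rw [hJ, ← MeasureTheory.integral_const_mul]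
    refine MeasureTheory.norm_integral_le_of_norm_le (hint.const_mul _) (MeasureTheory.ae_of_all _ fun t => ?_)
    rw [hG]
    simp only
    rw [tsum_mul_right, norm_mul, norm_mul, Complex.norm_natCast_cpow_of_pos hy]
    have h1 : ‖∑' n, LSeries.term b (σ + t * Complex.I) n‖ ≤ K * (|t| + 2) ^ (1 / 2 : ℝ) := hb t
    have h2 := ker_norm σ t hσ
    have h3 : (|t| + 2) ^ (1 / 2 : ℝ) ≤ 2 * (1 + t ^ 2) ^ (1 / 4 : ℝ) := by
      have : |t| + 2 ≤ (16 * (1 + t ^ 2)) ^ (1 / 2 : ℝ) := by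
        rw [← Real.sqrt_eq_rpow]
        apply Real.le_sqrt_of_sq_le
        nlinarith [sq_abs t, sq_nonneg (|t| - 1)]
      calc _ ≤ ((16 * (1 + t ^ 2)) ^ (1 / 2 : ℝ)) ^ (1 / 2 : ℝ) := by gcongr
        _ = (16:ℝ) ^ (1 / 4 : ℝ) * (1 + t ^ 2) ^ (1 / 4 : ℝ) := by
          rw [← Real.rpow_mul (by positivity), Real.mul_rpow (by norm_num) (by positivity)]; norm_num
        _ = _ := by
          congr 1
          rw [show (16:ℝ) = 2 ^ (4:ℝ) by norm_num, ← Real.rpow_mul (by norm_num)]; norm_num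
    have hre : (σ + t * Complex.I : ℂ).re = σ := by simp
    rw [hre]
    calc _ ≤ K * (2 * (1 + t ^ 2) ^ (1 / 4 : ℝ)) * ((y:ℝ) ^ σ * (1 + t ^ 2)⁻¹) := by
          gcongr
          exact h1.trans (by gcongr)
      _ = K * (y:ℝ) ^ σ * (2 * ((1 + t ^ 2) ^ (1 / 4 : ℝ) * (1 + t ^ 2)⁻¹)) := by ring
      _ = _ := by
        have hp : 0 < 1 + t ^ 2 := by positivity
        rw [← Real.rpow_neg_one, ← Real.rpow_add hp, Real.norm_eq_abs, sq_abs]; norm_num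
  rw [← heq, norm_mul] at hbound
  have hpi : (1:ℝ) ≤ ‖(2 * π : ℂ)‖ := by
    rw [norm_mul, Complex.norm_real, Real.norm_eq_abs, abs_of_pos Real.pi_pos]; norm_num; linarith [Real.pi_gt_three]
  have hy' : 0 ≤ K * (y:ℝ) ^ σ := by positivity
  nlinarith [norm_nonneg (∑ n ∈ Finset.Icc 1 y, b n * ((1 - n / y : ℝ) : ℂ))]

theorem log_pow_le (k : ℕ) : ∃ C : ℝ, 1 ≤ C ∧ ∀ x : ℝ, 1 ≤ x → Real.log x ^ k ≤ C * √x := by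
  refine ⟨max 1 ((2 * k : ℝ) ^ k), le_max_left _ _, fun x hx => ?_⟩
  have hl := Real.log_nonneg hx
  have hs : 1 ≤ √x := Real.one_le_sqrt.mpr hx
  rcases Nat.eq_zero_or_pos k with rfl | hk
  · simpa using hs
  have hk0 : (0:ℝ) < k := by exact_mod_cast hk
  have h := Real.log_le_rpow_div (x := x) (by linarith) (ε := 1 / (2 * k)) (by positivity)
  calc Real.log x ^ k ≤ (x ^ (1 / (2 * k) : ℝ) / (1 / (2 * k))) ^ k := by gcongr
    _ = (2 * k : ℝ) ^ k * (x ^ (1 / (2 * k) : ℝ)) ^ k := by rw [← mul_pow]; congr 1; field_simp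
    _ = (2 * k : ℝ) ^ k * √x := by
      rw [← Real.rpow_natCast (x ^ _), ← Real.rpow_mul (by linarith), Real.sqrt_eq_rpow]; congr 2; field_simp
    _ ≤ _ := by gcongr; exact le_max_right _ _

theorem logMul_iter (a : ℕ → ℂ) (m n : ℕ) : LSeries.logMul^[m] a n = ((Real.log n ^ m : ℝ) : ℂ) * a n := by
  induction m with
  | zero => simp
  | succ m ih =>
    rw [Function.iterate_succ_apply', LSeries.logMul, ih, pow_succ, ← Complex.natCast_log]
    push_cast; ring

theorem one_le_log {N : ℕ} (hN : 3 ≤ N) : 1 ≤ Real.log N := by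
  rw [Real.le_log_iff_exp_le (by positivity)]
  have : (3:ℝ) ≤ N := by exact_mod_cast hN
  linarith [Real.exp_one_lt_three]

theorem unsmooth (A : ℕ) : ∃ C : ℝ, 0 < C ∧ ∀ (a : ℕ → ℂ) (K : ℝ), 1 ≤ K → (∀ n : ℕ, ‖a n‖ ≤ Real.log n + 1) →
    LSeries.abscissaOfAbsConv a ≤ 1 →
    (∀ s : ℂ, 1 < s.re → s.re ≤ 2 → ‖LSeries (LSeries.logMul^[2 * A + 1] a) s‖ ≤ K * (|s.im| + 2) ^ (1 / 2 : ℝ)) →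
    ∀ N : ℕ, 3 ≤ N → ∀ z ≤ N, ‖∑ n ∈ Finset.Ioc 0 z, ((Real.log n ^ (2 * A + 1) : ℝ) : ℂ) * a n‖ ≤ C * K * (N * Real.log N ^ (A + 1)) := by
  obtain ⟨C0, hC0, ht⟩ := tauber
  obtain ⟨C2, hC2, hlp⟩ := log_pow_le (A + 1)
  refine ⟨48 * C0 + 3 ^ (2 * A + 2) * (1 + C2), by positivity, fun a K hK ha habs hb N hN z hz => ?_⟩
  set L := Real.log N with hL
  have hL1 : 1 ≤ L := one_le_log hN
  have hN0 : (3:ℝ) ≤ N := by exact_mod_cast hN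
  set b : ℕ → ℂ := fun n => ((Real.log n ^ (2 * A + 1) : ℝ) : ℂ) * a n with hbd
  have hbe : LSeries.logMul^[2 * A + 1] a = b := funext fun n => logMul_iter a _ n
  rw [hbe] at hb
  set σ := 1 + 1 / L with hσ
  have hL' : 1 / L ≤ 1 := by rw [div_le_one (by linarith)]; exact hL1
  have hL0 : 0 < 1 / L := by positivity
  have hT := ht b K σ (by linarith) (by linarith) (by
    rw [← hbe]
    refine LSeriesSummable_of_abscissaOfAbsConv_lt_re ?_
    rw [LSeries.absicssaOfAbsConv_logPowMul]
    refine habs.trans_lt ?_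
    simp only [Complex.ofReal_re]
    exact_mod_cast (by linarith : 1 < σ)) (fun t => by
      have := hb (σ + t * Complex.I) (by simp; linarith) (by simp; linarith)
      simpa using this)
  set W : ℕ → ℂ := fun y => ∑ n ∈ Finset.Ioc 0 y, b n * ((y - n : ℝ) : ℂ) with hW
  have hWb : ∀ y : ℕ, y ≤ 2 * N → ‖W y‖ ≤ 24 * C0 * K * N ^ 2 := by
    intro y hy
    rcases Nat.eq_zero_or_pos y with rfl | hy0
    · simp [hW]; positivity
    have hy0' : (0:ℝ) < y := by exact_mod_cast hy0
    have h1 := hT y hy0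
    have e : W y = (y:ℂ) * ∑ n ∈ Finset.Icc 1 y, b n * ((1 - n / y : ℝ) : ℂ) := by
      rw [hW, Finset.mul_sum]
      refine Finset.sum_congr rfl fun n _ => ?_
      have : (y:ℂ) ≠ 0 := by exact_mod_cast hy0.ne'
      push_cast; field_simp
    have hy2 : (y:ℝ) ≤ 2 * N := by exact_mod_cast hy
    have h2 : (y:ℝ) ^ σ ≤ 12 * N := by
      calc (y:ℝ) ^ σ ≤ (2 * N : ℝ) ^ σ := by gcongr
        _ = (2 * N) * (2 ^ (1 / L) * (N:ℝ) ^ (1 / L)) := by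
          rw [hσ, Real.rpow_add (by positivity), Real.rpow_one, Real.mul_rpow (by norm_num) (by positivity)]
        _ ≤ (2 * N) * (2 ^ (1:ℝ) * 3) := by
          gcongr
          · norm_num
          · rw [Real.rpow_def_of_pos (by linarith), ← hL, mul_one_div_cancel (by linarith)]
            exact Real.exp_one_lt_three.le
        _ = _ := by norm_num; ring
    rw [e, norm_mul, Complex.norm_natCast]
    calc _ ≤ (2 * N : ℝ) * (C0 * K * (12 * N)) := by
          gcongr
          exact h1.trans (by gcongr)
      _ = _ := by ring
  have hLN : L ^ (A + 1) ≤ C2 * N := by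
    refine (hlp N (by linarith)).trans ?_
    gcongr
    rw [Real.sqrt_le_left (by linarith)]; nlinarith
  have hLp : 1 ≤ L ^ (A + 1) := one_le_pow₀ hL1
  set h := ⌈(N:ℝ) / L ^ (A + 1)⌉₊ with hh
  have hh1 : (N:ℝ) / L ^ (A + 1) ≤ h := Nat.le_ceil _
  have hh2 : (h:ℝ) ≤ N / L ^ (A + 1) + 1 := (Nat.ceil_lt_add_one (by positivity)).le
  have hhN : h ≤ N := by
    rw [hh, Nat.ceil_le]
    exact div_le_self (by linarith) hLp
  have hhp : (0:ℝ) < h := lt_of_lt_of_le (by positivity) hh1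
  have hbb : ∀ n ∈ Finset.Ioc z (z + h), ‖b n * (((z + h : ℕ) - n : ℝ) : ℂ)‖ ≤ (3 * L) ^ (2 * A + 2) * h := by
    intro n hn
    rw [Finset.mem_Ioc] at hn
    have hn0 : (0:ℝ) < n := by exact_mod_cast (by omega : 0 < n)
    have hl0 : 0 ≤ Real.log n := Real.log_natCast_nonneg n
    have hl : Real.log n ≤ 2 * L := by
      have : (n:ℝ) ≤ N ^ 2 := by exact_mod_cast (by nlinarith : n ≤ N ^ 2)
      calc Real.log n ≤ Real.log ((N:ℝ) ^ 2) := Real.log_le_log hn0 this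
        _ = _ := by rw [Real.log_pow]; push_cast; ring
    rw [norm_mul]
    gcongr
    · rw [hbd]
      simp only
      rw [norm_mul, Complex.norm_real, norm_pow, Real.norm_eq_abs, abs_of_nonneg hl0, pow_succ (3 * L)]
      have := ha n
      gcongr <;> linarith
    · rw [Complex.norm_real, Real.norm_eq_abs, abs_of_nonneg]
      · have : (z:ℝ) ≤ n := by exact_mod_cast hn.1.le
        push_cast; linarith
      · have : (n:ℝ) ≤ (z + h : ℕ) := by exact_mod_cast hn.2
        linarith
  have hdiff : (h:ℂ) * ∑ n ∈ Finset.Ioc 0 z, b n = W (z + h) - W z - ∑ n ∈ Finset.Ioc z (z + h), b n * (((z + h : ℕ) - n : ℝ) : ℂ) := by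
    rw [hW]
    simp only
    rw [← Finset.sum_Ioc_consecutive _ (Nat.zero_le z) (Nat.le_add_right z h), add_sub_right_comm, add_sub_cancel_right,
      ← Finset.sum_sub_distrib, Finset.mul_sum]
    refine Finset.sum_congr rfl fun n _ => ?_
    push_cast; ring
  have hs3 : ‖∑ n ∈ Finset.Ioc z (z + h), b n * (((z + h : ℕ) - n : ℝ) : ℂ)‖ ≤ h * ((3 * L) ^ (2 * A + 2) * h) := by
    refine (norm_sum_le_of_le _ hbb).trans ?_
    rw [Finset.sum_const, Nat.card_Ioc, nsmul_eq_mul, Nat.add_sub_cancel_left]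
  have hfin : (h:ℝ) * ‖∑ n ∈ Finset.Ioc 0 z, b n‖ ≤ 48 * C0 * K * N ^ 2 + h * ((3 * L) ^ (2 * A + 2) * h) := by
    rw [← Complex.norm_natCast, ← norm_mul, hdiff]
    have h1 := hWb (z + h) (by omega)
    have h2 := hWb z (by omega)
    have := norm_sub_le (W (z + h) - W z) (∑ n ∈ Finset.Ioc z (z + h), b n * (((z + h : ℕ) - n : ℝ) : ℂ))
    have := norm_sub_le (W (z + h)) (W z)
    rw [Complex.norm_natCast]
    linarith
  have h1 : 48 * C0 * K * N ^ 2 ≤ h * (48 * C0 * K * (N * L ^ (A + 1))) := by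
    rw [div_le_iff₀ (by positivity)] at hh1
    calc _ = 48 * C0 * K * N * N := by ring
      _ ≤ 48 * C0 * K * N * (h * L ^ (A + 1)) := by gcongr
      _ = _ := by ring
  have h2 : (3 * L) ^ (2 * A + 2) * h ≤ 3 ^ (2 * A + 2) * (1 + C2) * K * (N * L ^ (A + 1)) := by
    have e : (3 * L) ^ (2 * A + 2) = 3 ^ (2 * A + 2) * (L ^ (A + 1) * L ^ (A + 1)) := by rw [mul_pow]; ring
    calc _ ≤ 3 ^ (2 * A + 2) * (L ^ (A + 1) * L ^ (A + 1)) * (N / L ^ (A + 1) + 1) := by rw [e]; gcongr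
      _ = 3 ^ (2 * A + 2) * (N + L ^ (A + 1)) * L ^ (A + 1) := by field_simp
      _ ≤ 3 ^ (2 * A + 2) * (N + C2 * N) * L ^ (A + 1) := by gcongr
      _ = 3 ^ (2 * A + 2) * (1 + C2) * 1 * (N * L ^ (A + 1)) := by ring
      _ ≤ _ := by gcongr
  refine le_of_mul_le_mul_left ?_ hhp
  calc _ ≤ _ := hfin
    _ ≤ h * (48 * C0 * K * (N * L ^ (A + 1))) + h * (3 ^ (2 * A + 2) * (1 + C2) * K * (N * L ^ (A + 1))) := by gcongr
    _ = _ := by ring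

theorem unlog (A : ℕ) : ∃ C : ℝ, 0 < C ∧ ∀ (a : ℕ → ℂ) (K : ℝ), 1 ≤ K → (∀ n : ℕ, ‖a n‖ ≤ Real.log n + 1) →
    LSeries.abscissaOfAbsConv a ≤ 1 →
    (∀ s : ℂ, 1 < s.re → s.re ≤ 2 → ‖LSeries (LSeries.logMul^[2 * A + 1] a) s‖ ≤ K * (|s.im| + 2) ^ (1 / 2 : ℝ)) →
    ∀ N : ℕ, 3 ≤ N → ∀ x ≤ N, ‖∑ n ∈ Finset.Ioc 0 x, a n‖ ≤ C * K * (N / Real.log N ^ A) := by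
  obtain ⟨C0, hC0, h0⟩ := unsmooth A
  obtain ⟨C2, hC2, hlp⟩ := log_pow_le (A + 1)
  refine ⟨2 * C2 + 2 * C0 * 2 ^ (2 * A + 1), by positivity, fun a K hK ha habs hb N hN x hx => ?_⟩
  have hB := h0 a K hK ha habs hb N hN
  have hL1 : 1 ≤ Real.log N := one_le_log hN
  have hN0 : (3:ℝ) ≤ N := by exact_mod_cast hN
  have hsm : ∀ x ≤ Nat.sqrt N, ‖∑ n ∈ Finset.Ioc 0 x, a n‖ ≤ 2 * C2 * K * (N / Real.log N ^ A) := by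
    intro x hx
    have hxs : (x:ℝ) ≤ √N := (Nat.cast_le.mpr hx).trans (Real.nat_sqrt_le_real_sqrt)
    have hxN : x ≤ N := hx.trans (Nat.sqrt_le_self N)
    calc _ ≤ ∑ n ∈ Finset.Ioc 0 x, (2 * Real.log N) := by
          refine norm_sum_le_of_le _ fun n hn => (ha n).trans ?_
          rw [Finset.mem_Ioc] at hn
          have : Real.log n ≤ Real.log N := Real.log_le_log (by exact_mod_cast hn.1) (by exact_mod_cast hn.2.trans hxN)
          linarith
      _ = x * (2 * Real.log N) := by simp
      _ ≤ √N * (2 * Real.log N) := by gcongr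
      _ = 2 * √N * Real.log N ^ (A + 1) / Real.log N ^ A := by field_simp; ring
      _ ≤ 2 * √N * (C2 * √N) / Real.log N ^ A := by gcongr; exact hlp N (by linarith)
      _ = 2 * C2 * 1 * (N / Real.log N ^ A) := by
        have : √(N:ℝ) * √N = N := Real.mul_self_sqrt (by linarith)
        rw [show 2 * √(N:ℝ) * (C2 * √N) = 2 * C2 * (√N * √N) by ring, this]; ring
      _ ≤ _ := by gcongr
  set y := Nat.sqrt N with hy
  have hNL : 0 ≤ N / Real.log N ^ A := by positivity
  rcases le_or_gt x y with hxy | hxy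
  · refine (hsm x hxy).trans ?_
    gcongr
    linarith [show 0 < 2 * C0 * 2 ^ (2 * A + 1) by positivity]
  have hy1 : 1 ≤ y := by rw [hy, Nat.le_sqrt']; omega
  have hlogp : ∀ n, y < n → 0 < Real.log n := fun n hn => Real.log_pos (by exact_mod_cast (by omega : 1 < n))
  have hM : ∀ z, y ≤ z → z ≤ x → ‖∑ n ∈ Finset.Ioc y z, ((Real.log n ^ (2 * A + 1) : ℝ) : ℂ) * a n‖ ≤
      2 * (C0 * K * (N * Real.log N ^ (A + 1))) := by
    intro z hyz hzx
    have e := Finset.sum_Ioc_consecutive (fun n : ℕ => ((Real.log n ^ (2 * A + 1) : ℝ) : ℂ) * a n) (Nat.zero_le y) hyz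
    have h1 := hB z (by omega)
    have h2 := hB y (by omega)
    rw [eq_sub_of_add_eq' e]
    refine (norm_sub_le _ _).trans (by linarith)
  have := abel_anti (fun n => ((Real.log n ^ (2 * A + 1) : ℝ) : ℂ) * a n) (fun n => (Real.log n ^ (2 * A + 1))⁻¹) y x _ hM
    (fun n hn _ => by have := hlogp n hn; positivity)
    (fun n hn _ => by
      have := hlogp n hn
      have h2 : Real.log n ≤ Real.log (n + 1 : ℕ) := Real.log_le_log (by exact_mod_cast (by omega : 0 < n)) (by push_cast; linarith)
      gcongr) hxy
  have e : ∑ n ∈ Finset.Ioc y x, (((Real.log n ^ (2 * A + 1))⁻¹ : ℝ) : ℂ) * (((Real.log n ^ (2 * A + 1) : ℝ) : ℂ) * a n) = ∑ n ∈ Finset.Ioc y x, a n := by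
    refine Finset.sum_congr rfl fun n hn => ?_
    have := hlogp n (Finset.mem_Ioc.mp hn).1
    rw [← mul_assoc, ← Complex.ofReal_mul, inv_mul_cancel₀ (by positivity)]; simp
  rw [e] at this
  have hlog : Real.log N / 2 ≤ Real.log (y + 1 : ℕ) := by
    have : (N:ℝ) ≤ ((y + 1 : ℕ):ℝ) ^ 2 := by exact_mod_cast (Nat.lt_succ_sqrt' N).le
    have := Real.log_le_log (by linarith) this
    rw [Real.log_pow] at this; push_cast at this ⊢; linarith
  rw [← Finset.sum_Ioc_consecutive _ (Nat.zero_le y) hxy.le]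
  refine (norm_add_le _ _).trans ?_
  have h3 : 2 * (C0 * K * (N * Real.log N ^ (A + 1))) * (Real.log (y + 1 : ℕ) ^ (2 * A + 1))⁻¹ ≤
      2 * C0 * 2 ^ (2 * A + 1) * K * (N / Real.log N ^ A) := by
    calc _ ≤ 2 * (C0 * K * (N * Real.log N ^ (A + 1))) * ((Real.log N / 2) ^ (2 * A + 1))⁻¹ := by gcongr
      _ = _ := by rw [div_pow, inv_div]; field_simp; ring
  have := hsm y le_rfl
  calc _ ≤ _ := add_le_add this ((by assumption : ‖∑ n ∈ Finset.Ioc y x, a n‖ ≤ _).trans h3)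
    _ = _ := by ring

open ArithmeticFunction in
theorem psi_chi (A B : ℕ) : ∃ C : ℝ, 0 < C ∧ ∀ N : ℕ, 3 ≤ N → ∀ (q : ℕ) [NeZero q], (q:ℝ) ≤ Real.log N ^ B →
    ∀ χ : DirichletCharacter ℂ q, χ ≠ 1 → ∀ x ≤ N, ‖∑ n ∈ Finset.Ioc 0 x, aχ χ n‖ ≤ C * (N / Real.log N ^ A) := by
  obtain ⟨C1, hC1, h1⟩ := unlog (A + B)
  obtain ⟨C2, hC2, h2⟩ := aχ_bound (2 * (A + B) + 1)
  refine ⟨C1 * (C2 + 1), by positivity, fun N hN q _ hq χ hχ x hx => ?_⟩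
  have hL1 : 1 ≤ Real.log N := one_le_log hN
  have hq1 : (1:ℝ) ≤ q := by exact_mod_cast Nat.pos_of_ne_zero (NeZero.ne q)
  have := h1 (aχ χ) ((C2 + 1) * q) (by nlinarith) (fun n => by
    rw [aχ, norm_mul, Complex.norm_real, Real.norm_eq_abs, abs_of_nonneg vonMangoldt_nonneg]
    have a := χ.norm_le_one n
    have b := vonMangoldt_le_log (n := n)
    have c := vonMangoldt_nonneg (n := n)
    nlinarith) (aχ_abs χ) (fun s hs1 hs2 => (h2 q χ s hs1 hs2 (Or.inl hχ)).trans (by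
      have : 0 ≤ q * (|s.im| + 2) ^ (1 / 2 : ℝ) := by positivity
      nlinarith)) N hN x hx
  refine this.trans ?_
  calc _ = C1 * (C2 + 1) * (q * (N / Real.log N ^ (A + B))) := by ring
    _ ≤ C1 * (C2 + 1) * (Real.log N ^ B * (N / Real.log N ^ (A + B))) := by gcongr
    _ = _ := by rw [pow_add]; field_simp

open ArithmeticFunction in
theorem psi_one (A : ℕ) : ∃ C : ℝ, 0 < C ∧ ∀ N : ℕ, 3 ≤ N → ∀ x ≤ N,
    |∑ n ∈ Finset.Ioc 0 x, vonMangoldt n - x| ≤ C * (N / Real.log N ^ A) := by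
  obtain ⟨C1, hC1, h1⟩ := unlog A
  obtain ⟨C2, hC2, h2⟩ := aζ_bound (2 * A + 1)
  refine ⟨C1 * (C2 + 1), by positivity, fun N hN x hx => ?_⟩
  have := h1 aζ (C2 + 1) (by linarith) (fun n => by
    rw [aζ]
    refine (norm_sub_le _ _).trans ?_
    rw [Complex.norm_real, Real.norm_eq_abs, abs_of_nonneg vonMangoldt_nonneg, norm_one]
    linarith [vonMangoldt_le_log (n := n)]) aζ_abs (fun s hs1 hs2 => (h2 s hs1 hs2).trans (by
      have : 0 ≤ (|s.im| + 2) ^ (1 / 2 : ℝ) := by positivity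
      nlinarith)) N hN x hx
  have e : ∑ n ∈ Finset.Ioc 0 x, aζ n = ((∑ n ∈ Finset.Ioc 0 x, vonMangoldt n - x : ℝ) : ℂ) := by
    simp [aζ]
  rwa [e, Complex.norm_real, Real.norm_eq_abs] at this

theorem natlog_le {N : ℕ} (hN : 3 ≤ N) : (Nat.log 2 N : ℝ) ≤ 2 * Real.log N := by
  have h := Real.natLog_le_logb N 2
  have h2 : Real.logb (2:ℕ) N ≤ 2 * Real.log N := by
    rw [Real.logb, div_le_iff₀ (Real.log_pos (by norm_num))]
    have := Real.log_two_gt_d9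
    have := one_le_log hN
    push_cast
    nlinarith
  exact h.trans h2

open ArithmeticFunction in
theorem noncop (N q x : ℕ) (hN : 3 ≤ N) (hx : x ≤ N) (hq : 1 ≤ q) :
    ∑ n ∈ Finset.Ioc 0 x with ¬ n.Coprime q, vonMangoldt n ≤ 6 * q * Real.log N ^ 2 := by
  have hL := one_le_log hN
  have hs : ∑ n ∈ Finset.Ioc 0 x with ¬ n.Coprime q, vonMangoldt n =
      ∑ n ∈ (Finset.Ioc 0 x).filter (fun n => ¬ n.Coprime q ∧ vonMangoldt n ≠ 0), vonMangoldt n := by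
    rw [← Finset.filter_filter, Finset.sum_filter_ne_zero]
  rw [hs]
  have hsub : (Finset.Ioc 0 x).filter (fun n => ¬ n.Coprime q ∧ vonMangoldt n ≠ 0) ⊆
      (Finset.Ioc 0 q ×ˢ Finset.range (Nat.log 2 N + 1)).image (fun z => z.1 ^ z.2) := by
    intro n hn
    simp only [Finset.mem_filter, Finset.mem_Ioc] at hn
    obtain ⟨⟨hn0, hnx⟩, hnc, hv⟩ := hn
    obtain ⟨p, k, hp, hk, rfl⟩ := (isPrimePow_nat_iff n).mp (vonMangoldt_ne_zero_iff.mp hv)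
    have hpq : p ∣ q := by
      by_contra h
      exact hnc (Nat.Coprime.pow_left k ((Nat.Prime.coprime_iff_not_dvd hp).mpr h))
    refine Finset.mem_image.mpr ⟨(p, k), ?_, rfl⟩
    simp only [Finset.mem_product, Finset.mem_Ioc, Finset.mem_range]
    refine ⟨⟨hp.pos, Nat.le_of_dvd hq hpq⟩, Nat.lt_succ_of_le ?_⟩
    apply Nat.le_log_of_pow_le (by norm_num)
    exact (Nat.pow_le_pow_left hp.two_le k).trans (hnx.trans hx)
  have hcard : (((Finset.Ioc 0 x).filter (fun n => ¬ n.Coprime q ∧ vonMangoldt n ≠ 0)).card : ℝ) ≤ q * (2 * Real.log N + 1) := by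
    have h1 := (Finset.card_le_card hsub).trans Finset.card_image_le
    rw [Finset.card_product, Nat.card_Ioc, Finset.card_range, Nat.sub_zero] at h1
    have h2 : (((Finset.Ioc 0 x).filter (fun n => ¬ n.Coprime q ∧ vonMangoldt n ≠ 0)).card : ℝ) ≤ q * (Nat.log 2 N + 1) := by
      exact_mod_cast h1
    have := natlog_le hN
    exact h2.trans (by gcongr)
  calc _ ≤ ∑ n ∈ (Finset.Ioc 0 x).filter (fun n => ¬ n.Coprime q ∧ vonMangoldt n ≠ 0), Real.log N := by
        refine Finset.sum_le_sum fun n hn => ?_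
        simp only [Finset.mem_filter, Finset.mem_Ioc] at hn
        exact vonMangoldt_le_log.trans (Real.log_le_log (by exact_mod_cast hn.1.1) (by exact_mod_cast hn.1.2.trans hx))
    _ ≤ q * (2 * Real.log N + 1) * Real.log N := by
      rw [Finset.sum_const, nsmul_eq_mul]; gcongr
    _ ≤ _ := by
      have : (1:ℝ) ≤ q := by exact_mod_cast hq
      have : 2 * Real.log N + 1 ≤ 6 * Real.log N := by linarith
      calc _ ≤ q * (6 * Real.log N) * Real.log N := by gcongr
        _ = _ := by ring

open ArithmeticFunction in
theorem siegel_walfisz (A B : ℕ) : ∃ C : ℝ, 0 < C ∧ ∀ N : ℕ, 3 ≤ N → ∀ (q : ℕ) [NeZero q], (q:ℝ) ≤ Real.log N ^ B →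
    ∀ r : ZMod q, IsUnit r → ∀ x ≤ N,
    |∑ n ∈ Finset.Ioc 0 x with ((n : ℕ) : ZMod q) = r, vonMangoldt n - x / (Nat.totient q : ℝ)| ≤ C * (N / Real.log N ^ A) := by
  obtain ⟨C1, hC1, h1⟩ := psi_chi A B
  obtain ⟨C2, hC2, h2⟩ := psi_one A
  obtain ⟨C3, hC3, h3⟩ := log_pow_le (A + B + 2)
  refine ⟨C1 + C2 + 6 * C3, by positivity, fun N hN q _ hq r hr x hx => ?_⟩
  have hL1 : 1 ≤ Real.log N := one_le_log hN
  have hN0 : (3:ℝ) ≤ N := by exact_mod_cast hN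
  have hq1 : 1 ≤ q := Nat.pos_of_ne_zero (NeZero.ne q)
  have hφ : 0 < Nat.totient q := Nat.totient_pos.mpr hq1
  have hφ0 : (0:ℝ) < Nat.totient q := by exact_mod_cast hφ
  set S := ∑ n ∈ Finset.Ioc 0 x with ((n : ℕ) : ZMod q) = r, vonMangoldt n with hS
  set Y := (N:ℝ) / Real.log N ^ A with hY
  have hY0 : 0 ≤ Y := by positivity
  have hone : ‖∑ n ∈ Finset.Ioc 0 x, aχ (1 : DirichletCharacter ℂ q) n - x‖ ≤ (C2 + 6 * C3) * Y := by
    have e : ∑ n ∈ Finset.Ioc 0 x, aχ (1 : DirichletCharacter ℂ q) n = ((∑ n ∈ Finset.Ioc 0 x, vonMangoldt n -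
        ∑ n ∈ Finset.Ioc 0 x with ¬ n.Coprime q, vonMangoldt n : ℝ) : ℂ) := by
      rw [← Finset.sum_filter_add_sum_filter_not (Finset.Ioc 0 x) (fun n => n.Coprime q) (fun n => vonMangoldt n), add_sub_cancel_right, Finset.sum_filter]
      push_cast
      refine Finset.sum_congr rfl fun n _ => ?_
      by_cases h : n.Coprime q
      · rw [if_pos h, aχ, MulChar.one_apply ((ZMod.isUnit_iff_coprime n q).mpr h), one_mul]
      · rw [if_neg h, aχ, MulChar.map_nonunit _ (fun h' => h ((ZMod.isUnit_iff_coprime n q).mp h'))]; simp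
    rw [e, ← Complex.ofReal_natCast, ← Complex.ofReal_sub, Complex.norm_real, Real.norm_eq_abs]
    have a := h2 N hN x hx
    have b := noncop N q x hN hx hq1
    have b0 : 0 ≤ ∑ n ∈ Finset.Ioc 0 x with ¬ n.Coprime q, vonMangoldt n := Finset.sum_nonneg fun n _ => vonMangoldt_nonneg
    have c : 6 * q * Real.log N ^ 2 ≤ 6 * C3 * Y := by
      rw [hY, mul_div_assoc', le_div_iff₀ (by positivity)]
      calc 6 * (q:ℝ) * Real.log N ^ 2 * Real.log N ^ A ≤ 6 * Real.log N ^ B * Real.log N ^ 2 * Real.log N ^ A := by gcongr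
        _ = 6 * Real.log N ^ (A + B + 2) := by ring
        _ ≤ 6 * (C3 * √N) := by gcongr; exact h3 N (by linarith)
        _ ≤ 6 * (C3 * N) := by
          gcongr
          rw [Real.sqrt_le_left (by linarith)]; nlinarith
        _ = _ := by ring
    rw [abs_le] at a ⊢
    constructor <;> linarith
  have horth : (Nat.totient q : ℂ) * (S : ℂ) = ∑ χ : DirichletCharacter ℂ q, χ r⁻¹ * ∑ n ∈ Finset.Ioc 0 x, aχ χ n := by
    simp_rw [Finset.mul_sum]
    rw [Finset.sum_comm, hS, Finset.sum_filter]
    push_cast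
    rw [Finset.mul_sum]
    refine Finset.sum_congr rfl fun n _ => ?_
    simp_rw [aχ, ← mul_assoc]
    rw [← Finset.sum_mul, DirichletCharacter.sum_char_inv_mul_char_eq ℂ hr]
    by_cases h : r = ((n : ℕ) : ZMod q)
    · rw [if_pos h, if_pos h.symm]
    · rw [if_neg h, if_neg (fun h' => h h'.symm)]; simp
  have hr1 : (1 : DirichletCharacter ℂ q) r⁻¹ = 1 := by
    obtain ⟨u, rfl⟩ := hr
    rw [ZMod.inv_coe_unit, MulChar.one_apply_coe]
  rw [← Finset.add_sum_erase _ _ (Finset.mem_univ (1 : DirichletCharacter ℂ q)), hr1, one_mul] at horth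
  have hrest : ‖∑ χ ∈ (Finset.univ : Finset (DirichletCharacter ℂ q)).erase 1, χ r⁻¹ * ∑ n ∈ Finset.Ioc 0 x, aχ χ n‖ ≤ Nat.totient q * (C1 * Y) := by
    calc _ ≤ ∑ χ ∈ (Finset.univ : Finset (DirichletCharacter ℂ q)).erase 1, C1 * Y := by
          refine norm_sum_le_of_le _ fun χ hχ => ?_
          rw [norm_mul]
          have a := h1 N hN q hq χ (Finset.ne_of_mem_erase hχ) x hx
          have b := χ.norm_le_one r⁻¹
          exact (mul_le_of_le_one_left (norm_nonneg _) b).trans a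
      _ ≤ _ := by
        rw [Finset.sum_const, nsmul_eq_mul]
        gcongr
        refine (Finset.card_le_card (Finset.erase_subset _ _)).trans ?_
        rw [Finset.card_univ, ← Nat.card_eq_fintype_card, DirichletCharacter.card_eq_totient_of_hasEnoughRootsOfUnity ℂ q]
  have hfin : (Nat.totient q : ℝ) * |S - x / (Nat.totient q : ℝ)| ≤ Nat.totient q * (C1 * Y) + (C2 + 6 * C3) * Y := by
    have : (Nat.totient q : ℝ) * |S - x / (Nat.totient q : ℝ)| = ‖(Nat.totient q : ℂ) * (S : ℂ) - x‖ := by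
      rw [← Complex.ofReal_natCast, ← Complex.ofReal_natCast, ← Complex.ofReal_mul, ← Complex.ofReal_sub, Complex.norm_real, Real.norm_eq_abs]
      nth_rw 1 [← abs_of_pos hφ0]
      rw [← abs_mul]
      congr 1
      field_simp
    rw [this, horth, add_sub_right_comm]
    refine (norm_add_le _ _).trans ?_
    linarith
  refine le_of_mul_le_mul_left (hfin.trans ?_) hφ0
  have : (1:ℝ) ≤ Nat.totient q := by exact_mod_cast hφ
  have h0 : 0 ≤ (C2 + 6 * C3) * Y := by positivity
  nlinarith

theorem pig (D Y q : ℕ) (G : Finset ℕ) (η : ℝ) (hG : ∀ h ∈ G, h < D) (hY : 1 ≤ Y) (hYD : Y ≤ D) (hq : 1 ≤ q) (hη : 0 < η)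
    (hc : η * D ≤ G.card) (hYq : 4 * q ≤ η * Y) :
    ∃ h ∈ G, ∃ l : ℕ, h + q * l ∈ G ∧ q * l < Y ∧ η * Y ≤ 4 * (q * l) := by
  have hY0 : (1:ℝ) ≤ Y := by exact_mod_cast hY
  have hq0 : (1:ℝ) ≤ q := by exact_mod_cast hq
  have hD0 : (Y:ℝ) ≤ D := by exact_mod_cast hYD
  set t := Finset.range (D / Y + 1) ×ˢ Finset.range q with ht
  have hmap : ∀ h ∈ G, (h / Y, h % q) ∈ t := fun h hh => by
    simp only [ht, Finset.mem_product, Finset.mem_range]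
    exact ⟨Nat.lt_succ_of_le (Nat.div_le_div_right (hG h hh).le), Nat.mod_lt _ hq⟩
  have htn : t.Nonempty := ⟨(0, 0), by simp [ht]; omega⟩
  have htc : (t.card : ℝ) ≤ 2 * D / Y * q := by
    rw [ht, Finset.card_product, Finset.card_range, Finset.card_range]
    push_cast
    gcongr
    have : ((D / Y : ℕ) : ℝ) ≤ D / Y := Nat.cast_div_le
    have h2 : 1 ≤ (D:ℝ) / Y := by rw [le_div_iff₀ (by linarith)]; linarith
    rw [mul_div_assoc]; linarith
  obtain ⟨z, hz, hzc⟩ := Finset.exists_le_card_fiber_of_nsmul_le_card_of_maps_to (b := η * Y / (2 * q)) hmap htn (by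
    refine le_trans ?_ hc
    rw [nsmul_eq_mul]
    calc (t.card:ℝ) * (η * Y / (2 * q)) ≤ 2 * D / Y * q * (η * Y / (2 * q)) := by gcongr
      _ = _ := by field_simp)
  set F := G.filter (fun h => (h / Y, h % q) = z)
  have h2 : (2:ℝ) ≤ η * Y / (2 * q) := by rw [le_div_iff₀ (by positivity)]; linarith
  have hFn : F.Nonempty := by
    rw [← Finset.card_pos]
    have : (0:ℝ) < F.card := by linarith
    exact_mod_cast this
  set a := F.min' hFn
  set b := F.max' hFn
  have ha : a ∈ F := F.min'_mem hFn
  have hb : b ∈ F := F.max'_mem hFn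
  have hab : a ≤ b := F.min'_le b hb
  obtain ⟨haG, hak⟩ := Finset.mem_filter.mp ha
  obtain ⟨hbG, hbk⟩ := Finset.mem_filter.mp hb
  have hk : (a / Y, a % q) = (b / Y, b % q) := hak.trans hbk.symm
  simp only [Prod.mk.injEq] at hk
  obtain ⟨l, hl⟩ := (Nat.modEq_iff_dvd' hab).mp hk.2
  have hbal : b = a + q * l := by omega
  have hcard : F.card ≤ l + 1 := by
    have : F ⊆ (Finset.range (l + 1)).image (fun i => a + q * i) := by
      intro x hx
      have hxa : a ≤ x := F.min'_le x hx
      have hxb : x ≤ b := F.le_max' x hx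
      obtain ⟨hxG, hxk⟩ := Finset.mem_filter.mp hx
      have hk : (a / Y, a % q) = (x / Y, x % q) := hak.trans hxk.symm
      simp only [Prod.mk.injEq] at hk
      obtain ⟨i, hi⟩ := (Nat.modEq_iff_dvd' hxa).mp hk.2
      refine Finset.mem_image.mpr ⟨i, Finset.mem_range.mpr (Nat.lt_succ_of_le ?_), by omega⟩
      exact Nat.le_of_mul_le_mul_left (by omega : q * i ≤ q * l) hq
    refine (Finset.card_le_card this).trans (Finset.card_image_le.trans ?_)
    simp
  refine ⟨a, haG, l, hbal ▸ hbG, ?_, ?_⟩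
  · have h1 := Nat.div_add_mod a Y
    have h2 := Nat.div_add_mod b Y
    have h3 := Nat.mod_lt b hY
    rw [hk.1] at h1
    omega
  · have h3 : (F.card : ℝ) ≤ l + 1 := by exact_mod_cast hcard
    have h4 : η * Y / (2 * q) ≤ 2 * l := by linarith
    rw [div_le_iff₀ (by positivity)] at h4
    linarith

set_option maxHeartbeats 1000000 in
theorem vino (D : ℕ) (G : Finset ℕ) (b η ε : ℝ) (hG : ∀ h ∈ G, h < D) (hη : 0 < η) (hη1 : η ≤ 1)
    (hc : η * D ≤ G.card) (hGb : ∀ h ∈ G, ∃ c : ℤ, |h * b - c| ≤ ε) (hε : 0 < ε) (hε1 : ε < η / 40) (hD : 20 / η ^ 2 ≤ D) :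
    ∃ q : ℕ, 1 ≤ q ∧ q ≤ 5 / η ∧ ∃ c : ℤ, |q * b - c| ≤ 40 * ε / (η ^ 2 * D) := by
  have hη2 : 1 ≤ 1 / η := by rw [le_div_iff₀ hη]; linarith
  have hηη : 1 / η * η = 1 := by field_simp
  have hsq : 20 / η ^ 2 = 20 * (1 / η) * (1 / η) := by field_simp
  have hdiff : ∀ h ∈ G, ∀ m : ℕ, h + m ∈ G → ∃ c : ℤ, |m * b - c| ≤ 2 * ε := by
    intro h hh m hm
    obtain ⟨c1, h1⟩ := hGb h hh
    obtain ⟨c2, h2⟩ := hGb _ hm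
    refine ⟨c2 - c1, ?_⟩
    push_cast at h2 ⊢
    rw [abs_le] at h1 h2 ⊢
    constructor <;> nlinarith
  have hY1 : (⌈4 / η⌉₊ : ℝ) ≤ 5 / η := by
    have := Nat.ceil_lt_add_one (a := 4 / η) (by positivity)
    have h4 : 4 / η = 4 * (1 / η) := by ring
    have h5 : 5 / η = 5 * (1 / η) := by ring
    linarith
  have hD5 : 5 / η ≤ D := by
    refine le_trans ?_ hD
    rw [hsq, show 5 / η = 5 * (1 / η) by ring]
    nlinarith
  obtain ⟨h, hh, q, hq1, hq2, hq3⟩ := pig D ⌈4 / η⌉₊ 1 G η hG (Nat.ceil_pos.mpr (by positivity))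
    (by exact_mod_cast hY1.trans hD5) le_rfl hη hc (by
      have := Nat.le_ceil (4 / η)
      rw [div_le_iff₀ hη] at this
      push_cast; linarith)
  rw [one_mul] at hq1 hq2
  have hceil := Nat.le_ceil (4 / η)
  rw [div_le_iff₀ hη] at hceil
  have hq0 : 1 ≤ q := by
    have : (0:ℝ) < q := by push_cast at hq3; linarith
    exact_mod_cast this
  have hqr : (1:ℝ) ≤ q := by exact_mod_cast hq0
  have hq5 : (q:ℝ) ≤ 5 / η := le_trans (by exact_mod_cast hq2.le) hY1
  refine ⟨q, hq0, hq5, ?_⟩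
  obtain ⟨c, hcq⟩ := hdiff h hh q hq1
  refine ⟨c, ?_⟩
  set θ := q * b - c with hθ
  have hq5' : q * η ≤ 5 := by rwa [le_div_iff₀ hη] at hq5
  have main : ∀ Y : ℕ, 1 ≤ Y → Y ≤ D → 4 * q ≤ η * Y → Y * |θ| ≤ q / 2 → Y * |θ| * η ≤ 8 * ε * q := by
    intro Y hY hYD hYq hYθ
    obtain ⟨h', hh', l, hl1, hl2, hl3⟩ := pig D Y q G η hG hY hYD hq0 hη hc hYq
    obtain ⟨c', hc'⟩ := hdiff h' hh' _ hl1
    have e : ((q * l : ℕ) : ℝ) * b - c' = l * θ + ((l * c - c' : ℤ) : ℝ) := by rw [hθ]; push_cast; ring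
    rw [e] at hc'
    have hlθ : |l * θ| < 1 / 2 ∨ θ = 0 := by
      by_cases h0 : θ = 0
      · exact Or.inr h0
      left
      have hθ0 : 0 < |θ| := abs_pos.mpr h0
      rw [abs_mul, Nat.abs_cast]
      have : (q * l : ℝ) < Y := by exact_mod_cast hl2
      have : (q * l : ℝ) * |θ| < q / 2 := by nlinarith
      nlinarith
    rcases hlθ with hlθ | h0
    swap
    · rw [h0]; simp; positivity
    have hz : (l * c - c' : ℤ) = 0 := by
      have hε2 : 2 * ε < 1 / 2 := by linarith
      have : |((l * c - c' : ℤ) : ℝ)| < 1 := by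
        rw [abs_le] at hc'; rw [abs_lt] at hlθ ⊢
        constructor <;> linarith
      have : |(l * c - c' : ℤ)| < 1 := by exact_mod_cast this
      exact Int.abs_lt_one_iff.mp this
    rw [hz, Int.cast_zero, add_zero, abs_mul, Nat.abs_cast] at hc'
    calc Y * |θ| * η = (η * Y) * |θ| := by ring
      _ ≤ (4 * (q * l)) * |θ| := by gcongr
      _ = 4 * q * (l * |θ|) := by ring
      _ ≤ 4 * q * (2 * ε) := by gcongr
      _ = _ := by ring
  have hD1 : 1 ≤ D := by
    have : (1:ℝ) ≤ D := le_trans (by rw [le_div_iff₀ hη]; linarith) hD5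
    exact_mod_cast this
  by_cases hcase : D * |θ| ≤ q / 2
  · have := main D hD1 le_rfl (by
      rw [hsq] at hD
      have : 20 * (1 / η) * (1 / η) * η ≤ D * η := by gcongr
      have : 20 * (1 / η) * (1 / η) * η = 20 / η := by field_simp
      have : 4 * (q:ℝ) ≤ 20 / η := by rw [le_div_iff₀ hη]; linarith
      linarith) hcase
    have hD0 : (0:ℝ) < D := by exact_mod_cast hD1
    rw [le_div_iff₀ (by positivity)]
    calc |θ| * (η ^ 2 * D) = (D * |θ| * η) * η := by ring
      _ ≤ (8 * ε * q) * η := by gcongr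
      _ = 8 * ε * (q * η) := by ring
      _ ≤ 8 * ε * 5 := by gcongr
      _ = _ := by ring
  · exfalso
    push Not at hcase
    have hθ0 : 0 < |θ| := by
      by_contra h; push Not at h
      have : (D:ℝ) * |θ| ≤ 0 := mul_nonpos_of_nonneg_of_nonpos (by positivity) h
      linarith
    set Y := ⌊q / (2 * |θ|)⌋₊ with hYd
    have hY1 : (Y:ℝ) ≤ q / (2 * |θ|) := Nat.floor_le (by positivity)
    have hY2 : q / (2 * |θ|) < Y + 1 := Nat.lt_floor_add_one _
    rw [le_div_iff₀ (by positivity)] at hY1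
    rw [div_lt_iff₀ (by positivity)] at hY2
    have h10 : 10 * q ≤ η * (Y + 1) := by
      have h1 : (q:ℝ) < (Y + 1) * (4 * ε) := hY2.trans_le (mul_le_mul_of_nonneg_left (by linarith) (by positivity))
      have : (Y + 1) * (4 * ε) ≤ (Y + 1) * (η / 10) := by gcongr; linarith
      linarith
    have h4 : 4 * q ≤ η * Y := by linarith
    have hY0 : 1 ≤ Y := by
      rcases Nat.eq_zero_or_pos Y with h0 | h0
      · rw [h0] at h4; simp at h4; linarith
      · exact h0
    have hYr : (1:ℝ) ≤ Y := by exact_mod_cast hY0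
    have hYD : Y ≤ D := by
      have : (Y:ℝ) ≤ D := by
        by_contra h; push Not at h
        have : D * |θ| ≤ Y * |θ| := by gcongr
        linarith
      exact_mod_cast this
    have h8 := main Y hY0 hYD h4 (by linarith)
    have h9 : q / 4 * η ≤ Y * |θ| * η := by
      gcongr
      have : 1 * |θ| ≤ Y * |θ| := by gcongr
      linarith
    have : q * (32 * ε) < q * η := by gcongr; linarith
    linarith

noncomputable def ee (x : ℝ) : ℂ := Complex.exp ((2 * π * x : ℝ) * Complex.I)

theorem ee_add (x y : ℝ) : ee (x + y) = ee x * ee y := by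
  rw [ee, ee, ee, ← Complex.exp_add]; congr 1; push_cast; ring

theorem ee_zero : ee 0 = 1 := by simp [ee]

theorem ee_norm (x : ℝ) : ‖ee x‖ = 1 := Complex.norm_exp_ofReal_mul_I _

theorem ee_int (n : ℤ) : ee n = 1 := by
  rw [ee, Complex.exp_eq_one_iff]; exact ⟨n, by push_cast; ring⟩

theorem ee_neg (x : ℝ) : ee (-x) = (starRingEnd ℂ) (ee x) := by
  rw [ee, ee, ← Complex.exp_conj, map_mul, Complex.conj_ofReal, Complex.conj_I]
  congr 1; push_cast; ring

theorem ee_conj_mul (x : ℝ) : ee x * (starRingEnd ℂ) (ee x) = 1 := by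
  rw [← ee_neg, ← ee_add, add_neg_cancel, ee_zero]

theorem ee_nat (n : ℕ) (x : ℝ) : ee (n * x) = ee x ^ n := by
  rw [ee, ee, ← Complex.exp_nat_mul]; congr 1; push_cast; ring

theorem ee_lower (x : ℝ) (hx : |x| ≤ 1 / 2) : 4 * |x| ≤ ‖ee x - 1‖ := by
  rw [ee, mul_comm ((_ : ℝ) : ℂ), Complex.norm_exp_I_mul_ofReal_sub_one, norm_mul, Real.norm_eq_abs, Real.norm_eq_abs, abs_two,
    show 2 * π * x / 2 = π * x by ring]
  have h : 2 / π * (π * |x|) ≤ Real.sin (π * |x|) := Real.mul_le_sin (by positivity) (by nlinarith [Real.pi_pos])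
  have h2 : Real.sin (π * |x|) ≤ |Real.sin (π * x)| := by
    rcases abs_cases x with h | h <;> rw [h.1]
    · exact le_abs_self _
    · rw [mul_neg, Real.sin_neg]; exact neg_le_abs _
  have h3 : 2 / π * (π * |x|) = 2 * |x| := by field_simp
  linarith

theorem ee_lip (x : ℝ) : ‖ee x - 1‖ ≤ 7 * |x| := by
  rw [ee, mul_comm ((_ : ℝ) : ℂ)]
  refine (Real.norm_exp_I_mul_ofReal_sub_one_le).trans ?_
  rw [Real.norm_eq_abs, abs_mul, abs_of_pos (by positivity)]
  gcongr
  have := Real.pi_lt_d2; linarith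

theorem geom_bound (x t : ℝ) (n : ℕ) (ht : 0 < t) (hx : ∀ c : ℤ, t ≤ |x - c|) : ‖∑ i ∈ Finset.range n, ee (i * x)‖ ≤ 1 / (2 * t) := by
  have e0 : ee x = ee (x - round x) := by
    conv_lhs => rw [show x = (x - round x) + round x by ring, ee_add, ee_int, mul_one]
  have h1 := ee_lower (x - round x) (abs_sub_round x)
  have h2 := hx (round x)
  rw [← e0] at h1
  have hne : ee x ≠ 1 := by
    intro h; rw [h, sub_self, norm_zero] at h1; linarith
  simp_rw [ee_nat]
  rw [geom_sum_eq hne, norm_div]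
  have h3 : ‖ee x ^ n - 1‖ ≤ 2 := by
    refine (norm_sub_le _ _).trans ?_
    rw [norm_pow, ee_norm]; norm_num
  calc _ ≤ 2 / (4 * t) := by gcongr; linarith
    _ = _ := by field_simp; norm_num

def IsP : ℕ → ℝ → (ℕ → ℝ) → Prop
  | 0, a, φ => ∀ n, φ n = a
  | k + 1, a, φ => ∀ h : ℕ, IsP k (h * a) (fun n => φ (n + h) - φ n)

theorem vdc (z : ℕ → ℂ) (hz : ∀ n, ‖z n‖ = 1) (m : ℕ) :
    ‖∑ n ∈ Finset.range m, z n‖ ^ 2 ≤ m + 2 * ∑ h ∈ Finset.range m, ‖∑ n ∈ Finset.range (m - (h + 1)), z (n + (h + 1)) * (starRingEnd ℂ) (z n)‖ := by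
  set T : ℕ → ℕ → ℂ := fun h m => ∑ n ∈ Finset.range (m - (h + 1)), z (n + (h + 1)) * (starRingEnd ℂ) (z n) with hT
  have key : ∀ m : ℕ, (∑ n ∈ Finset.range m, z n) * (starRingEnd ℂ) (∑ n ∈ Finset.range m, z n) =
      m + ∑ h ∈ Finset.range m, (T h m + (starRingEnd ℂ) (T h m)) := by
    intro m
    induction m with
    | zero => simp
    | succ m ih =>
      have hstep : ∀ h ∈ Finset.range m, T h (m + 1) = T h m + z m * (starRingEnd ℂ) (z (m - 1 - h)) := by
        intro h hh
        rw [Finset.mem_range] at hh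
        simp only [hT]
        rw [show m + 1 - (h + 1) = (m - (h + 1)) + 1 by omega, Finset.sum_range_succ, show m - (h + 1) + (h + 1) = m by omega,
          show m - (h + 1) = m - 1 - h by omega]
      have hlast : T m (m + 1) = 0 := by simp [hT]
      have hsum : ∑ h ∈ Finset.range m, T h (m + 1) = ∑ h ∈ Finset.range m, T h m + z m * (starRingEnd ℂ) (∑ n ∈ Finset.range m, z n) := by
        rw [Finset.sum_congr rfl hstep, Finset.sum_add_distrib, ← Finset.mul_sum, ← map_sum, Finset.sum_range_reflect]
      rw [Finset.sum_range_succ, Finset.sum_range_succ, hlast, Finset.sum_add_distrib, ← map_sum, hsum]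
      rw [Finset.sum_add_distrib, ← map_sum] at ih
      have h1 : z m * (starRingEnd ℂ) (z m) = 1 := by
        rw [Complex.mul_conj, Complex.normSq_eq_norm_sq, hz]; simp
      simp only [map_add, map_mul, Complex.conj_conj, map_zero, add_zero]
      push_cast
      linear_combination ih + h1
  have h1 := key m
  rw [Complex.mul_conj, Complex.normSq_eq_norm_sq] at h1
  have h2 := congrArg (fun w : ℂ => ‖w‖) h1
  simp only [Complex.norm_real, norm_pow, norm_norm] at h2
  rw [h2]
  refine (norm_add_le _ _).trans ?_
  rw [Complex.norm_natCast, Finset.mul_sum]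
  gcongr
  refine norm_sum_le_of_le _ fun h _ => ?_
  refine (norm_add_le _ _).trans ?_
  rw [RCLike.norm_conj]; linarith

set_option maxHeartbeats 2000000 in
theorem weyl (k : ℕ) : ∃ (C : ℝ) (E : ℕ), 1 ≤ C ∧ ∀ (a : ℝ) (φ : ℕ → ℝ), IsP (k + 1) a φ → ∀ (P : ℝ) (D m : ℕ), 1 ≤ P → 1 ≤ D → m ≤ D →
    D ≤ P * ‖∑ n ∈ Finset.range m, ee (φ n)‖ → ∃ q : ℕ, 1 ≤ q ∧ q ≤ C * P ^ E ∧ ∃ c : ℤ, |q * a - c| ≤ C * P ^ E / D ^ (k + 1) := by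
  induction k with
  | zero =>
    refine ⟨1, 1, le_rfl, fun a φ hφ P D m hP hD hm h => ⟨1, le_rfl, by simpa using hP, ?_⟩⟩
    by_contra hcon
    push Not at hcon
    have hD0 : (0:ℝ) < D := by exact_mod_cast hD
    have e : ∀ n, ee (φ n) = ee (n * a) * ee (φ 0) := by
      intro n
      have := hφ n 0
      rw [← ee_add]; congr 1
      simp only [zero_add] at this; linarith
    have hb := geom_bound a (P / D) m (by positivity) (fun c => by simpa using (hcon c).le)
    rw [Finset.sum_congr rfl (fun n _ => e n), ← Finset.sum_mul, norm_mul, ee_norm, mul_one] at h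
    have : P * ‖∑ n ∈ Finset.range m, ee (n * a)‖ ≤ P * (1 / (2 * (P / D))) := by gcongr
    have e2 : P * (1 / (2 * (P / D))) = D / 2 := by field_simp
    linarith
  | succ k ih =>
    obtain ⟨C, E, hC, ih⟩ := ih
    set K : ℝ := 1280 * C ^ 2 * 64 ^ E with hK
    have hK1 : 1 ≤ K := by
      have h1 : (1:ℝ) ≤ C ^ 2 := one_le_pow₀ hC
      have h2 : (1:ℝ) ≤ 64 ^ E := one_le_pow₀ (by norm_num)
      have : (1:ℝ) ≤ C ^ 2 * 64 ^ E := one_le_mul_of_one_le_of_one_le h1 h2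
      rw [hK]; linarith
    refine ⟨K ^ (k + 3), (4 + 4 * E) * (k + 3), one_le_pow₀ hK1, fun a φ hφ P D m hP hD hm h => ?_⟩
    set P1 : ℝ := C * (8 * P ^ 2) ^ E with hP1
    have hP2 : 1 ≤ P ^ 2 := one_le_pow₀ hP
    have hP11 : 1 ≤ P1 := one_le_mul_of_one_le_of_one_le hC (one_le_pow₀ (by linarith))
    set X : ℝ := 1280 * P ^ 4 * P1 ^ 2 with hX
    have hXK : K ^ (k + 3) * P ^ ((4 + 4 * E) * (k + 3)) = X ^ (k + 3) := by
      rw [hX, hK, hP1, pow_mul, ← mul_pow]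
      congr 1
      rw [show (64:ℝ) ^ E = (8 ^ E) ^ 2 by rw [← pow_mul, mul_comm, pow_mul]; norm_num]
      rw [mul_pow 8, ← pow_mul P, mul_pow C, mul_pow (8 ^ E), ← pow_mul P]
      ring
    rw [hXK]
    have hP40 : 1 ≤ P ^ 4 := one_le_pow₀ hP
    have hP1sq : P1 ≤ P1 ^ 2 := le_self_pow₀ hP11 (by norm_num)
    have hPP : P1 ≤ P ^ 4 * P1 ^ 2 := by nlinarith
    have hX1 : 1 ≤ X := by rw [hX]; nlinarith
    have hP1X : P1 ≤ X := by rw [hX]; nlinarith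
    have hD0 : (1:ℝ) ≤ D := by exact_mod_cast hD
    by_cases hDX : X ≤ D
    swap
    · refine ⟨1, le_rfl, by simpa using one_le_pow₀ hX1, round a, ?_⟩
      rw [Nat.cast_one, one_mul]
      refine (abs_sub_round a).trans ?_
      rw [le_div_iff₀ (by positivity)]
      have h1 : (D:ℝ) ^ (k + 1 + 1) ≤ X ^ (k + 1 + 1) := by gcongr; linarith
      have h2 : X ^ (k + 1 + 1) ≤ X ^ (k + 3) := pow_le_pow_right₀ hX1 (by omega)
      have : (0:ℝ) ≤ D ^ (k + 1 + 1) := by positivity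
      linarith
    set S : ℕ → ℂ := fun h => ∑ n ∈ Finset.range (m - (h + 1)), ee (φ (n + (h + 1)) - φ n) with hS
    have hmD : (m:ℝ) ≤ D := by exact_mod_cast hm
    have hvdc : (D:ℝ) ^ 2 ≤ P ^ 2 * (D + 2 * ∑ h ∈ Finset.range m, ‖S h‖) := by
      calc (D:ℝ) ^ 2 ≤ (P * ‖∑ n ∈ Finset.range m, ee (φ n)‖) ^ 2 := by gcongr
        _ = P ^ 2 * ‖∑ n ∈ Finset.range m, ee (φ n)‖ ^ 2 := by ring
        _ ≤ _ := by
          gcongr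
          refine (vdc (fun n => ee (φ n)) (fun n => ee_norm _) m).trans ?_
          simp only [hS, sub_eq_add_neg, ee_add, ee_neg]
          gcongr
    set G := (Finset.range m).filter (fun h => D ≤ 8 * P ^ 2 * ‖S h‖) with hG
    have hSb : ∀ h, ‖S h‖ ≤ D := fun h => by
      calc _ ≤ ∑ n ∈ Finset.range (m - (h + 1)), (1:ℝ) := norm_sum_le_of_le _ fun n _ => (ee_norm _).le
        _ = ((m - (h + 1) : ℕ) : ℝ) := by simp
        _ ≤ D := by exact_mod_cast (by omega : m - (h + 1) ≤ D)
    have hGc : (D:ℝ) ≤ 8 * P ^ 2 * G.card := by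
      have h1 : 8 * P ^ 2 * ∑ h ∈ Finset.range m, ‖S h‖ ≤ 8 * P ^ 2 * G.card * D + D * D := by
        rw [← Finset.sum_filter_add_sum_filter_not (Finset.range m) (fun h => D ≤ 8 * P ^ 2 * ‖S h‖), mul_add]
        refine add_le_add ?_ ?_
        · rw [mul_assoc (8 * P ^ 2)]; gcongr
          refine (Finset.sum_le_card_nsmul _ _ (D:ℝ) fun h _ => hSb h).trans ?_
          rw [nsmul_eq_mul]
        · rw [Finset.mul_sum]
          refine (Finset.sum_le_card_nsmul _ _ (D:ℝ) fun h hh => ?_).trans ?_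
          · have := (Finset.mem_filter.mp hh).2
            linarith
          · rw [nsmul_eq_mul]; gcongr
            refine (Finset.card_filter_le _ _).trans ?_
            simpa using hm
      have h2 : 4 * P ^ 2 ≤ D := by
        refine le_trans ?_ hDX
        rw [hX]
        have : P ^ 2 ≤ P ^ 4 := pow_le_pow_right₀ hP (by norm_num)
        have : P ^ 4 * 1 ≤ P ^ 4 * P1 ^ 2 := by gcongr; nlinarith
        nlinarith
      have h3 : 4 * P ^ 2 * D ≤ D * D := by gcongr
      have h4 : D * D ≤ 8 * P ^ 2 * G.card * D := by nlinarith
      exact le_of_mul_le_mul_right h4 (by linarith)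
    have hex : ∀ h ∈ G, ∃ q : ℕ, 1 ≤ q ∧ q ≤ P1 ∧ ∃ c : ℤ, |q * (((h + 1 : ℕ) : ℝ) * a) - c| ≤ P1 / D ^ (k + 1) := by
      intro h hh
      exact ih _ _ (hφ (h + 1)) (8 * P ^ 2) D (m - (h + 1)) (by linarith) hD (by omega) (Finset.mem_filter.mp hh).2
    choose! qf hq1 hq2 hq3 using hex
    obtain ⟨q, hq, hqc⟩ := Finset.exists_le_card_fiber_of_nsmul_le_card_of_maps_to (b := (D:ℝ) / (8 * P ^ 2 * P1)) (t := Finset.Icc 1 ⌊P1⌋₊) (f := qf) (s := G)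
      (fun h hh => Finset.mem_Icc.mpr ⟨hq1 h hh, Nat.le_floor (hq2 h hh)⟩) ⟨1, Finset.mem_Icc.mpr ⟨le_rfl, Nat.le_floor (by simpa using hP11)⟩⟩ (by
        rw [nsmul_eq_mul, Nat.card_Icc, Nat.add_sub_cancel]
        calc (⌊P1⌋₊:ℝ) * (D / (8 * P ^ 2 * P1)) ≤ P1 * (D / (8 * P ^ 2 * P1)) := by gcongr; exact Nat.floor_le (by linarith)
          _ = D / (8 * P ^ 2) := by field_simp
          _ ≤ _ := by rw [div_le_iff₀ (by positivity)]; linarith)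
    obtain ⟨hqa, hqb⟩ := Finset.mem_Icc.mp hq
    have hqb : (q:ℝ) ≤ P1 := (Nat.le_floor_iff (by linarith)).mp hqb
    have hη1 : 1 ≤ 8 * P ^ 2 * P1 := by nlinarith
    have hkD : (D:ℝ) ≤ D ^ (k + 1) := le_self_pow₀ hD0 (by omega)
    obtain ⟨q', h1, h2, c, h3⟩ := vino D ((G.filter (fun h => qf h = q)).image (· + 1)) (q * a) (1 / (8 * P ^ 2 * P1)) (P1 / D ^ (k + 1))
      (by
        intro h hh
        obtain ⟨h', hh', rfl⟩ := Finset.mem_image.mp hh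
        obtain ⟨h1, h2⟩ := Finset.mem_filter.mp (Finset.mem_filter.mp hh').1
        have := Finset.mem_range.mp h1
        by_contra hcon
        have : m - (h' + 1) = 0 := by omega
        simp only [hS, this, Finset.range_zero, Finset.sum_empty, norm_zero, mul_zero] at h2
        linarith)
      (by positivity) (by rw [div_le_iff₀ (by positivity)]; linarith)
      (by
        rw [Finset.card_image_of_injective _ (add_left_injective 1)]
        refine le_trans (le_of_eq ?_) hqc
        ring)
      (by
        intro h hh
        obtain ⟨h', hh', rfl⟩ := Finset.mem_image.mp hh
        obtain ⟨h1, h2⟩ := Finset.mem_filter.mp hh'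
        obtain ⟨c, hc⟩ := hq3 h' h1
        refine ⟨c, ?_⟩
        rw [h2] at hc
        convert hc using 3
        ring)
      (by positivity)
      (by
        rw [div_lt_iff₀ (by positivity), div_mul_eq_mul_div, div_mul_eq_mul_div, one_mul, lt_div_iff₀ (by positivity), lt_div_iff₀ (by positivity)]
        refine lt_of_lt_of_le ?_ (hDX.trans hkD)
        rw [hX]
        have : P ^ 2 ≤ P ^ 4 := pow_le_pow_right₀ hP (by norm_num)
        have : P ^ 2 * P1 ^ 2 ≤ P ^ 4 * P1 ^ 2 := by gcongr
        nlinarith)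
      (by
        refine le_trans (le_of_eq ?_) hDX
        rw [hX]; field_simp; norm_num)
    refine ⟨q' * q, Nat.mul_pos h1 hqa, ?_, c, ?_⟩
    · push_cast
      calc (q':ℝ) * q ≤ 5 / (1 / (8 * P ^ 2 * P1)) * P1 := by gcongr
        _ = 40 * (P ^ 2 * P1 ^ 2) := by field_simp; norm_num
        _ ≤ X := by
          rw [hX]
          have : P ^ 2 ≤ P ^ 4 := pow_le_pow_right₀ hP (by norm_num)
          have : P ^ 2 * P1 ^ 2 ≤ P ^ 4 * P1 ^ 2 := by gcongr
          nlinarith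
        _ ≤ X ^ (k + 3) := le_self_pow₀ hX1 (by omega)
    · rw [Nat.cast_mul, mul_assoc]
      refine h3.trans ?_
      calc 40 * (P1 / (D:ℝ) ^ (k + 1)) / ((1 / (8 * P ^ 2 * P1)) ^ 2 * D) = 2 * X * P1 / D ^ (k + 1 + 1) := by
            rw [hX]; field_simp; ring
        _ ≤ _ := by
          gcongr
          have h2X : 2 ≤ X := by rw [hX]; nlinarith
          calc 2 * X * P1 ≤ X * X * X := by gcongr
            _ = X ^ 3 := by ring
            _ ≤ X ^ (k + 3) := pow_le_pow_right₀ hX1 (by omega)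

theorem isP_poly (k : ℕ) : ∀ (g : Polynomial ℝ), g.natDegree ≤ k → IsP k (k.factorial * g.coeff k) (fun n => g.eval (n:ℝ)) := by
  induction k with
  | zero =>
    intro g hg n
    rw [Polynomial.eq_C_of_natDegree_le_zero hg]; simp
  | succ k ih =>
    intro g hg h
    set g' := Polynomial.taylor (h:ℝ) g - g with hg'
    have hd1 := Polynomial.natDegree_hasseDeriv_le g k
    have hlin := Polynomial.eq_X_add_C_of_natDegree_le_one (p := Polynomial.hasseDeriv k g) (by omega)
    have hc : g'.coeff k = (k + 1) * h * g.coeff (k + 1) := by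
      rw [hg', Polynomial.coeff_sub, Polynomial.taylor_coeff, hlin]
      simp only [Polynomial.hasseDeriv_coeff]
      simp [add_comm 1 k]
      ring
    have hdeg : g'.natDegree ≤ k := by
      rw [Polynomial.natDegree_le_iff_coeff_eq_zero]
      intro m hm
      rw [hg', Polynomial.coeff_sub, Polynomial.taylor_coeff]
      have hd := Polynomial.natDegree_hasseDeriv_le g m
      rw [Polynomial.eq_C_of_natDegree_le_zero (p := Polynomial.hasseDeriv m g) (by omega)]
      simp [Polynomial.hasseDeriv_coeff]
    have := ih g' hdeg
    rw [hc] at this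
    have e1 : (k.factorial : ℝ) * ((k + 1) * h * g.coeff (k + 1)) = h * ((k + 1).factorial * g.coeff (k + 1)) := by
      rw [Nat.factorial_succ]; push_cast; ring
    have e2 : (fun n : ℕ => g'.eval (n:ℝ)) = fun n : ℕ => g.eval ((n + h : ℕ) : ℝ) - g.eval (n:ℝ) := by
      funext n
      rw [hg', Polynomial.eval_sub, Polynomial.taylor_eval]; push_cast; rfl
    rw [e1, e2] at this
    exact this

/-- values of `f` at `d + 1`. -/
def Fv (f : Polynomial ℤ) (d : ℕ) : ℤ := f.eval ((d : ℤ) + 1)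

theorem isP_f (f : Polynomial ℤ) (α : ℝ) : IsP f.natDegree ((f.natDegree.factorial * f.leadingCoeff : ℝ) * α) (fun n => α * Fv f n) := by
  have h := isP_poly f.natDegree (Polynomial.C α * (Polynomial.taylor 1 f).map (Int.castRingHom ℝ)) (by
    refine (Polynomial.natDegree_C_mul_le _ _).trans (Polynomial.natDegree_map_le.trans ?_)
    rw [Polynomial.natDegree_taylor])
  rw [Polynomial.coeff_C_mul, Polynomial.coeff_map, Polynomial.coeff_taylor_natDegree] at h
  have e2 : (fun n : ℕ => (Polynomial.C α * (Polynomial.taylor 1 f).map (Int.castRingHom ℝ)).eval (n:ℝ)) = fun n => α * (Fv f n : ℝ) := by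
    funext n
    rw [Polynomial.eval_C_mul, Polynomial.eval_map, Fv, ← Polynomial.taylor_eval]
    rw [← Int.cast_natCast, ← eq_intCast (Int.castRingHom ℝ) (n:ℤ), Polynomial.eval₂_at_apply]
    simp
  rw [e2] at h
  convert h using 1
  simp; ring

theorem weyl_f (f : Polynomial ℤ) (hk : 1 ≤ f.natDegree) (hc : 0 < f.leadingCoeff) : ∃ (C : ℝ) (E : ℕ), 1 ≤ C ∧ ∀ (α P : ℝ) (D : ℕ), 1 ≤ P → 1 ≤ D →
    D ≤ P * ‖∑ n ∈ Finset.range D, ee (α * Fv f n)‖ → ∃ q : ℕ, 1 ≤ q ∧ q ≤ C * P ^ E ∧ ∃ c : ℤ, IsCoprime (c : ℤ) (q : ℤ) ∧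
      |α - c / q| ≤ C * P ^ E / D ^ f.natDegree := by
  obtain ⟨C, E, hC, h⟩ := weyl (f.natDegree - 1)
  rw [Nat.sub_add_cancel hk] at h
  lift f.leadingCoeff to ℕ using hc.le with l hl
  have hl1 : 1 ≤ l := by exact_mod_cast hc
  set A := f.natDegree.factorial * l with hA
  have hA1 : 1 ≤ A := Nat.mul_pos (Nat.factorial_pos _) hl1
  have hA1' : (1:ℝ) ≤ A := by exact_mod_cast hA1
  refine ⟨A * C, E, one_le_mul_of_one_le_of_one_le hA1' hC, fun α P D hP hD hW => ?_⟩
  obtain ⟨q, hq1, hq2, c, hc⟩ := h _ _ (isP_f f α) P D D hP hD le_rfl hW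
  have hPE : 1 ≤ P ^ E := one_le_pow₀ hP
  have hqA : 1 ≤ q * A := Nat.mul_pos hq1 hA1
  set r : ℚ := c / (q * A : ℕ) with hr
  have hden : (r.den : ℤ) ∣ (q * A : ℕ) := by
    rw [hr, ← Int.cast_natCast (q * A), ← Rat.divInt_eq_div]; exact Rat.den_dvd _ _
  have hden2 : r.den ≤ q * A := Nat.le_of_dvd hqA (by exact_mod_cast hden)
  refine ⟨r.den, r.pos, ?_, r.num, ?_, ?_⟩
  · calc (r.den:ℝ) ≤ (q * A : ℕ) := by exact_mod_cast hden2
      _ = A * q := by push_cast; ring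
      _ ≤ A * (C * P ^ E) := by gcongr
      _ = _ := by ring
  · rw [Int.isCoprime_iff_nat_coprime]; simpa using r.reduced
  · have e : (r.num : ℝ) / r.den = c / (q * A : ℕ) := by
      have : ((r : ℚ) : ℝ) = (r.num : ℝ) / r.den := Rat.cast_def r
      rw [← this, hr]; push_cast; ring
    rw [e]
    have hq0 : (1:ℝ) ≤ (q * A : ℕ) := by exact_mod_cast hqA
    have e2 : α - c / (q * A : ℕ) = (q * ((f.natDegree.factorial * f.leadingCoeff : ℝ) * α) - c) / (q * A : ℕ) := by
      rw [← hl, hA]; push_cast; field_simp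
    rw [e2, abs_div, Nat.abs_cast]
    calc _ ≤ |(q * ((f.natDegree.factorial * f.leadingCoeff : ℝ) * α) - c)| := div_le_self (abs_nonneg _) hq0
      _ ≤ C * P ^ E / D ^ f.natDegree := hc
      _ ≤ _ := by
        gcongr
        exact le_mul_of_one_le_left (by linarith) hA1'

/-- correlation count along the values `F d`, `d < D`. -/
noncomputable def Rc (N D : ℕ) (F : ℕ → ℤ) (u : ℕ → ℝ) : ℝ :=
  ∑ d ∈ Finset.range D, ∑ n ∈ Finset.Ioc 0 N, ∑ m ∈ Finset.Ioc 0 N, if (m : ℤ) - n = F d then u n * u m else 0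

noncomputable def Sf (N : ℕ) (u : ℕ → ℝ) (α : ℝ) : ℂ := ∑ n ∈ Finset.Ioc 0 N, (u n : ℂ) * ee (n * α)

theorem ortho (M : ℕ) (hM : 1 ≤ M) (t : ℤ) : ∑ j ∈ Finset.range M, ee ((j:ℝ) * (t / M)) = if (M : ℤ) ∣ t then (M : ℂ) else 0 := by
  have hM0 : (M:ℝ) ≠ 0 := by positivity
  split_ifs with h
  · obtain ⟨c, rfl⟩ := h
    have : ∀ j ∈ Finset.range M, ee ((j:ℝ) * (((M * c : ℤ) : ℝ) / M)) = 1 := fun j _ => by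
      rw [show (j:ℝ) * (((M * c : ℤ) : ℝ) / M) = ((j * c : ℤ) : ℝ) by push_cast; field_simp]
      exact ee_int _
    rw [Finset.sum_congr rfl this]; simp
  · simp_rw [ee_nat]
    have hne : ee ((t:ℝ) / M) ≠ 1 := by
      intro h1
      rw [ee, Complex.exp_eq_one_iff] at h1
      obtain ⟨n, hn⟩ := h1
      apply h
      refine ⟨n, ?_⟩
      have h2 : ((2 * π * (t / M) : ℝ) : ℂ) = ((n * (2 * π) : ℝ) : ℂ) := by
        apply mul_right_cancel₀ Complex.I_ne_zero
        rw [hn]; push_cast; ring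
      have h3 : 2 * π * ((t:ℝ) / M) = n * (2 * π) := by exact_mod_cast h2
      have h4 : (t:ℝ) = M * n := by
        have : (t:ℝ) / M = n := by
          apply mul_left_cancel₀ (show (2 * π) ≠ 0 by positivity); linarith
        rw [← this]; field_simp
      exact_mod_cast h4
    rw [geom_sum_eq hne, ← ee_nat, show (M:ℝ) * (t / M) = (t:ℤ) by field_simp, ee_int, sub_self, zero_div]

theorem Sf_sq (N : ℕ) (u : ℕ → ℝ) (α : ℝ) : ((‖Sf N u α‖ ^ 2 : ℝ) : ℂ) =
    ∑ n ∈ Finset.Ioc 0 N, ∑ m ∈ Finset.Ioc 0 N, (u n * u m : ℂ) * ee ((n - m : ℤ) * α) := by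
  rw [← Complex.normSq_eq_norm_sq, ← Complex.mul_conj, Sf, map_sum, Finset.sum_mul_sum]
  refine Finset.sum_congr rfl fun n _ => Finset.sum_congr rfl fun m _ => ?_
  rw [map_mul, Complex.conj_ofReal, ← ee_neg, show (((n:ℤ) - m : ℤ) : ℝ) * α = n * α + -(m * α) by push_cast; ring, ee_add]
  ring

theorem fourier_id (N D M : ℕ) (F : ℕ → ℤ) (u : ℕ → ℝ) (hM : 1 ≤ M) (hF : ∀ d < D, |F d| + N ≤ M) :
    ∑ j ∈ Finset.range M, (∑ d ∈ Finset.range D, ee ((j / M : ℝ) * F d)) * ((‖Sf N u (j / M)‖ ^ 2 : ℝ) : ℂ) = M * (Rc N D F u : ℂ) := by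
  simp_rw [Sf_sq, Finset.sum_mul_sum, Finset.mul_sum]
  rw [Rc]
  push_cast
  rw [Finset.sum_comm, Finset.mul_sum]
  refine Finset.sum_congr rfl fun d hd => ?_
  rw [Finset.sum_comm, Finset.mul_sum]
  refine Finset.sum_congr rfl fun n hn => ?_
  rw [Finset.sum_comm, Finset.mul_sum]
  refine Finset.sum_congr rfl fun m hm => ?_
  have e : ∀ j ∈ Finset.range M, ee ((j / M : ℝ) * F d) * ((u n * u m : ℂ) * ee (((n:ℝ) - m) * (j / M))) =
      (u n * u m : ℂ) * ee ((j:ℝ) * ((F d + n - m : ℤ) / M)) := by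
    intro j _
    rw [mul_left_comm, ← ee_add]
    congr 2; push_cast; ring
  rw [Finset.sum_congr rfl e, ← Finset.mul_sum, ortho M hM]
  have h1 := hF d (Finset.mem_range.mp hd)
  rw [Finset.mem_Ioc] at hn hm
  have hiff : (M:ℤ) ∣ F d + n - m ↔ (m:ℤ) - n = F d := by
    constructor
    · intro h
      have := Int.eq_zero_of_abs_lt_dvd h (by rw [abs_lt]; rcases abs_cases (F d) with h | h <;> constructor <;> omega)
      linarith
    · intro h
      rw [← h]; simp
  simp only [hiff]
  split_ifs
  · push_cast; ring
  · simp

theorem parseval (N M : ℕ) (u : ℕ → ℝ) (hM : 1 ≤ M) (hN : N ≤ M) :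
    ∑ j ∈ Finset.range M, ‖Sf N u (j / M)‖ ^ 2 = M * ∑ n ∈ Finset.Ioc 0 N, u n ^ 2 := by
  have h := fourier_id N 1 M (fun _ => 0) u hM (by intro d _; simpa using hN)
  have e : Rc N 1 (fun _ => 0) u = ∑ n ∈ Finset.Ioc 0 N, u n ^ 2 := by
    simp only [Rc, Finset.range_one, Finset.sum_singleton]
    refine Finset.sum_congr rfl fun n hn => ?_
    rw [Finset.sum_eq_single_of_mem n hn]
    · simp [sq]
    · intro m _ hmn
      rw [if_neg]; omega
  rw [e] at h
  simp only [Finset.range_one, Finset.sum_singleton, Int.cast_zero, mul_zero, ee_zero, one_mul] at h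
  exact_mod_cast h

theorem circle (N D M : ℕ) (F : ℕ → ℤ) (u v : ℕ → ℝ) (P η B : ℝ) (hM : 1 ≤ M) (hF : ∀ d < D, |F d| + N ≤ M) (hNM : N ≤ M) (hP : 1 ≤ P)
    (J : Finset ℕ) (hJ : ∀ j ∈ Finset.range M, D ≤ P * ‖∑ d ∈ Finset.range D, ee ((j / M : ℝ) * F d)‖ → j ∈ J)
    (h1 : ∀ j ∈ J, ‖Sf N u (j / M) - Sf N v (j / M)‖ ≤ η) (h2 : ∀ j ∈ J, ‖Sf N u (j / M)‖ + ‖Sf N v (j / M)‖ ≤ B) (hη : 0 ≤ η) (hB : 0 ≤ B) :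
    |Rc N D F u - Rc N D F v| ≤ D / P * (∑ n ∈ Finset.Ioc 0 N, u n ^ 2 + ∑ n ∈ Finset.Ioc 0 N, v n ^ 2) + J.card * D * η * B / M := by
  have hM0 : (0:ℝ) < M := by exact_mod_cast hM
  set W : ℕ → ℂ := fun j => ∑ d ∈ Finset.range D, ee ((j / M : ℝ) * F d) with hW
  set U : ℕ → ℝ := fun j => ‖Sf N u (j / M)‖ with hU
  set V : ℕ → ℝ := fun j => ‖Sf N v (j / M)‖ with hV
  have hWD : ∀ j, ‖W j‖ ≤ D := fun j => by
    calc _ ≤ ∑ d ∈ Finset.range D, (1:ℝ) := norm_sum_le_of_le _ fun n _ => (ee_norm _).le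
      _ = D := by simp
  have hid : (M * (Rc N D F u - Rc N D F v) : ℝ) = ∑ j ∈ Finset.range M, W j * ((U j ^ 2 - V j ^ 2 : ℝ) : ℂ) := by
    push_cast
    rw [mul_sub, ← fourier_id N D M F u hM hF, ← fourier_id N D M F v hM hF, ← Finset.sum_sub_distrib]
    refine Finset.sum_congr rfl fun j _ => ?_
    simp only [hW, hU, hV]; push_cast; ring
  have hterm : ∀ j ∈ Finset.range M, ‖W j * ((U j ^ 2 - V j ^ 2 : ℝ) : ℂ)‖ ≤ D / P * (U j ^ 2 + V j ^ 2) + if j ∈ J then D * (η * B) else 0 := by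
    intro j hj
    rw [norm_mul, Complex.norm_real, Real.norm_eq_abs]
    split_ifs with hjJ
    · have a1 : |U j ^ 2 - V j ^ 2| ≤ η * B := by
        rw [show U j ^ 2 - V j ^ 2 = (U j - V j) * (U j + V j) by ring, abs_mul]
        have b1 : |U j - V j| ≤ η := (abs_norm_sub_norm_le _ _).trans (h1 j hjJ)
        have b2 : |U j + V j| ≤ B := by rw [abs_of_nonneg (by positivity)]; exact h2 j hjJ
        gcongr
      have a2 : 0 ≤ D / P * (U j ^ 2 + V j ^ 2) := by positivity
      have a3 : ‖W j‖ * |U j ^ 2 - V j ^ 2| ≤ D * (η * B) := by gcongr; exact hWD j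
      linarith
    · have a1 : ‖W j‖ ≤ D / P := by
        by_contra hcon
        push Not at hcon
        rw [div_lt_iff₀ (by linarith), mul_comm] at hcon
        exact hjJ (hJ j hj hcon.le)
      have a2 : |U j ^ 2 - V j ^ 2| ≤ U j ^ 2 + V j ^ 2 := by
        rw [abs_le]; constructor <;> nlinarith [sq_nonneg (U j), sq_nonneg (V j)]
      rw [add_zero]
      gcongr
  have hsum := norm_sum_le_of_le _ hterm
  rw [← hid, Complex.norm_real, Real.norm_eq_abs, abs_mul, abs_of_pos hM0, Finset.sum_add_distrib, ← Finset.mul_sum, Finset.sum_add_distrib,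
    parseval N M u hM hNM, parseval N M v hM hNM, ← Finset.sum_filter, Finset.sum_const, nsmul_eq_mul] at hsum
  have hcard : ((Finset.range M).filter (· ∈ J)).card ≤ J.card := Finset.card_le_card (fun x hx => (Finset.mem_filter.mp hx).2)
  have hcard' : (((Finset.range M).filter (· ∈ J)).card : ℝ) ≤ J.card := by exact_mod_cast hcard
  have h3 : M * |Rc N D F u - Rc N D F v| ≤ D / P * (M * ∑ n ∈ Finset.Ioc 0 N, u n ^ 2 + M * ∑ n ∈ Finset.Ioc 0 N, v n ^ 2) + J.card * (D * (η * B)) :=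
    hsum.trans (by gcongr)
  refine le_of_mul_le_mul_left (h3.trans (le_of_eq ?_)) hM0
  field_simp

theorem abel_lip (b : ℕ → ℂ) (β E : ℝ) (N : ℕ) (hE : ∀ z ≤ N, ‖∑ n ∈ Finset.Ioc 0 z, b n‖ ≤ E) :
    ‖∑ n ∈ Finset.Ioc 0 N, b n * ee (n * β)‖ ≤ E * (1 + 7 * N * |β|) := by
  have key : ∀ z ≤ N, ‖∑ n ∈ Finset.Ioc 0 z, b n * ee (n * β) - (∑ n ∈ Finset.Ioc 0 z, b n) * ee (z * β)‖ ≤ E * (7 * z * |β|) := by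
    intro z
    induction z with
    | zero => intro _; simp
    | succ z ih =>
      intro hz
      have h1 := ih (by omega)
      have h2 := hE z (by omega)
      rw [Finset.sum_Ioc_succ_top (by omega), Finset.sum_Ioc_succ_top (by omega)]
      have e : ee ((z + 1 : ℕ) * β) = ee (z * β) * ee β := by rw [← ee_add]; congr 1; push_cast; ring
      rw [e]
      set S := ∑ n ∈ Finset.Ioc 0 z, b n
      set T := ∑ n ∈ Finset.Ioc 0 z, b n * ee (n * β)
      calc _ = ‖(T - S * ee (z * β)) - S * (ee (z * β) * (ee β - 1))‖ := by congr 1; ring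
        _ ≤ E * (7 * z * |β|) + E * (7 * |β|) := by
          refine (norm_sub_le _ _).trans (add_le_add h1 ?_)
          rw [norm_mul, norm_mul, ee_norm, one_mul]
          have := ee_lip β
          have : 0 ≤ E := (norm_nonneg _).trans h2
          gcongr
        _ = _ := by push_cast; ring
  have h1 := key N le_rfl
  have h2 := hE N le_rfl
  have h3 : ‖(∑ n ∈ Finset.Ioc 0 N, b n) * ee (N * β)‖ ≤ E := by rwa [norm_mul, ee_norm, mul_one]
  have := norm_sub_norm_le (∑ n ∈ Finset.Ioc 0 N, b n * ee (n * β)) ((∑ n ∈ Finset.Ioc 0 N, b n) * ee (N * β))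
  linarith

/-- Ramanujan sum. -/
def cr (q : ℕ) (n : ℤ) : ℤ := ∑ x ∈ q.divisorsAntidiagonal, ArithmeticFunction.moebius x.1 * if (x.2 : ℤ) ∣ n then (x.2 : ℤ) else 0

def rset (q : ℕ) : Finset ℕ := (Finset.range q).filter (fun a => a.Coprime q)

theorem rset_card (q : ℕ) : (rset q).card = Nat.totient q := by
  rw [rset, Nat.totient]; congr 1; ext a; simp [Nat.coprime_comm]

theorem rset_regroup (q : ℕ) (hq : 0 < q) (h : ℝ → ℂ) :
    ∑ d ∈ q.divisors, ∑ b ∈ rset d, h (b / d) = ∑ a ∈ Finset.range q, h (a / q) := by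
  rw [Finset.sum_sigma']
  have hpos : ∀ a : ℕ, 0 < a.gcd q := fun a => Nat.gcd_pos_of_pos_right _ hq
  refine Finset.sum_bij' (fun x _ => x.2 * (q / x.1)) (fun a _ => ⟨q / a.gcd q, a / a.gcd q⟩) ?_ ?_ ?_ ?_ ?_
  · rintro ⟨d, b⟩ hx
    simp only [Finset.mem_sigma, Nat.mem_divisors, rset, Finset.mem_filter, Finset.mem_range] at hx ⊢
    obtain ⟨⟨⟨c, rfl⟩, _⟩, hb, _⟩ := hx
    have hd : 0 < d := by omega
    rw [Nat.mul_div_cancel_left c hd]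
    have : 0 < c := Nat.pos_of_mul_pos_left hq
    exact Nat.mul_lt_mul_of_pos_right hb this
  · intro a ha
    rw [Finset.mem_range] at ha
    simp only [Finset.mem_sigma, Nat.mem_divisors, rset, Finset.mem_filter, Finset.mem_range]
    refine ⟨⟨Nat.div_dvd_of_dvd (Nat.gcd_dvd_right _ _), hq.ne'⟩, ?_, Nat.coprime_div_gcd_div_gcd (hpos a)⟩
    exact Nat.div_lt_div_of_lt_of_dvd (Nat.gcd_dvd_right _ _) ha
  · rintro ⟨d, b⟩ hx
    simp only [Finset.mem_sigma, Nat.mem_divisors, rset, Finset.mem_filter, Finset.mem_range] at hx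
    obtain ⟨⟨⟨c, rfl⟩, _⟩, hb, hbd⟩ := hx
    have hd : 0 < d := by omega
    have hc : 0 < c := Nat.pos_of_mul_pos_left hq
    have hg : (b * c).gcd (d * c) = c := by rw [Nat.gcd_mul_right, hbd, one_mul]
    simp only [Nat.mul_div_cancel_left c hd, hg, Nat.mul_div_cancel _ hc]
  · intro a ha
    have h1 : q / (q / a.gcd q) = a.gcd q := Nat.div_div_self (Nat.gcd_dvd_right _ _) hq.ne'
    simp only [h1]
    exact Nat.div_mul_cancel (Nat.gcd_dvd_left _ _)
  · rintro ⟨d, b⟩ hx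
    simp only [Finset.mem_sigma, Nat.mem_divisors, rset, Finset.mem_filter, Finset.mem_range] at hx
    obtain ⟨⟨⟨c, rfl⟩, _⟩, hb, _⟩ := hx
    have hd : 0 < d := by omega
    have hc : 0 < c := Nat.pos_of_mul_pos_left hq
    have hd' : (d:ℝ) ≠ 0 := by positivity
    have hc' : (c:ℝ) ≠ 0 := by positivity
    simp only [Nat.mul_div_cancel_left c hd]
    congr 1
    push_cast
    field_simp

theorem cr_exp (q : ℕ) (hq : 0 < q) (n : ℤ) : (cr q n : ℂ) = ∑ a ∈ rset q, ee (-(n * (a / q))) := by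
  have h := (ArithmeticFunction.sum_eq_iff_sum_mul_moebius_eq (R := ℂ) (f := fun q => ∑ a ∈ rset q, ee (-(n * (a / q))))
    (g := fun q => if (q:ℤ) ∣ n then (q:ℂ) else 0)).mp (by
      intro q hq
      rw [rset_regroup q hq (fun x => ee (-(n * x)))]
      have := ortho q hq (-n)
      simp only [dvd_neg] at this
      rw [← this]
      refine Finset.sum_congr rfl fun a _ => ?_
      congr 1; push_cast; ring) q hq
  rw [← h, cr]
  push_cast
  rfl

theorem cr_exp' (q : ℕ) (hq : 0 < q) (n : ℤ) : (cr q n : ℂ) = ∑ a ∈ rset q, ee (n * (a / q)) := by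
  have := congrArg (starRingEnd ℂ) (cr_exp q hq n)
  rw [map_sum] at this
  simp_rw [← ee_neg, neg_neg] at this
  rw [← this]; simp

theorem cr_zero (q : ℕ) (hq : 0 < q) : (cr q 0 : ℝ) = Nat.totient q := by
  have := cr_exp q hq 0
  simp only [Int.cast_zero, zero_mul, neg_zero, ee_zero, Finset.sum_const, rset_card, nsmul_eq_mul, mul_one] at this
  exact_mod_cast this

theorem cr_abs (q : ℕ) (hq : 0 < q) (n : ℤ) : |(cr q n : ℝ)| ≤ Nat.totient q := by
  have h := congrArg (fun z : ℂ => ‖z‖) (cr_exp q hq n)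
  simp only [Complex.norm_intCast] at h
  rw [h, ← rset_card]
  refine (norm_sum_le_of_le _ fun a _ => (ee_norm _).le).trans ?_
  simp

theorem cr_coprime (q : ℕ) (hq : 0 < q) (n : ℤ) (h : IsCoprime n (q:ℤ)) : cr q n = ArithmeticFunction.moebius q := by
  rw [cr, Finset.sum_eq_single_of_mem (q, 1) (by simp [hq.ne'])]
  · simp
  · rintro ⟨a, b⟩ hx hne
    rw [Nat.mem_divisorsAntidiagonal] at hx
    simp only at hx
    rw [if_neg, mul_zero]
    intro hb
    have h1 : (b:ℤ) ∣ q := by rw [← hx.1]; push_cast; exact dvd_mul_left _ _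
    have h2 : IsUnit (b:ℤ) := h.isUnit_of_dvd' hb h1
    have h3 : b = 1 := by simpa [Int.isUnit_iff_natAbs_eq] using h2
    apply hne
    rw [h3, mul_one] at hx
    rw [h3, hx.1]

noncomputable def wq (q : ℕ) : ℝ := (ArithmeticFunction.moebius q : ℝ) / Nat.totient q

theorem wq_abs (q : ℕ) : |wq q| ≤ 1 / Nat.totient q := by
  rw [wq, abs_div, Nat.abs_cast]
  gcongr
  exact_mod_cast ArithmeticFunction.abs_moebius_le_one

theorem wq_abs1 (q : ℕ) : |wq q| ≤ 1 := by
  refine (wq_abs q).trans ?_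
  rcases Nat.eq_zero_or_pos (Nat.totient q) with h | h
  · rw [h]; simp
  · exact div_le_one_of_le₀ (by exact_mod_cast h) (by positivity)

noncomputable def Ls (Q : ℕ) (n : ℤ) : ℝ := ∑ q ∈ Finset.Icc 1 Q, wq q * cr q n

def fset (Q : ℕ) : Finset (Σ _ : ℕ, ℕ) := (Finset.Icc 1 Q).sigma rset

noncomputable def fr (x : Σ _ : ℕ, ℕ) : ℝ := (x.2 : ℝ) / x.1

theorem Ls_exp (Q : ℕ) (n : ℤ) : (Ls Q n : ℂ) = ∑ x ∈ fset Q, (wq x.1 : ℂ) * ee (-(n * fr x)) := by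
  rw [fset, Finset.sum_sigma, Ls]
  push_cast
  refine Finset.sum_congr rfl fun q hq => ?_
  rw [cr_exp q (Finset.mem_Icc.mp hq).1, Finset.mul_sum]
  rfl

theorem Ls_exp' (Q : ℕ) (n : ℤ) : (Ls Q n : ℂ) = ∑ x ∈ fset Q, (wq x.1 : ℂ) * ee (n * fr x) := by
  rw [fset, Finset.sum_sigma, Ls]
  push_cast
  refine Finset.sum_congr rfl fun q hq => ?_
  rw [cr_exp' q (Finset.mem_Icc.mp hq).1, Finset.mul_sum]
  rfl

theorem Ls_abs (Q : ℕ) (n : ℤ) : |Ls Q n| ≤ Q := by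
  rw [Ls]
  refine (Finset.abs_sum_le_sum_abs _ _).trans ?_
  calc _ ≤ ∑ q ∈ Finset.Icc 1 Q, (1:ℝ) := by
        refine Finset.sum_le_sum fun q hq => ?_
        have hq := (Finset.mem_Icc.mp hq).1
        have h1 := wq_abs q
        have h2 := cr_abs q hq n
        have : (0:ℝ) < Nat.totient q := by exact_mod_cast Nat.totient_pos.mpr hq
        rw [abs_mul]
        calc _ ≤ 1 / (Nat.totient q : ℝ) * Nat.totient q := by gcongr
          _ = 1 := by field_simp
    _ = Q := by simp

theorem fset_card (Q : ℕ) : ((fset Q).card : ℝ) ≤ Q ^ 2 := by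
  rw [fset, Finset.card_sigma]
  push_cast
  calc _ ≤ ∑ q ∈ Finset.Icc 1 Q, (Q:ℝ) := by
        refine Finset.sum_le_sum fun q hq => ?_
        rw [rset_card]
        exact_mod_cast (Nat.totient_le q).trans (Finset.mem_Icc.mp hq).2
    _ = _ := by simp [sq]

theorem geom_Ioc (x t : ℝ) (u v : ℕ) (ht : 0 < t) (hx : ∀ c : ℤ, t ≤ |x - c|) : ‖∑ n ∈ Finset.Ioc u v, ee (n * x)‖ ≤ 1 / (2 * t) := by
  rw [← Finset.Ico_add_one_add_one_eq_Ioc, Finset.sum_Ico_eq_sum_range]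
  have e : ∀ i : ℕ, ee ((u + 1 + i : ℕ) * x) = ee ((u + 1) * x) * ee (i * x) := fun i => by
    rw [← ee_add]; congr 1; push_cast; ring
  rw [Finset.sum_congr rfl (fun i _ => e i), ← Finset.mul_sum, norm_mul, ee_norm, one_mul]
  exact geom_bound x t _ ht hx

theorem frac_sep (Q q q' : ℕ) (a a' c : ℤ) (hq : 1 ≤ q) (hq' : 1 ≤ q') (hQ : q ≤ Q) (hQ' : q' ≤ Q) (hne : a * q' - a' * q - c * (q * q') ≠ 0) :
    1 / (Q:ℝ) ^ 2 ≤ |((a:ℝ) / q - a' / q') - c| := by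
  have h0 : (1:ℝ) ≤ q := by exact_mod_cast hq
  have h1 : (1:ℝ) ≤ q' := by exact_mod_cast hq'
  have h2 : (q:ℝ) ≤ Q := by exact_mod_cast hQ
  have h3 : (q':ℝ) ≤ Q := by exact_mod_cast hQ'
  have e : ((a:ℝ) / q - a' / q') - c = ((a * q' - a' * q - c * (q * q') : ℤ) : ℝ) / (q * q') := by
    push_cast; field_simp
  rw [e, abs_div, abs_of_nonneg (by positivity : (0:ℝ) ≤ q * q')]
  have h4 : (1:ℝ) ≤ |((a * q' - a' * q - c * (q * q') : ℤ) : ℝ)| := by exact_mod_cast Int.one_le_abs hne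
  rw [sq]
  gcongr

theorem frac_eq {q q' : ℕ} {a a' c : ℤ} (hq : 1 ≤ q) (hq' : 1 ≤ q') (h1 : IsCoprime a (q:ℤ)) (h2 : IsCoprime a' (q':ℤ))
    (h : a * q' - a' * q - c * (q * q') = 0) : q = q' ∧ (q:ℤ) ∣ a - a' := by
  have d1 : (q:ℤ) ∣ q' := by
    have : (q:ℤ) ∣ a * q' := ⟨a' + c * q', by linarith⟩
    exact h1.symm.dvd_of_dvd_mul_left this
  have d2 : (q':ℤ) ∣ q := by
    have : (q':ℤ) ∣ a' * q := ⟨a - c * q, by linarith⟩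
    exact h2.symm.dvd_of_dvd_mul_left this
  have e : q = q' := Nat.dvd_antisymm (by exact_mod_cast d1) (by exact_mod_cast d2)
  refine ⟨e, c, ?_⟩
  subst e
  have h0 : (q:ℤ) ≠ 0 := by positivity
  apply mul_left_cancel₀ h0
  linarith

theorem fset_sep {Q : ℕ} {x y : Σ _ : ℕ, ℕ} (hx : x ∈ fset Q) (hy : y ∈ fset Q) (hne : x ≠ y) (c : ℤ) : 1 / (Q:ℝ) ^ 2 ≤ |(fr x - fr y) - c| := by
  obtain ⟨q, a⟩ := x
  obtain ⟨q', a'⟩ := y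
  simp only [fset, rset, Finset.mem_sigma, Finset.mem_Icc, Finset.mem_filter, Finset.mem_range] at hx hy
  have := frac_sep Q q q' a a' c hx.1.1 hy.1.1 hx.1.2 hy.1.2 (by
    intro h
    obtain ⟨e, hd⟩ := frac_eq hx.1.1 hy.1.1 (Nat.isCoprime_iff_coprime.mpr hx.2.2) (Nat.isCoprime_iff_coprime.mpr hy.2.2) h
    subst e
    apply hne
    have h2 : ((a:ℤ) - a') = 0 := Int.eq_zero_of_abs_lt_dvd hd (by rw [abs_lt]; omega)
    have : a = a' := by omega
    rw [this])
  simpa [fr] using this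

theorem fset_sum {Q : ℕ} {x y : Σ _ : ℕ, ℕ} (hx : x ∈ fset Q) (hy : y ∈ fset Q) (u v : ℕ) (huv : u ≤ v) :
    ‖∑ n ∈ Finset.Ioc u v, ee (n * (fr x - fr y)) - if x = y then ((v:ℂ) - u) else 0‖ ≤ (Q:ℝ) ^ 2 := by
  split_ifs with h
  · subst h
    simp [ee_zero, Nat.cast_sub huv]
  · rw [sub_zero]
    have hQ : 1 ≤ Q := by
      have := (Finset.mem_sigma.mp hx).1
      rw [Finset.mem_Icc] at this; omega
    have hQ' : (1:ℝ) ≤ Q := by exact_mod_cast hQ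
    refine (geom_Ioc _ (1 / (Q:ℝ)^2) u v (by positivity) (fset_sep hx hy h)).trans ?_
    rw [div_le_iff₀ (by positivity)]
    field_simp; norm_num

theorem wq_norm1 (q : ℕ) : ‖(wq q : ℂ)‖ ≤ 1 := by
  rw [Complex.norm_real]; exact wq_abs1 q

theorem spec0 {Q : ℕ} {x : Σ _ : ℕ, ℕ} (hx : x ∈ fset Q) (z : ℕ) :
    ‖∑ n ∈ Finset.Ioc 0 z, (Ls Q n : ℂ) * ee (n * fr x) - z * wq x.1‖ ≤ (Q:ℝ) ^ 4 := by
  have e : ∑ n ∈ Finset.Ioc 0 z, (Ls Q n : ℂ) * ee (n * fr x) - z * wq x.1 =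
      ∑ y ∈ fset Q, (wq y.1 : ℂ) * (∑ n ∈ Finset.Ioc 0 z, ee (n * (fr x - fr y)) - if x = y then ((z:ℂ) - (0:ℕ)) else 0) := by
    simp_rw [mul_sub, Finset.sum_sub_distrib, Finset.mul_sum]
    congr 1
    · rw [Finset.sum_comm]
      refine Finset.sum_congr rfl fun n _ => ?_
      rw [Ls_exp, Finset.sum_mul]
      refine Finset.sum_congr rfl fun y _ => ?_
      rw [mul_assoc, ← ee_add]; congr 2; push_cast; ring
    · simp [hx, mul_comm]
  rw [e]
  refine (norm_sum_le_of_le (fset Q) (f := _) (n := fun _ => (Q:ℝ)^2) fun y hy => ?_).trans ?_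
  · rw [norm_mul]
    calc _ ≤ 1 * (Q:ℝ)^2 := by
          gcongr
          · exact wq_norm1 _
          · exact fset_sum hx hy 0 z (Nat.zero_le _)
      _ = _ := one_mul _
  · rw [Finset.sum_const, nsmul_eq_mul]
    have := fset_card Q
    calc _ ≤ (Q:ℝ)^2 * (Q:ℝ)^2 := by gcongr
      _ = _ := by ring

theorem corr (Q : ℕ) (h : ℤ) (u v : ℕ) (huv : u ≤ v) :
    |∑ n ∈ Finset.Ioc u v, Ls Q n * Ls Q (n + h) - (v - u) * ∑ q ∈ Finset.Icc 1 Q, wq q ^ 2 * cr q h| ≤ (Q:ℝ) ^ 6 := by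
  have e : ((∑ n ∈ Finset.Ioc u v, Ls Q n * Ls Q (n + h) - (v - u) * ∑ q ∈ Finset.Icc 1 Q, wq q ^ 2 * cr q h : ℝ) : ℂ) =
      ∑ x ∈ fset Q, ∑ y ∈ fset Q, (wq x.1 : ℂ) * wq y.1 * ee (h * fr x) * (∑ n ∈ Finset.Ioc u v, ee (n * (fr x - fr y)) - if x = y then ((v:ℂ) - u) else 0) := by
    simp_rw [mul_sub, Finset.sum_sub_distrib, Finset.mul_sum]
    push_cast
    congr 1
    · rw [← Finset.sum_product', Finset.sum_comm]
      refine Finset.sum_congr rfl fun n _ => ?_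
      rw [Ls_exp Q n, Ls_exp' Q (n + h), mul_comm, Finset.sum_mul_sum, ← Finset.sum_product']
      refine Finset.sum_congr rfl fun y _ => ?_
      have : ee (((n + h : ℤ) : ℝ) * fr y.1) * ee (-((n:ℤ) * fr y.2)) = ee (h * fr y.1) * ee (n * fr y.1 - n * fr y.2) := by
        rw [← ee_add, ← ee_add]; congr 1; push_cast; ring
      linear_combination (wq y.1.1 : ℂ) * wq y.2.1 * this
    · rw [fset, Finset.sum_sigma, ← fset]
      refine Finset.sum_congr rfl fun q hq => ?_
      rw [cr_exp' q (Finset.mem_Icc.mp hq).1, Finset.mul_sum, Finset.mul_sum]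
      refine Finset.sum_congr rfl fun a ha => ?_
      have hm : (⟨q, a⟩ : Σ _ : ℕ, ℕ) ∈ fset Q := Finset.mem_sigma.mpr ⟨hq, ha⟩
      simp only [mul_ite, mul_zero, Finset.sum_ite_eq, hm, if_true, fr]
      ring
  have e2 := congrArg (fun z : ℂ => ‖z‖) e
  simp only [Complex.norm_real, Real.norm_eq_abs] at e2
  rw [e2]
  refine (norm_sum_le_of_le (fset Q) (f := _) (n := fun _ => (Q:ℝ)^4) fun x hx => ?_).trans ?_
  · refine (norm_sum_le_of_le (fset Q) (f := _) (n := fun _ => (Q:ℝ)^2) fun y hy => ?_).trans ?_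
    · rw [norm_mul, norm_mul, norm_mul, ee_norm]
      calc _ ≤ 1 * 1 * 1 * (Q:ℝ)^2 := by
            gcongr
            · exact wq_norm1 _
            · exact wq_norm1 _
            · exact fset_sum hx hy u v huv
        _ = _ := by ring
    · rw [Finset.sum_const, nsmul_eq_mul]
      have := fset_card Q
      calc _ ≤ (Q:ℝ)^2 * (Q:ℝ)^2 := by gcongr
        _ = _ := by ring
  · rw [Finset.sum_const, nsmul_eq_mul]
    have := fset_card Q
    calc _ ≤ (Q:ℝ)^2 * (Q:ℝ)^4 := by gcongr
      _ = _ := by ring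

theorem inv_totient (q : ℕ) (hq : 1 ≤ q) : 1 / (Nat.totient q : ℝ) ≤ (1 + 2 * log q) / q := by
  have h := phi_lower q hq
  have h1 : (Nat.totient q : ℝ) = q * ∏ p ∈ q.primeFactors, (1 - 1 / (p:ℝ)) := by
    have := Nat.totient_eq_mul_prod_factors q
    have h2 := congrArg (fun x : ℚ => (x:ℝ)) this
    push_cast at h2
    rw [h2]; simp
  have hl : 0 ≤ log q := log_natCast_nonneg q
  have hq' : (0:ℝ) < q := by exact_mod_cast hq
  have hp : (0:ℝ) < ∏ p ∈ q.primeFactors, (1 - 1 / (p:ℝ)) := lt_of_lt_of_le (by positivity) h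
  rw [h1, div_le_div_iff₀ (by positivity) hq', one_mul]
  rw [div_le_iff₀ (by positivity)] at h
  nlinarith

theorem Ls_sq (Q N : ℕ) : ∑ n ∈ Finset.Ioc 0 N, Ls Q n ^ 2 ≤ N * (1 + 2 * log Q) ^ 2 + (Q:ℝ) ^ 6 := by
  have h := (abs_le.mp (corr Q 0 0 N (Nat.zero_le _))).2
  simp only [add_zero, Nat.cast_zero, sub_zero] at h
  have e : ∑ n ∈ Finset.Ioc 0 N, Ls Q n ^ 2 = ∑ n ∈ Finset.Ioc 0 N, Ls Q n * Ls Q n := Finset.sum_congr rfl fun n _ => sq _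
  rw [e]
  have hl : 0 ≤ log Q := log_natCast_nonneg Q
  have h2 : ∑ q ∈ Finset.Icc 1 Q, wq q ^ 2 * cr q 0 ≤ (1 + 2 * log Q) ^ 2 := by
    calc _ ≤ ∑ q ∈ Finset.Icc 1 Q, (1 + 2 * log Q) * (q:ℝ)⁻¹ := by
          refine Finset.sum_le_sum fun q hq => ?_
          rw [Finset.mem_Icc] at hq
          rw [cr_zero q hq.1, ← sq_abs]
          have hq' : (0:ℝ) < q := by exact_mod_cast hq.1
          have : (0:ℝ) < Nat.totient q := by exact_mod_cast Nat.totient_pos.mpr hq.1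
          calc |wq q| ^ 2 * (Nat.totient q : ℝ) ≤ (1 / (Nat.totient q : ℝ)) ^ 2 * Nat.totient q := by
                gcongr; exact wq_abs q
            _ = 1 / (Nat.totient q : ℝ) := by field_simp
            _ ≤ (1 + 2 * log q) / q := inv_totient q hq.1
            _ ≤ (1 + 2 * log Q) / q := by gcongr; exact_mod_cast hq.2
            _ = _ := by rw [div_eq_mul_inv]
      _ = (1 + 2 * log Q) * ∑ q ∈ Finset.Icc 1 Q, (q:ℝ)⁻¹ := by rw [Finset.mul_sum]
      _ ≤ (1 + 2 * log Q) * (1 + log Q) := by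
          gcongr
          have := harmonic_le_one_add_log Q
          rw [harmonic_eq_sum_Icc] at this
          push_cast at this
          exact this
      _ ≤ _ := by nlinarith
  have h3 : (N:ℝ) * ∑ q ∈ Finset.Icc 1 Q, wq q ^ 2 * cr q 0 ≤ N * (1 + 2 * log Q) ^ 2 := by gcongr
  linarith

theorem spec_vm (A B : ℕ) : ∃ C : ℝ, 0 < C ∧ ∀ N : ℕ, 3 ≤ N → ∀ q a : ℕ, 1 ≤ q → (q:ℝ) ≤ log N ^ B → a.Coprime q → ∀ z ≤ N,
    ‖∑ n ∈ Finset.Ioc 0 z, ((ArithmeticFunction.vonMangoldt n : ℝ) : ℂ) * ee (n * (a / q)) - z * wq q‖ ≤ q * (C * (N / log N ^ A)) + 6 * q * log N ^ 2 := by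
  obtain ⟨C, hC, h⟩ := siegel_walfisz A B
  refine ⟨C, hC, fun N hN q a hq hqB ha z hz => ?_⟩
  have : NeZero q := ⟨by omega⟩
  have hq0 : (q:ℝ) ≠ 0 := by positivity
  set L := fun n : ℕ => ArithmeticFunction.vonMangoldt n with hL
  have h1 : ∀ r ∈ rset q, |∑ n ∈ Finset.Ioc 0 z with n.Coprime q ∧ n % q = r, L n - z / (Nat.totient q : ℝ)| ≤ C * (N / log N ^ A) := by
    intro r hr
    rw [rset, Finset.mem_filter, Finset.mem_range] at hr
    have := h N hN q hqB (r : ZMod q) ((ZMod.isUnit_iff_coprime r q).mpr hr.2) z hz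
    convert this using 4
    ext n
    simp only [Finset.mem_filter, and_congr_right_iff]
    intro _
    rw [ZMod.natCast_eq_natCast_iff, Nat.ModEq, Nat.mod_eq_of_lt hr.1]
    refine ⟨fun h => h.2, fun h => ⟨?_, h⟩⟩
    rw [Nat.Coprime, ← (Nat.mod_modEq n q).gcd_eq, h]
    exact hr.2
  have e0 : ∑ n ∈ Finset.Ioc 0 z, (L n : ℂ) * ee (n * (a / q)) = ∑ n ∈ Finset.Ioc 0 z with n.Coprime q, (L n : ℂ) * ee (n * (a / q))
      + ∑ n ∈ Finset.Ioc 0 z with ¬ n.Coprime q, (L n : ℂ) * ee (n * (a / q)) := (Finset.sum_filter_add_sum_filter_not _ _ _).symm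
  have e1 : ∑ n ∈ Finset.Ioc 0 z with n.Coprime q, (L n : ℂ) * ee (n * (a / q)) =
      ∑ r ∈ rset q, ee (a * (r / q)) * ((∑ n ∈ Finset.Ioc 0 z with n.Coprime q ∧ n % q = r, L n : ℝ) : ℂ) := by
    rw [← Finset.sum_fiberwise_of_maps_to (t := rset q) (g := fun n => n % q)]
    · refine Finset.sum_congr rfl fun r hr => ?_
      rw [Finset.filter_filter]
      push_cast
      rw [Finset.mul_sum]
      refine Finset.sum_congr rfl fun n hn => ?_
      rw [mul_comm]
      congr 1
      have hn2 := (Finset.mem_filter.mp hn).2.2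
      obtain ⟨t, this⟩ : ∃ t : ℕ, (n:ℝ) = r + q * t := by
        refine ⟨n / q, ?_⟩
        have := Nat.mod_add_div n q
        rw [hn2] at this
        exact_mod_cast this.symm
      rw [show (n:ℝ) * (a / q) = a * (r / q) + ((a * t : ℤ) : ℝ) by
        rw [this]; push_cast; field_simp, ee_add, ee_int, mul_one]
    · intro n hn
      rw [Finset.mem_filter] at hn
      rw [rset, Finset.mem_filter, Finset.mem_range]
      refine ⟨Nat.mod_lt _ hq, ?_⟩
      have := hn.2
      rw [Nat.Coprime] at this ⊢
      rwa [(Nat.mod_modEq n q).gcd_eq]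
  have e2 : (z:ℂ) * wq q = ∑ r ∈ rset q, ee (a * (r / q)) * ((z / (Nat.totient q : ℝ) : ℝ) : ℂ) := by
    have := cr_exp' q hq a
    rw [cr_coprime q hq a (Nat.isCoprime_iff_coprime.mpr ha)] at this
    rw [← Finset.sum_mul]
    push_cast at this
    rw [← this, wq]
    push_cast; ring
  rw [e0, e1, e2, add_sub_right_comm, ← Finset.sum_sub_distrib]
  refine (norm_add_le _ _).trans (add_le_add ?_ ?_)
  · refine (norm_sum_le_of_le (rset q) (f := _) (n := fun _ => C * (N / log N ^ A)) fun r hr => ?_).trans ?_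
    · rw [← mul_sub, norm_mul, ee_norm, one_mul, ← Complex.ofReal_sub, Complex.norm_real]
      exact h1 r hr
    · rw [Finset.sum_const, nsmul_eq_mul, rset_card]
      have : (0:ℝ) ≤ log N := log_natCast_nonneg N
      gcongr
      exact Nat.totient_le q
  · refine le_trans ?_ (noncop N q z hN hz hq)
    refine (norm_sum_le_of_le _ fun n hn => ?_)
    rw [norm_mul, ee_norm, mul_one, Complex.norm_real, Real.norm_eq_abs, abs_of_nonneg ArithmeticFunction.vonMangoldt_nonneg]

theorem major_fin (N D M Q k A : ℕ) (F : ℕ → ℤ) (P Q0 C1 CM : ℝ) (hN : 3 ≤ N) (hD : 1 ≤ D) (hDk : N ≤ D ^ k) (hF : ∀ d < D, |F d| + N ≤ M)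
    (hM : (M:ℝ) ≤ CM * N) (hCM : 1 ≤ CM) (hQ0 : 1 ≤ Q0) (hQ : CM * (Q0 + 1) ^ 2 + 1 ≤ Q) (hLQ : log N ≤ Q) (hP : 1 ≤ P) (hC1 : 0 ≤ C1)
    (hW : ∀ α : ℝ, D ≤ P * ‖∑ n ∈ Finset.range D, ee (α * F n)‖ → ∃ q : ℕ, 1 ≤ q ∧ q ≤ Q0 ∧ ∃ c : ℤ, IsCoprime (c : ℤ) (q : ℤ) ∧ |α - c / q| ≤ Q0 / D ^ k)
    (hS : ∀ q a : ℕ, 1 ≤ q → q ≤ Q → a.Coprime q → ∀ z ≤ N, ‖∑ n ∈ Finset.Ioc 0 z, ((ArithmeticFunction.vonMangoldt n : ℝ) : ℂ) * ee (n * (a / q)) - z * wq q‖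
      ≤ q * (C1 * (N / log N ^ A)) + 6 * q * log N ^ 2) :
    |Rc N D F (fun n => ArithmeticFunction.vonMangoldt n) - Rc N D F (fun n => Ls Q n)| ≤
      D / P * (N * log N ^ 2 + (N * (1 + 2 * log Q) ^ 2 + (Q:ℝ) ^ 6)) + (9 * Q ^ 3) * D * (8 * Q * (Q * (C1 * (N / log N ^ A)) + 6 * Q * log N ^ 2 + (Q:ℝ) ^ 4)) * (2 * N * Q) / M := by
  classical
  have hL := one_le_log hN
  have hNM : N ≤ M := by have := hF 0 hD; have := abs_nonneg (F 0); omega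
  have hN0 : (0:ℝ) < N := by positivity
  have hM0 : (0:ℝ) < M := by have : (N:ℝ) ≤ M := by exact_mod_cast hNM
                             linarith
  have hDk' : (N:ℝ) ≤ (D:ℝ) ^ k := by exact_mod_cast hDk
  have hQQ : Q0 + 1 ≤ Q := by nlinarith
  have hQ1 : (1:ℝ) ≤ Q := by linarith
  have hr1 : (N:ℝ) * (Q0 / D ^ k) ≤ Q0 := by
    rw [mul_div_assoc', div_le_iff₀ (by linarith)]; nlinarith
  have hr2 : (M:ℝ) * (Q0 / D ^ k) ≤ CM * Q0 := by
    calc (M:ℝ) * (Q0 / D ^ k) ≤ CM * N * (Q0 / D ^ k) := by gcongr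
      _ = CM * (N * (Q0 / D ^ k)) := by ring
      _ ≤ _ := by gcongr
  have hr3 : Q0 / D ^ k ≤ Q0 := by
    apply div_le_self (by linarith)
    have : (3:ℝ) ≤ N := by exact_mod_cast hN
    linarith
  set L : ℕ → ℝ := fun n => ArithmeticFunction.vonMangoldt n with hLdef
  set V : ℕ → ℝ := fun n => Ls Q n with hVdef
  have hLn : ∀ n ∈ Finset.Ioc 0 N, |L n| ≤ log N := fun n hn => by
    rw [Finset.mem_Ioc] at hn
    rw [abs_of_nonneg ArithmeticFunction.vonMangoldt_nonneg]
    refine ArithmeticFunction.vonMangoldt_le_log.trans (Real.log_le_log (by exact_mod_cast hn.1) (by exact_mod_cast hn.2))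
  let T : ℕ → ℕ × ℤ → Prop := fun j x => 1 ≤ x.1 ∧ (x.1:ℝ) ≤ Q0 ∧ IsCoprime x.2 (x.1 : ℤ) ∧ |(j / M : ℝ) - x.2 / x.1| ≤ Q0 / D ^ k
  set J := (Finset.range M).filter (fun j => ∃ x, T j x) with hJ
  have hJe : ∀ j : ℕ, ∃ x, j ∈ J → T j x := fun j => by
    by_cases h : j ∈ J
    · obtain ⟨x, hx⟩ := (Finset.mem_filter.mp h).2
      exact ⟨x, fun _ => hx⟩
    · exact ⟨default, fun h' => absurd h' h⟩
  choose X hX using hJe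
  have hcard : (J.card : ℝ) ≤ 9 * Q ^ 3 := by
    have h1 : J.card ≤ ((Finset.Icc 1 Q) ×ˢ (Finset.Icc (-(Q:ℤ)) Q) ×ˢ (Finset.Icc (-(Q:ℤ)) Q)).card := by
      refine Finset.card_le_card_of_injOn (fun j => ((X j).1, (X j).2, ⌊(j:ℝ) - (X j).2 * M / (X j).1⌋)) ?_ ?_
      · intro j hj
        obtain ⟨a1, a2, a3, a4⟩ := hX j hj
        have hjM : (j:ℝ) < M := by
          have := (Finset.mem_filter.mp hj).1
          rw [Finset.mem_range] at this
          exact_mod_cast this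
        have hj0 : (0:ℝ) ≤ j / M := by positivity
        have hj1 : (j:ℝ) / M ≤ 1 := by rw [div_le_one hM0]; exact hjM.le
        have hq0 : (0:ℝ) < (X j).1 := by exact_mod_cast a1
        rw [Finset.mem_coe, Finset.mem_product, Finset.mem_product, Finset.mem_Icc, Finset.mem_Icc, Finset.mem_Icc]
        have b1 := abs_le.mp a4
        have hc : |((X j).2 : ℝ)| ≤ Q := by
          have : |((X j).2 : ℝ) / (X j).1| ≤ 1 + Q0 := abs_le.mpr ⟨by linarith, by linarith⟩
          rw [abs_div, abs_of_pos hq0, div_le_iff₀ hq0] at this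
          nlinarith
        have hz : |(j:ℝ) - (X j).2 * M / (X j).1| ≤ CM * Q0 := by
          have : (j:ℝ) - (X j).2 * M / (X j).1 = M * ((j / M : ℝ) - (X j).2 / (X j).1) := by field_simp
          rw [this, abs_mul, abs_of_pos hM0]
          exact (mul_le_mul_of_nonneg_left a4 hM0.le).trans hr2
        have hz2 : CM * Q0 + 1 ≤ Q := by nlinarith
        have hz3 := abs_le.mp hz
        have hc3 := abs_le.mp hc
        refine ⟨⟨a1, by exact_mod_cast (show ((X j).1:ℝ) ≤ Q by linarith)⟩, ⟨by exact_mod_cast hc3.1, by exact_mod_cast hc3.2⟩, ?_, ?_⟩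
        · rw [Int.le_floor]; push_cast; linarith
        · have := Int.floor_le ((j:ℝ) - (X j).2 * M / (X j).1)
          exact_mod_cast (show ((⌊(j:ℝ) - (X j).2 * M / (X j).1⌋ : ℤ) : ℝ) ≤ Q by linarith)
      · intro j hj j' hj' h
        simp only [Prod.mk.injEq] at h
        obtain ⟨e1, e2, e3⟩ := h
        rw [e1, e2, sub_eq_neg_add, sub_eq_neg_add, Int.floor_add_natCast, Int.floor_add_natCast] at e3
        omega
    have h2 : J.card ≤ Q * ((2 * Q + 1) * (2 * Q + 1)) := by
      refine h1.trans (le_of_eq ?_)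
      rw [Finset.card_product, Finset.card_product, Nat.card_Icc, Int.card_Icc]
      have : ((Q:ℤ) + 1 - -(Q:ℤ)).toNat = 2 * Q + 1 := by omega
      rw [this]; rfl
    have h3 : (J.card : ℝ) ≤ Q * ((2 * Q + 1) * (2 * Q + 1)) := by exact_mod_cast h2
    have h4 : (2 * Q + 1) * (2 * Q + 1) ≤ 9 * (Q:ℝ) ^ 2 := by nlinarith
    calc _ ≤ _ := h3
      _ ≤ Q * (9 * (Q:ℝ) ^ 2) := by gcongr
      _ = _ := by ring
  set η := 8 * Q * (Q * (C1 * (N / log N ^ A)) + 6 * Q * log N ^ 2 + (Q:ℝ) ^ 4) with hη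
  have hη0 : 0 ≤ η := by positivity
  have hc := circle N D M F L V P η (2 * N * Q) (by omega) hF hNM hP J ?_ ?_ ?_ hη0 (by positivity)
  · refine hc.trans (add_le_add ?_ ?_)
    · gcongr
      · calc _ ≤ ∑ n ∈ Finset.Ioc 0 N, log N ^ 2 := by
              refine Finset.sum_le_sum fun n hn => ?_
              rw [← sq_abs]
              have := hLn n hn
              gcongr
          _ = _ := by simp
      · exact Ls_sq Q N
    · gcongr
  · intro j hj h
    obtain ⟨q, h1, h2, c, h3, h4⟩ := hW _ h
    exact Finset.mem_filter.mpr ⟨hj, (q, c), h1, h2, h3, h4⟩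
  · intro j hj
    obtain ⟨a1, a2, a3, a4⟩ := hX j hj
    set q := (X j).1
    set c := (X j).2
    have hqQ : q ≤ Q := by exact_mod_cast (show (q:ℝ) ≤ Q by linarith)
    have hqR : (q:ℝ) ≤ Q := by exact_mod_cast hqQ
    have hq0 : (q:ℝ) ≠ 0 := by positivity
    have hqz : (q:ℤ) ≠ 0 := by positivity
    obtain ⟨a, ha⟩ := Int.eq_ofNat_of_zero_le (Int.emod_nonneg c hqz)
    have hcd : c = a + q * (c / q) := by rw [← ha]; exact (Int.emod_add_mul_ediv c q).symm
    obtain ⟨t, ht⟩ : ∃ t : ℤ, c = a + q * t := ⟨_, hcd⟩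
    have haq : a.Coprime q := by
      rw [ht] at a3
      exact Nat.isCoprime_iff_coprime.mp ((IsCoprime.add_mul_left_left_iff).mp a3)
    have haq2 : a < q := by have := Int.emod_lt_of_pos c (by omega : 0 < (q:ℤ)); omega
    have hx : (⟨q, a⟩ : Σ _ : ℕ, ℕ) ∈ fset Q := by
      simp only [fset, rset, Finset.mem_sigma, Finset.mem_Icc, Finset.mem_filter, Finset.mem_range]
      exact ⟨⟨a1, hqQ⟩, haq2, haq⟩
    have hsp := hS q a a1 hqQ haq
    have hsp2 := fun z => spec0 hx z
    simp only [fr] at hsp2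
    have key := abel_lip (fun n => ((L n : ℂ) - V n) * ee (n * (a / q))) (j / M - c / q) (q * (C1 * (N / log N ^ A)) + 6 * q * log N ^ 2 + (Q:ℝ) ^ 4) N ?_
    · have e : Sf N L (j / M) - Sf N V (j / M) = ∑ n ∈ Finset.Ioc 0 N, ((L n : ℂ) - V n) * ee (n * (a / q)) * ee (n * (j / M - c / q)) := by
        rw [Sf, Sf, ← Finset.sum_sub_distrib]
        refine Finset.sum_congr rfl fun n _ => ?_
        rw [mul_assoc, ← ee_add, ← sub_mul]
        congr 1
        have : (n:ℝ) * (j / M) = n * (a / q) + n * (j / M - c / q) + ((n * t : ℤ) : ℝ) := by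
          have : (c:ℝ) = a + q * t := by exact_mod_cast ht
          rw [this]; push_cast; field_simp; ring
        rw [this, ee_add _ (((n * t : ℤ) : ℝ)), ee_int, mul_one]
      rw [e]
      refine key.trans ?_
      have h7 : 1 + 7 * N * |(j / M : ℝ) - c / q| ≤ 8 * Q := by
        have : N * |(j / M : ℝ) - c / q| ≤ Q0 := (mul_le_mul_of_nonneg_left a4 hN0.le).trans hr1
        nlinarith
      rw [hη, mul_comm (8 * (Q:ℝ))]
      gcongr
    · intro z hz
      have h1 := hsp z hz
      have h2 := hsp2 z
      have e : ∑ n ∈ Finset.Ioc 0 z, ((L n : ℂ) - V n) * ee (n * (a / q)) =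
        (∑ n ∈ Finset.Ioc 0 z, (L n : ℂ) * ee (n * (a / q)) - z * wq q) - (∑ n ∈ Finset.Ioc 0 z, (V n : ℂ) * ee (n * (a / q)) - z * wq q) := by
        simp_rw [sub_mul, Finset.sum_sub_distrib]; ring
      rw [e]
      refine (norm_sub_le _ _).trans (add_le_add h1 ?_)
      convert h2 using 3
  · intro j _
    have b1 : ‖Sf N L (j / M)‖ ≤ N * Q := by
      refine (norm_sum_le_of_le (Finset.Ioc 0 N) (f := _) (n := fun _ => (Q:ℝ)) fun n hn => ?_).trans (by simp)
      rw [norm_mul, ee_norm, mul_one, Complex.norm_real]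
      exact (hLn n hn).trans hLQ
    have b2 : ‖Sf N V (j / M)‖ ≤ N * Q := by
      refine (norm_sum_le_of_le (Finset.Ioc 0 N) (f := _) (n := fun _ => (Q:ℝ)) fun n hn => ?_).trans (by simp)
      rw [norm_mul, ee_norm, mul_one, Complex.norm_real]
      exact Ls_abs Q n
    linarith

theorem ev_log (K : ℝ) : ∀ᶠ N : ℕ in atTop, K ≤ log N :=
  (Real.tendsto_log_atTop.comp tendsto_natCast_atTop_atTop).eventually_ge_atTop K

theorem log_pow_le' (k : ℕ) : ∃ C : ℝ, 1 ≤ C ∧ ∀ N : ℕ, 1 ≤ N → log N ^ k ≤ C * N := by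
  obtain ⟨C, hC, h⟩ := log_pow_le k
  refine ⟨C, hC, fun N hN => (h N (by exact_mod_cast hN)).trans ?_⟩
  have : (1:ℝ) ≤ N := by exact_mod_cast hN
  gcongr
  rw [Real.sqrt_le_left (by positivity)]
  nlinarith

set_option maxHeartbeats 800000 in
theorem major (f : Polynomial ℤ) (hk : 1 ≤ f.natDegree) (hc : 0 < f.leadingCoeff) (CM : ℝ) (hCM : 1 ≤ CM) :
    ∃ B : ℕ, 9 ≤ B ∧ ∃ C : ℝ, 0 ≤ C ∧ ∀ᶠ N : ℕ in atTop, ∀ D M : ℕ, 1 ≤ D → N ≤ D ^ f.natDegree → (∀ d < D, |Fv f d| + N ≤ M) → (M:ℝ) ≤ CM * N →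
    |Rc N D (Fv f) (fun n => ArithmeticFunction.vonMangoldt n) - Rc N D (Fv f) (fun n => Ls ⌊log N ^ B⌋₊ n)| ≤ C * (D * N / log N) := by
  obtain ⟨C, E, hC, hw⟩ := weyl_f f hk hc
  set B := 6 * E + 9 with hB
  obtain ⟨C1, hC1, hsp⟩ := spec_vm (6 * B + 1) B
  obtain ⟨C2, hC2, hl2⟩ := log_pow_le' (9 * B + 1)
  refine ⟨B, by omega, (1 + (1 + 2 * B) ^ 2 + C2) + 144 * (C1 + 7 * C2), by positivity, ?_⟩
  filter_upwards [ev_log (CM * (C + 1) ^ 2 + 2), eventually_ge_atTop 3] with N hLK hN3 D M hD hDk hF hM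
  have hL := one_le_log hN3
  set L := log (N:ℝ) with hLd
  set Q := ⌊L ^ B⌋₊ with hQd
  have hL0 : 0 < L := by linarith
  have hQle : (Q:ℝ) ≤ L ^ B := Nat.floor_le (by positivity)
  have hN0 : (0:ℝ) < N := by positivity
  have hQge : L ^ B - 1 ≤ Q := (Nat.sub_one_lt_floor _).le
  have hLE : (1:ℝ) ≤ L ^ (6 * E) := one_le_pow₀ hL
  have hLB : L ^ B = L ^ (6 * E) * L ^ 9 := by rw [hB, pow_add]
  have hL3 : L ≤ L ^ 9 := le_self_pow₀ hL (by norm_num)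
  have hK : 0 ≤ CM * (C + 1) ^ 2 := by positivity
  have hQ : CM * (C * (L ^ 3) ^ E + 1) ^ 2 + 1 ≤ Q := by
    have h1 : (C * (L ^ 3) ^ E + 1) ^ 2 ≤ (C + 1) ^ 2 * L ^ (6 * E) := by
      have h2 : (1:ℝ) ≤ (L ^ 3) ^ E := one_le_pow₀ (one_le_pow₀ hL)
      have h3 : L ^ (6 * E) = ((L ^ 3) ^ E) ^ 2 := by rw [← pow_mul, ← pow_mul]; congr 1; ring
      rw [h3, ← mul_pow]
      gcongr
      linarith
    have h2 : CM * (C * (L ^ 3) ^ E + 1) ^ 2 ≤ CM * ((C + 1) ^ 2 * L ^ (6 * E)) := by gcongr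
    nlinarith
  have hQ1 : (1:ℝ) ≤ Q := by
    have : 0 ≤ CM * (C * (L ^ 3) ^ E + 1) ^ 2 := by positivity
    linarith
  have hLQ : L ≤ Q := by
    have h2 : 2 ≤ L := by linarith
    have h3 : L + 1 ≤ L ^ 3 := by nlinarith [mul_self_nonneg (L - 1), mul_le_mul h2 h2 (by norm_num) hL0.le]
    have h4 : L ^ 3 ≤ L ^ B := pow_le_pow_right₀ hL (by omega)
    linarith
  have h := major_fin N D M Q f.natDegree (6 * B + 1) (Fv f) (L ^ 3) (C * (L ^ 3) ^ E) C1 CM hN3 hD hDk hF hM hCM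
    (by have : (1:ℝ) ≤ (L ^ 3) ^ E := one_le_pow₀ (one_le_pow₀ hL)
        nlinarith) hQ hLQ (one_le_pow₀ hL) hC1.le (fun α => hw α (L ^ 3) D (one_le_pow₀ hL) hD)
    (fun q a h1 h2 => hsp N hN3 q a h1 ((by exact_mod_cast h2 : (q:ℝ) ≤ Q).trans hQle))
  refine h.trans ?_
  rw [← hLd]
  have hl := hl2 N (by omega)
  rw [← hLd] at hl
  have hlogQ : log Q ≤ B * L := by
    calc log Q ≤ log (L ^ B) := Real.log_le_log (by linarith) hQle
      _ = B * log L := by rw [Real.log_pow]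
      _ ≤ B * L := by gcongr; exact Real.log_le_self hL0.le
  have hlogQ0 : 0 ≤ log Q := Real.log_nonneg hQ1
  have hNM : (N:ℝ) ≤ M := by have := hF 0 hD; have := abs_nonneg (Fv f 0); exact_mod_cast (by omega : N ≤ M)
  have hpw : ∀ i : ℕ, (Q:ℝ) ^ i ≤ L ^ (B * i) := fun i => by rw [pow_mul]; gcongr
  have hQ9 : (Q:ℝ) ^ 9 ≤ C2 * N / L := by
    rw [le_div_iff₀ hL0]
    refine le_trans ?_ hl
    rw [pow_succ L, mul_comm 9 B]; exact mul_le_mul_of_nonneg_right (hpw 9) hL0.le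
  have t1 : D / L ^ 3 * (N * L ^ 2 + (N * (1 + 2 * log Q) ^ 2 + (Q:ℝ) ^ 6)) ≤ (1 + (1 + 2 * B) ^ 2 + C2) * (D * N / L) := by
    have a1 : (1 + 2 * log Q) ^ 2 ≤ (1 + 2 * B) ^ 2 * L ^ 2 := by
      rw [← mul_pow]; gcongr; nlinarith
    have a2 : (Q:ℝ) ^ 6 ≤ C2 * N * L ^ 2 := by
      calc (Q:ℝ) ^ 6 ≤ Q ^ 9 := pow_le_pow_right₀ hQ1 (by norm_num)
        _ ≤ C2 * N / L := hQ9
        _ ≤ C2 * N := div_le_self (by positivity) hL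
        _ ≤ _ := le_mul_of_one_le_right (by positivity) (one_le_pow₀ hL)
    calc _ ≤ D / L ^ 3 * (N * L ^ 2 + (N * ((1 + 2 * B) ^ 2 * L ^ 2) + C2 * N * L ^ 2)) := by gcongr
      _ = _ := by field_simp; ring
  have t2 : (9 * Q ^ 3) * D * (8 * Q * (Q * (C1 * (N / L ^ (6 * B + 1))) + 6 * Q * L ^ 2 + (Q:ℝ) ^ 4)) * (2 * N * Q) / M ≤ 144 * (C1 + 7 * C2) * (D * N / L) := by
    have a0 : Q ^ 6 * (N / L ^ (6 * B + 1)) ≤ N / L := by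
      rw [mul_div_assoc', div_le_div_iff₀ (by positivity) hL0, pow_succ L, mul_comm 6 B]
      have := hpw 6
      calc _ = (Q:ℝ) ^ 6 * (N * L) := by ring
        _ ≤ L ^ (B * 6) * (N * L) := by gcongr
        _ = _ := by ring
    have a1 : 6 * Q * L ^ 2 + (Q:ℝ) ^ 4 ≤ 7 * (Q:ℝ) ^ 4 := by
      have : Q * L ^ 2 ≤ (Q:ℝ) ^ 4 := by
        calc Q * L ^ 2 ≤ Q * (Q:ℝ) ^ 2 := by gcongr
          _ = (Q:ℝ) ^ 3 := by ring
          _ ≤ _ := pow_le_pow_right₀ hQ1 (by norm_num)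
      linarith
    have hM0 : (0:ℝ) < M := by linarith
    rw [div_le_iff₀ hM0]
    calc _ ≤ (9 * Q ^ 3) * D * (8 * Q * (Q * (C1 * (N / L ^ (6 * B + 1))) + 6 * Q * L ^ 2 + (Q:ℝ) ^ 4)) * (2 * M * Q) := by gcongr
      _ = 144 * D * (C1 * (Q ^ 6 * (N / L ^ (6 * B + 1))) + (Q:ℝ) ^ 5 * (6 * Q * L ^ 2 + (Q:ℝ) ^ 4)) * M := by ring
      _ ≤ 144 * D * (C1 * (N / L) + (Q:ℝ) ^ 5 * (7 * (Q:ℝ) ^ 4)) * M := by gcongr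
      _ = 144 * D * (C1 * (N / L) + 7 * (Q:ℝ) ^ 9) * M := by ring
      _ ≤ 144 * D * (C1 * (N / L) + 7 * (C2 * N / L)) * M := by gcongr
      _ = _ := by ring
  rw [add_mul]
  exact add_le_add t1 t2

theorem zf_mod (f : Polynomial ℤ) (m r : ℕ) : f.eval ((r % m : ℕ) : ℤ) % (m:ℤ) = 0 ↔ f.eval (r:ℤ) % (m:ℤ) = 0 := by
  have h1 := Polynomial.sub_dvd_eval_sub ((r % m : ℕ) : ℤ) (r:ℤ) f
  have h2 : (m:ℤ) ∣ ((r % m : ℕ) : ℤ) - r := by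
    push_cast
    exact Int.dvd_emod_sub_self
  have h3 := h2.trans h1
  rw [← Int.dvd_iff_emod_eq_zero, ← Int.dvd_iff_emod_eq_zero]
  exact dvd_iff_dvd_of_dvd_sub h3

theorem zf_mul (f : Polynomial ℤ) (m n : ℕ) (h : m.Coprime n) : zf f (m * n) = zf f m * zf f n := by
  rcases Nat.eq_zero_or_pos m with rfl | hm
  · simp [zf]
  rcases Nat.eq_zero_or_pos n with rfl | hn
  · simp [zf]
  rw [zf, zf, zf, ← Finset.card_product]
  have hmn : ∀ t : ℤ, t % ((m * n : ℕ) : ℤ) = 0 ↔ t % m = 0 ∧ t % n = 0 := fun t => by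
    rw [← Int.dvd_iff_emod_eq_zero, ← Int.dvd_iff_emod_eq_zero, ← Int.dvd_iff_emod_eq_zero]
    push_cast
    exact ⟨fun hh => ⟨(dvd_mul_right _ _).trans hh, (dvd_mul_left _ _).trans hh⟩,
      fun hh => (Nat.isCoprime_iff_coprime.mpr h).mul_dvd hh.1 hh.2⟩
  have hc : ∀ r a b : ℕ, r < m * n → a < m → b < n → r % m = a → r % n = b → r = (Nat.chineseRemainder h a b : ℕ) := by
    intro r a b hr ha hb h1 h2
    have hx := (Nat.chineseRemainder h a b).2
    refine Nat.ModEq.eq_of_lt_of_lt ((Nat.modEq_and_modEq_iff_modEq_mul h).mp ⟨?_, ?_⟩) hr (Nat.chineseRemainder_lt_mul h a b hm.ne' hn.ne')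
    · exact (show r ≡ a [MOD m] by rw [Nat.ModEq, h1, Nat.mod_eq_of_lt ha]).trans hx.1.symm
    · exact (show r ≡ b [MOD n] by rw [Nat.ModEq, h2, Nat.mod_eq_of_lt hb]).trans hx.2.symm
  refine Finset.card_bij' (fun r _ => (r % m, r % n)) (fun x _ => (Nat.chineseRemainder h x.1 x.2 : ℕ)) ?_ ?_ ?_ ?_
  · intro r hr
    simp only [Finset.mem_filter, Finset.mem_range, Finset.mem_product] at hr ⊢
    rw [hmn] at hr
    exact ⟨⟨Nat.mod_lt _ hm, (zf_mod f m r).mpr hr.2.1⟩, Nat.mod_lt _ hn, (zf_mod f n r).mpr hr.2.2⟩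
  · rintro ⟨a, b⟩ hx
    simp only [Finset.mem_filter, Finset.mem_range, Finset.mem_product] at hx ⊢
    have hy := (Nat.chineseRemainder h a b).2
    have h1 : (Nat.chineseRemainder h a b : ℕ) % m = a := by rw [hy.1]; exact Nat.mod_eq_of_lt hx.1.1
    have h2 : (Nat.chineseRemainder h a b : ℕ) % n = b := by rw [hy.2]; exact Nat.mod_eq_of_lt hx.2.1
    refine ⟨Nat.chineseRemainder_lt_mul h a b hm.ne' hn.ne', ?_⟩
    rw [hmn, ← zf_mod f m, ← zf_mod f n, h1, h2]
    exact ⟨hx.1.2, hx.2.2⟩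
  · intro r hr
    simp only [Finset.mem_filter, Finset.mem_range] at hr
    exact (hc r _ _ hr.1 (Nat.mod_lt _ hm) (Nat.mod_lt _ hn) rfl rfl).symm
  · rintro ⟨a, b⟩ hx
    simp only [Finset.mem_filter, Finset.mem_range, Finset.mem_product] at hx
    have hy := (Nat.chineseRemainder h a b).2
    rw [Prod.mk.injEq]
    exact ⟨by rw [hy.1]; exact Nat.mod_eq_of_lt hx.1.1, by rw [hy.2]; exact Nat.mod_eq_of_lt hx.2.1⟩

theorem zf_prime (f : Polynomial ℤ) (hc : 0 < f.leadingCoeff) (p : ℕ) (hp : p.Prime) : zf f p ≤ f.natDegree + f.leadingCoeff.natAbs := by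
  by_cases hd : (p:ℤ) ∣ f.leadingCoeff
  · have h1 : p ≤ f.leadingCoeff.natAbs := Nat.le_of_dvd (by omega) (Int.natCast_dvd.mp hd)
    have h2 : zf f p ≤ p := (Finset.card_filter_le _ _).trans (by simp)
    omega
  · have := Fact.mk hp
    have hne : (Int.castRingHom (ZMod p)) f.leadingCoeff ≠ 0 := by
      intro h; exact hd ((ZMod.intCast_zmod_eq_zero_iff_dvd _ p).mp h)
    have hg : f.map (Int.castRingHom (ZMod p)) ≠ 0 := fun h => by
      have h2 := congrArg (fun g => Polynomial.coeff g f.natDegree) h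
      simp only [Polynomial.coeff_map, Polynomial.coeff_zero] at h2
      exact hne h2
    set g := f.map (Int.castRingHom (ZMod p)) with hgd
    have h1 : zf f p ≤ g.roots.toFinset.card := by
      refine Finset.card_le_card_of_injOn (fun r => (r : ZMod p)) ?_ ?_
      · intro r hr
        have hr := (Finset.mem_filter.mp hr).2
        rw [← Int.dvd_iff_emod_eq_zero, ← ZMod.intCast_zmod_eq_zero_iff_dvd] at hr
        rw [Finset.mem_coe, Multiset.mem_toFinset, Polynomial.mem_roots hg, Polynomial.IsRoot.def, hgd]
        have := Polynomial.eval_intCast_map (Int.castRingHom (ZMod p)) f (r:ℤ)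
        push_cast at this
        rw [this]
        exact_mod_cast hr
      · intro r hr r' hr' h
        have h2 := Finset.mem_range.mp (Finset.mem_filter.mp hr).1
        have h3 := Finset.mem_range.mp (Finset.mem_filter.mp hr').1
        exact Nat.ModEq.eq_of_lt_of_lt ((ZMod.natCast_eq_natCast_iff _ _ _).mp h) h2 h3
    have h2 := (h1.trans (Multiset.toFinset_card_le _)).trans (Polynomial.card_roots' g)
    have h3 : g.natDegree ≤ f.natDegree := Polynomial.natDegree_map_le
    omega

def zA (f : Polynomial ℤ) : ArithmeticFunction ℤ := ⟨fun n => (zf f n : ℤ), by simp [zf]⟩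

theorem zA_mult (f : Polynomial ℤ) : (zA f).IsMultiplicative := by
  refine ⟨?_, fun {m n} h => ?_⟩
  · simp [zA, zf]
  · change ((zf f (m * n) : ℕ) : ℤ) = zf f m * zf f n
    rw [zf_mul f m n h]; push_cast; rfl

noncomputable def rho (f : Polynomial ℤ) : ArithmeticFunction ℤ := ArithmeticFunction.moebius * zA f

theorem rho_mult (f : Polynomial ℤ) : (rho f).IsMultiplicative := ArithmeticFunction.isMultiplicative_moebius.mul (zA_mult f)

theorem rho_prime (f : Polynomial ℤ) (p : ℕ) (hp : p.Prime) : rho f p = zf f p - 1 := by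
  have h1 : zA f 1 = 1 := (zA_mult f).1
  rw [rho, ArithmeticFunction.mul_apply, Nat.sum_divisorsAntidiagonal (fun a b => ArithmeticFunction.moebius a * zA f b), hp.divisors,
    Finset.sum_pair hp.one_lt.ne]
  rw [Nat.div_one, Nat.div_self hp.pos, h1, ArithmeticFunction.moebius_apply_prime hp, ArithmeticFunction.moebius_apply_one]
  change 1 * (zf f p : ℤ) + -1 * 1 = _
  ring

noncomputable def gq (f : Polynomial ℤ) (q : ℕ) : ℝ := wq q ^ 2 * rho f q

theorem rho_bound (f : Polynomial ℤ) (hc : 0 < f.leadingCoeff) : ∃ C : ℝ, 0 < C ∧ ∀ q : ℕ, Squarefree q → |(rho f q : ℝ)| ≤ C * (q:ℝ) ^ (1/4 : ℝ) := by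
  set K := f.natDegree + f.leadingCoeff.natAbs with hK
  have hK1 : 1 ≤ K := by omega
  have hK1' : (1:ℝ) ≤ K := by exact_mod_cast hK1
  refine ⟨(K:ℝ) ^ (K ^ 4 + 1), by positivity, fun q hq => ?_⟩
  have h1 : ∀ p ∈ q.primeFactors, |(rho f p : ℝ)| ≤ (if p < K ^ 4 + 1 then (K:ℝ) else 1) * (p:ℝ) ^ (1/4 : ℝ) := by
    intro p hp
    have hp := Nat.prime_of_mem_primeFactors hp
    have hp1 : (1:ℝ) ≤ p := by exact_mod_cast hp.one_le
    have h2 : |(rho f p : ℝ)| ≤ K := by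
      rw [rho_prime f p hp]
      have h3 : (zf f p : ℝ) ≤ K := by exact_mod_cast zf_prime f hc p hp
      have h4 : (0:ℝ) ≤ zf f p := by positivity
      push_cast
      rw [abs_le]; constructor <;> linarith
    split_ifs with h
    · exact h2.trans (le_mul_of_one_le_right (by positivity) (Real.one_le_rpow hp1 (by norm_num)))
    · rw [one_mul]
      refine h2.trans ?_
      have h5 : ((K:ℝ) ^ 4) ≤ p := by exact_mod_cast (by omega : K ^ 4 ≤ p)
      calc (K:ℝ) = ((K:ℝ) ^ 4) ^ (1/4 : ℝ) := by
            rw [← Real.rpow_natCast, ← Real.rpow_mul (by positivity)]; norm_num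
        _ ≤ _ := by gcongr
  rw [← (rho_mult f).prod_primeFactors hq]
  push_cast
  rw [Finset.abs_prod]
  refine (Finset.prod_le_prod (fun _ _ => abs_nonneg _) h1).trans ?_
  rw [Finset.prod_mul_distrib, Real.finsetProd_rpow _ _ (fun _ _ => by positivity)]
  have h6 : ∏ p ∈ q.primeFactors, (p:ℝ) = q := by
    rw [← Nat.cast_prod, Nat.prod_primeFactors_of_squarefree hq]
  rw [h6]
  gcongr
  rw [← Finset.prod_filter]
  rw [Finset.prod_const]
  refine pow_le_pow_right₀ hK1' ?_
  calc _ ≤ (Finset.range (K ^ 4 + 1)).card := Finset.card_le_card (fun p hp => by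
        rw [Finset.mem_filter] at hp; exact Finset.mem_range.mpr hp.2)
    _ = _ := Finset.card_range _

theorem gq_bound (f : Polynomial ℤ) (hc : 0 < f.leadingCoeff) : ∃ C : ℝ, 0 < C ∧ ∀ q : ℕ, |gq f q| ≤ C * (1 / (q:ℝ) ^ (3/2 : ℝ)) := by
  obtain ⟨C, hC, h⟩ := rho_bound f hc
  refine ⟨C * 17 ^ 2, by positivity, fun q => ?_⟩
  by_cases hq : Squarefree q
  · have hq1 : 1 ≤ q := Nat.one_le_iff_ne_zero.mpr hq.ne_zero
    have hq0 : (0:ℝ) < q := by exact_mod_cast hq1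
    have hq1' : (1:ℝ) ≤ q := by exact_mod_cast hq1
    have hl : log q ≤ 8 * (q:ℝ) ^ (1/8 : ℝ) := by
      have := Real.log_le_rpow_div hq0.le (show (0:ℝ) < 1/8 by norm_num)
      linarith
    have hl0 : 0 ≤ log q := log_natCast_nonneg q
    have h1 : (1:ℝ) ≤ (q:ℝ) ^ (1/8 : ℝ) := Real.one_le_rpow hq1' (by norm_num)
    have h2 : |wq q| ≤ 17 * (q:ℝ) ^ (1/8 : ℝ) / q := by
      refine (wq_abs q).trans ((inv_totient q hq1).trans ?_)
      gcongr; linarith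
    rw [gq, abs_mul, abs_pow]
    calc _ ≤ (17 * (q:ℝ) ^ (1/8 : ℝ) / q) ^ 2 * (C * (q:ℝ) ^ (1/4 : ℝ)) := by
          gcongr; exact h q hq
      _ = C * 17 ^ 2 * (((q:ℝ) ^ (1/8 : ℝ) * (q:ℝ) ^ (1/8 : ℝ)) * (q:ℝ) ^ (1/4 : ℝ) / q ^ 2) := by field_simp
      _ = _ := by
          congr 1
          rw [← Real.rpow_add hq0, ← Real.rpow_add hq0, div_eq_div_iff (by positivity) (by positivity), ← Real.rpow_add hq0, one_mul, ← Real.rpow_natCast]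
          norm_num
  · rw [gq, wq, ArithmeticFunction.moebius_eq_zero_of_not_squarefree hq]
    simp only [Int.cast_zero, zero_div, ne_eq, OfNat.ofNat_ne_zero, not_false_eq_true, zero_pow, zero_mul, abs_zero]
    positivity

theorem gq_prod (f : Polynomial ℤ) (hc : 0 < f.leadingCoeff) :
    (∏' p : Nat.Primes, (1 + ((zf f (p : ℕ) : ℝ) - 1) / (((p : ℕ) : ℝ) - 1) ^ 2)) = ∑' q, gq f q := by
  obtain ⟨C, hC, h⟩ := gq_bound f hc
  have h0 : gq f 0 = 0 := by simp [gq]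
  have h1 : gq f 1 = 1 := by simp [gq, wq, (rho_mult f).1]
  have hs : Summable (fun q => ‖gq f q‖) :=
    Summable.of_nonneg_of_le (fun _ => norm_nonneg _) h ((Real.summable_one_div_nat_rpow.mpr (by norm_num)).mul_left C)
  have hp := EulerProduct.eulerProduct_hasProd (f := gq f) h1 (fun {m n} hmn => by
    rw [gq, gq, gq, (rho_mult f).2 hmn, wq, wq, wq, ArithmeticFunction.isMultiplicative_moebius.2 hmn, Nat.totient_mul hmn]
    push_cast
    rw [mul_div_mul_comm]; ring) hs h0
  rw [← hp.tprod_eq]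
  refine tprod_congr fun p => ?_
  rw [tsum_eq_sum (s := {0, 1})]
  · rw [Finset.sum_pair (by norm_num), pow_zero, pow_one, h1, gq, wq, rho_prime f p p.2, ArithmeticFunction.moebius_apply_prime p.2, Nat.totient_prime p.2,
      Nat.cast_sub p.2.one_le]
    push_cast
    congr 1
    rw [div_pow, neg_one_sq]; ring
  · intro e he
    have he2 : 2 ≤ e := by
      simp only [Finset.mem_insert, Finset.mem_singleton, not_or] at he
      omega
    have : ¬ Squarefree ((p:ℕ) ^ e) := by
      rw [Nat.squarefree_pow_iff p.2.ne_one (by omega)]; omega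
    rw [gq, wq, ArithmeticFunction.moebius_eq_zero_of_not_squarefree this]
    simp

theorem gq_tail (f : Polynomial ℤ) (hc : 0 < f.leadingCoeff) : ∃ C : ℝ, 0 < C ∧ ∀ Q : ℕ, 1 ≤ Q →
    |∑ q ∈ Finset.Icc 1 Q, gq f q - ∏' p : Nat.Primes, (1 + ((zf f (p : ℕ) : ℝ) - 1) / (((p : ℕ) : ℝ) - 1) ^ 2)| ≤ C / (Q:ℝ) ^ (1/4 : ℝ) := by
  obtain ⟨C, hC, h⟩ := gq_bound f hc
  have hs : Summable (fun q => gq f q) := Summable.of_norm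
    (Summable.of_nonneg_of_le (fun _ => norm_nonneg _) h ((Real.summable_one_div_nat_rpow.mpr (by norm_num)).mul_left C))
  have hS : Summable (fun q : ℕ => 1 / (q:ℝ) ^ (5/4 : ℝ)) := Real.summable_one_div_nat_rpow.mpr (by norm_num)
  refine ⟨C * (∑' q : ℕ, 1 / (q:ℝ) ^ (5/4 : ℝ) + 1), mul_pos hC ?_, fun Q hQ => ?_⟩
  · have : 0 ≤ ∑' q : ℕ, 1 / (q:ℝ) ^ (5/4 : ℝ) := tsum_nonneg fun q => by positivity
    linarith
  have h0 : gq f 0 = 0 := by simp [gq]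
  have e1 : ∑ q ∈ Finset.Icc 1 Q, gq f q = ∑ q ∈ Finset.range (Q + 1), gq f q := by
    rw [Finset.sum_range_succ', h0, add_zero, ← Finset.Ico_add_one_right_eq_Icc, Finset.sum_Ico_eq_sum_range]
    simp only [Nat.add_sub_cancel, add_comm]
  have hQ0 : (0:ℝ) < Q := by exact_mod_cast hQ
  rw [gq_prod f hc, e1, ← hs.sum_add_tsum_nat_add (Q + 1), sub_add_cancel_left, abs_neg]
  have hS2 := (summable_nat_add_iff (Q + 1)).mpr hS
  have hb : ∀ i : ℕ, ‖gq f (i + (Q + 1))‖ ≤ C / (Q:ℝ) ^ (1/4 : ℝ) * (1 / ((i + (Q + 1) : ℕ):ℝ) ^ (5/4 : ℝ)) := by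
    intro i
    set q := i + (Q + 1)
    have hq0 : (0:ℝ) < q := by positivity
    have hqQ : (Q:ℝ) ≤ q := by exact_mod_cast (by omega : Q ≤ i + (Q + 1))
    refine (h q).trans ?_
    have : (q:ℝ) ^ (3/2 : ℝ) = (q:ℝ) ^ (1/4 : ℝ) * (q:ℝ) ^ (5/4 : ℝ) := by
      rw [← Real.rpow_add hq0]; norm_num
    rw [this, div_mul_div_comm, mul_one, mul_one_div]
    gcongr
  refine (tsum_of_norm_bounded (hS2.mul_left _).hasSum hb).trans ?_
  rw [tsum_mul_left, mul_div_right_comm]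
  have := hS.sum_add_tsum_nat_add (Q + 1)
  have h3 : 0 ≤ ∑ i ∈ Finset.range (Q + 1), 1 / (i:ℝ) ^ (5/4 : ℝ) := Finset.sum_nonneg fun i _ => by positivity
  gcongr
  linarith

theorem per_block (H : ℕ → ℝ) (q : ℕ) (hH : ∀ n, H (n + q) = H n) (s : ℕ) : ∑ i ∈ Finset.range q, H (i + s) = ∑ i ∈ Finset.range q, H i := by
  induction s with
  | zero => simp
  | succ s ih =>
    rw [← ih]
    have h1 := Finset.sum_range_succ (fun i => H (i + s)) q
    have h2 := Finset.sum_range_succ' (fun i => H (i + s)) q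
    have h3 : H (q + s) = H (0 + s) := by rw [add_comm q s, zero_add, hH]
    have h4 : ∑ i ∈ Finset.range q, H (i + (s + 1)) = ∑ i ∈ Finset.range q, H (i + 1 + s) :=
      Finset.sum_congr rfl fun i _ => by congr 1; ring
    linarith

theorem per_sum (H : ℕ → ℝ) (q : ℕ) (hq : 1 ≤ q) (hH : ∀ n, H (n + q) = H n) (h0 : ∑ i ∈ Finset.range q, H i = 0) (K : ℝ) (hK : ∀ n, |H n| ≤ K) (n : ℕ) :
    |∑ i ∈ Finset.range n, H i| ≤ q * K := by
  have hK0 : 0 ≤ K := (abs_nonneg _).trans (hK 0)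
  induction n using Nat.strong_induction_on with
  | _ n ih =>
    rcases lt_or_ge n q with h | h
    · refine (Finset.abs_sum_le_sum_abs _ _).trans ((Finset.sum_le_sum fun i _ => hK i).trans ?_)
      rw [Finset.sum_const, Finset.card_range, nsmul_eq_mul]
      gcongr
    · obtain ⟨m, rfl⟩ := Nat.exists_eq_add_of_le h
      rw [Finset.sum_range_add, h0, zero_add]
      rw [Finset.sum_congr rfl fun i _ => show H (q + i) = H i by rw [add_comm, hH]]
      exact ih m (by omega)

theorem cr_mod (q : ℕ) (a b : ℤ) (h : (q:ℤ) ∣ a - b) : cr q a = cr q b := by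
  rw [cr, cr]
  refine Finset.sum_congr rfl fun x hx => ?_
  rw [Nat.mem_divisorsAntidiagonal] at hx
  have h2 : (x.2 : ℤ) ∣ a - b := Dvd.dvd.trans (by exact_mod_cast Dvd.intro_left _ hx.1) h
  simp only [dvd_iff_dvd_of_dvd_sub h2]

theorem cr_per (f : Polynomial ℤ) (q n : ℕ) : cr q (f.eval ((n + q : ℕ) : ℤ)) = cr q (f.eval (n:ℤ)) := by
  apply cr_mod
  refine Dvd.dvd.trans ?_ (Polynomial.sub_dvd_eval_sub _ _ f)
  push_cast
  simp

theorem zf_block (f : Polynomial ℤ) (b a : ℕ) : ∑ r ∈ Finset.range (a * b), (if (b:ℤ) ∣ f.eval (r:ℤ) then (b:ℝ) else 0) = a * b * zf f b := by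
  have h0 : ∑ r ∈ Finset.range b, (if (b:ℤ) ∣ f.eval (r:ℤ) then (b:ℝ) else 0) = b * zf f b := by
    rw [← Finset.sum_filter, Finset.sum_const, nsmul_eq_mul, mul_comm]
    congr 2
    simp only [Int.dvd_iff_emod_eq_zero, zf]
  induction a with
  | zero => simp
  | succ a ih =>
    rw [add_mul, one_mul, add_comm, Finset.sum_range_add, h0]
    have : ∀ i ∈ Finset.range (a * b), (if (b:ℤ) ∣ f.eval ((b + i : ℕ) : ℤ) then (b:ℝ) else 0) = if (b:ℤ) ∣ f.eval (i : ℤ) then (b:ℝ) else 0 := by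
      intro i _
      have h2 : (b:ℤ) ∣ f.eval ((b + i : ℕ) : ℤ) - f.eval (i:ℤ) := Dvd.dvd.trans (by push_cast; simp) (Polynomial.sub_dvd_eval_sub _ _ f)
      simp only [dvd_iff_dvd_of_dvd_sub h2]
    rw [Finset.sum_congr rfl this, ih]
    push_cast; ring

theorem cr_mean (f : Polynomial ℤ) (q : ℕ) : ∑ d ∈ Finset.range q, (cr q (Fv f d) : ℝ) = q * rho f q := by
  have h := per_block (fun n => (cr q (f.eval (n:ℤ)) : ℝ)) q (fun n => by rw [cr_per]) 1
  have e : ∀ d ∈ Finset.range q, (cr q (Fv f d) : ℝ) = cr q (f.eval ((d + 1 : ℕ) : ℤ)) := fun d _ => by rw [Fv]; push_cast; rfl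
  rw [Finset.sum_congr rfl e, h]
  simp only [cr]
  push_cast
  rw [Finset.sum_comm, rho, ArithmeticFunction.mul_apply]
  push_cast
  rw [Finset.mul_sum]
  refine Finset.sum_congr rfl fun x hx => ?_
  rw [Nat.mem_divisorsAntidiagonal] at hx
  rw [← Finset.mul_sum, ← hx.1, zf_block]
  change _ = _ * (_ * ((zf f x.2 : ℤ) : ℝ))
  push_cast; ring

theorem cr_sums (f : Polynomial ℤ) (q : ℕ) (hq : 1 ≤ q) (y z : ℕ) (hyz : y ≤ z) : |∑ d ∈ Finset.Ioc y z, ((cr q (Fv f d) : ℝ) - rho f q)| ≤ 4 * q ^ 2 ∧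
    ∀ d, |(cr q (Fv f d) : ℝ) - rho f q| ≤ 2 * q := by
  have hq0 : (0:ℝ) < q := by exact_mod_cast hq
  have hcr : ∀ n, |(cr q n : ℝ)| ≤ q := fun n => (cr_abs q hq n).trans (by exact_mod_cast Nat.totient_le q)
  have hr : |(rho f q : ℝ)| ≤ q := by
    have h := cr_mean f q
    have h2 : |(q:ℝ) * rho f q| ≤ q * q := by
      rw [← h]
      refine (Finset.abs_sum_le_sum_abs _ _).trans ((Finset.sum_le_sum fun i _ => hcr _).trans ?_)
      simp
    rw [abs_mul, abs_of_pos hq0] at h2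
    exact le_of_mul_le_mul_left h2 hq0
  have hd : ∀ d, |(cr q (Fv f d) : ℝ) - rho f q| ≤ 2 * q := fun d => by
    have := abs_sub ((cr q (Fv f d) : ℝ)) (rho f q)
    have := hcr (Fv f d)
    linarith
  refine ⟨?_, hd⟩
  have hs := per_sum (fun d => (cr q (Fv f d) : ℝ) - rho f q) q hq (fun n => by
    have : Fv f (n + q) = f.eval ((n + 1 + q : ℕ) : ℤ) := by rw [Fv]; congr 1; push_cast; ring
    rw [this, cr_per, Fv]; push_cast; rfl) (by rw [Finset.sum_sub_distrib, cr_mean]; simp) _ hd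
  rw [← Finset.Ico_add_one_add_one_eq_Ioc, Finset.sum_Ico_eq_sub _ (by omega)]
  have h1 := hs (z + 1)
  have h2 := hs (y + 1)
  refine (abs_sub _ _).trans ?_
  nlinarith

theorem poly_pos (g : Polynomial ℝ) (h : 0 < g.leadingCoeff) : ∀ᶠ x : ℝ in atTop, 0 < g.eval x := by
  rcases Nat.eq_zero_or_pos g.natDegree with h0 | h0
  · rw [Polynomial.eq_C_of_natDegree_eq_zero h0] at h ⊢
    simp only [Polynomial.leadingCoeff_C] at h
    simp [h]
  · exact (Polynomial.tendsto_atTop_of_leadingCoeff_nonneg g (Polynomial.natDegree_pos_iff_degree_pos.mp h0) h.le).eventually_gt_atTop 0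

theorem Fv_smono (f : Polynomial ℤ) (hk : 1 ≤ f.natDegree) (hc : 0 < f.leadingCoeff) : ∃ d0 : ℕ, ∀ d, d0 ≤ d → 0 < Fv f d ∧ Fv f d < Fv f (d + 1) := by
  set g := f.map (Int.castRingHom ℝ) with hg
  have hgl : g.leadingCoeff = f.leadingCoeff := Polynomial.leadingCoeff_map_of_injective Int.cast_injective f
  have hgd : g.natDegree = f.natDegree := Polynomial.natDegree_map_eq_of_injective Int.cast_injective f
  have hgp : 0 < g.leadingCoeff := by rw [hgl]; exact_mod_cast hc
  have h1 : 0 < g.derivative.leadingCoeff := by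
    rw [Polynomial.leadingCoeff_derivative]
    have : (0:ℝ) < g.natDegree := by rw [hgd]; exact_mod_cast hk
    positivity
  obtain ⟨x0, hx0⟩ := eventually_atTop.mp ((poly_pos g hgp).and (poly_pos _ h1))
  have hm : StrictMonoOn (fun x => g.eval x) (Set.Ici x0) := by
    refine strictMonoOn_of_deriv_pos (convex_Ici x0) g.continuous.continuousOn fun x hx => ?_
    rw [interior_Ici] at hx
    rw [Polynomial.deriv]
    exact (hx0 x (le_of_lt hx)).2
  have he : ∀ d : ℕ, (Fv f d : ℝ) = g.eval ((d:ℝ) + 1) := fun d => by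
    rw [Fv, hg]
    have := Polynomial.eval_intCast_map (Int.castRingHom ℝ) f ((d:ℤ) + 1)
    push_cast at this
    rw [this]; rfl
  refine ⟨⌈x0⌉₊, fun d hd => ?_⟩
  have hd' : x0 ≤ d := (Nat.le_ceil x0).trans (by exact_mod_cast hd)
  constructor
  · have := (hx0 ((d:ℝ) + 1) (by linarith)).1
    rw [← he] at this
    exact_mod_cast this
  · have := hm (show (d:ℝ) + 1 ∈ Set.Ici x0 by rw [Set.mem_Ici]; linarith) (show ((d + 1 : ℕ):ℝ) + 1 ∈ Set.Ici x0 by rw [Set.mem_Ici]; push_cast; linarith)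
      (by push_cast; linarith)
    simp only at this
    rw [← he, ← he] at this
    exact_mod_cast this

theorem Fv_mono (f : Polynomial ℤ) (hk : 1 ≤ f.natDegree) (hc : 0 < f.leadingCoeff) : ∃ d0 : ℕ, ∀ d, d0 ≤ d → 0 < Fv f d ∧ Fv f d ≤ Fv f (d + 1) := by
  obtain ⟨d0, h⟩ := Fv_smono f hk hc
  exact ⟨d0, fun d hd => ⟨(h d hd).1, (h d hd).2.le⟩⟩

theorem inner_ls (Q N : ℕ) (h : ℤ) : |∑ n ∈ Finset.Ioc 0 N, ∑ m ∈ Finset.Ioc 0 N, (if (m:ℤ) - n = h then Ls Q n * Ls Q m else 0)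
    - max 0 ((N:ℝ) - |(h:ℝ)|) * ∑ q ∈ Finset.Icc 1 Q, wq q ^ 2 * cr q h| ≤ (Q:ℝ) ^ 6 := by
  have e : ∀ n ∈ Finset.Ioc 0 N, ∑ m ∈ Finset.Ioc 0 N, (if (m:ℤ) - n = h then Ls Q n * Ls Q m else 0) =
      if 0 < (n:ℤ) + h ∧ (n:ℤ) + h ≤ N then Ls Q n * Ls Q (n + h) else 0 := by
    intro n _
    split_ifs with h1
    · obtain ⟨m, hm⟩ := Int.eq_ofNat_of_zero_le h1.1.le
      rw [Finset.sum_eq_single_of_mem m (by rw [Finset.mem_Ioc]; omega)]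
      · rw [if_pos (by omega), hm]
      · intro b _ hb
        rw [if_neg (by omega)]
    · refine Finset.sum_eq_zero fun m hm => ?_
      rw [Finset.mem_Ioc] at hm
      rw [if_neg (by omega)]
  rw [Finset.sum_congr rfl e, ← Finset.sum_filter]
  rcases le_or_gt (N:ℤ) |h| with h1 | h1
  · rw [Finset.filter_eq_empty_iff.mpr, Finset.sum_empty, max_eq_left]
    · simp
    · have : (N:ℝ) ≤ |(h:ℝ)| := by exact_mod_cast h1
      linarith
    · intro n hn
      rw [Finset.mem_Ioc] at hn
      rcases abs_cases h with h2 | h2 <;> omega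
  · have h3 := abs_lt.mp h1
    obtain ⟨u, hu⟩ := Int.eq_ofNat_of_zero_le (le_max_left 0 (-h))
    obtain ⟨v, hv⟩ := Int.eq_ofNat_of_zero_le (show 0 ≤ min (N:ℤ) (N - h) by omega)
    have e2 : (Finset.Ioc 0 N).filter (fun n : ℕ => 0 < (n:ℤ) + h ∧ (n:ℤ) + h ≤ N) = Finset.Ioc u v := by
      ext n
      rw [Finset.mem_filter, Finset.mem_Ioc, Finset.mem_Ioc]
      omega
    have e3 : max 0 ((N:ℝ) - |(h:ℝ)|) = (v:ℝ) - u := by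
      have : (|h| : ℝ) < N := by exact_mod_cast h1
      rw [max_eq_right (by linarith)]
      have : (N:ℤ) - |h| = v - u := by rcases abs_cases h with h2 | h2 <;> omega
      exact_mod_cast this
    rw [e2, e3]
    exact corr Q h u v (by omega)

noncomputable def Wd (f : Polynomial ℤ) (N d : ℕ) : ℝ := max 0 ((N:ℝ) - |(Fv f d : ℝ)|)

theorem Wd_nonneg (f : Polynomial ℤ) (N d : ℕ) : 0 ≤ Wd f N d := le_max_left _ _

theorem Wd_le (f : Polynomial ℤ) (N d : ℕ) : Wd f N d ≤ N := max_le (by positivity) (by linarith [abs_nonneg (Fv f d : ℝ)])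

theorem rc_ls (f : Polynomial ℤ) (hk : 1 ≤ f.natDegree) (hc : 0 < f.leadingCoeff) : ∃ C : ℝ, 0 ≤ C ∧ ∀ N Q D : ℕ,
    |Rc N D (Fv f) (fun n => Ls Q n) - (∑ d ∈ Finset.range D, Wd f N d) * ∑ q ∈ Finset.Icc 1 Q, gq f q| ≤ D * (Q:ℝ) ^ 6 + C * N * Q ^ 3 := by
  obtain ⟨d0, hd0⟩ := Fv_mono f hk hc
  refine ⟨2 * d0 + 6, by positivity, fun N Q D => ?_⟩
  have key : ∀ q ∈ Finset.Icc 1 Q, |∑ d ∈ Finset.range D, Wd f N d * ((cr q (Fv f d) : ℝ) - rho f q)| ≤ (2 * d0 + 6) * N * Q ^ 2 := by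
    intro q hq
    rw [Finset.mem_Icc] at hq
    have hqQ : (q:ℝ) ≤ Q := by exact_mod_cast hq.2
    have hq1 : (1:ℝ) ≤ q := by exact_mod_cast hq.1
    have htriv : ∀ n : ℕ, |∑ d ∈ Finset.range n, Wd f N d * ((cr q (Fv f d) : ℝ) - rho f q)| ≤ n * (N * (2 * q)) := by
      intro n
      refine (Finset.abs_sum_le_sum_abs _ _).trans ((Finset.sum_le_sum (g := fun _ => (N:ℝ) * (2 * q)) fun d _ => ?_).trans (by simp))
      rw [abs_mul, abs_of_nonneg (Wd_nonneg f N d)]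
      gcongr
      · exact Wd_le f N d
      · exact (cr_sums f q hq.1 0 0 le_rfl).2 d
    have hb : ((d0:ℝ) + 1) * (N * (2 * q)) + 4 * q ^ 2 * N ≤ (2 * d0 + 6) * N * Q ^ 2 := by
      calc _ ≤ ((d0:ℝ) + 1) * (N * (2 * q ^ 2)) + 4 * q ^ 2 * N := by gcongr; exact le_self_pow₀ hq1 (by norm_num)
        _ = (2 * d0 + 6) * N * q ^ 2 := by ring
        _ ≤ _ := by gcongr
    refine le_trans ?_ hb
    rcases le_or_gt D (d0 + 1) with hD | hD
    · have hD' : (D:ℝ) ≤ d0 + 1 := by exact_mod_cast hD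
      refine (htriv D).trans ?_
      have : (0:ℝ) ≤ 4 * q ^ 2 * N := by positivity
      have : D * (N * (2 * (q:ℝ))) ≤ ((d0:ℝ) + 1) * (N * (2 * q)) := by gcongr
      linarith
    · have e : ∑ d ∈ Finset.range D, Wd f N d * ((cr q (Fv f d) : ℝ) - rho f q) = ∑ d ∈ Finset.range (d0 + 1), Wd f N d * ((cr q (Fv f d) : ℝ) - rho f q)
          + ∑ d ∈ Finset.Ioc d0 (D - 1), Wd f N d * ((cr q (Fv f d) : ℝ) - rho f q) := by
        rw [← Finset.Ico_add_one_add_one_eq_Ioc, Nat.sub_add_cancel (by omega), Finset.sum_range_add_sum_Ico _ (by omega)]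
      rw [e]
      refine (abs_add_le _ _).trans (add_le_add ?_ ?_)
      · exact_mod_cast htriv (d0 + 1)
      · have := abel_anti (fun d => (((cr q (Fv f d) : ℝ) - rho f q : ℝ) : ℂ)) (Wd f N) d0 (D - 1) (4 * q ^ 2) (fun z hz _ => by
          rw [← Complex.ofReal_sum, Complex.norm_real]
          exact (cr_sums f q hq.1 d0 z hz).1) (fun n _ _ => Wd_nonneg f N n) (fun n hn _ => by
            have h1 := hd0 n hn.le
            have h2 : (Fv f n : ℝ) ≤ Fv f (n + 1) := by exact_mod_cast h1.2
            have h3 : (0:ℝ) < Fv f n := by exact_mod_cast h1.1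
            refine max_le_max le_rfl ?_
            rw [abs_of_pos h3, abs_of_pos (by linarith)]
            linarith) (by omega)
        simp only [← Complex.ofReal_mul] at this
        rw [← Complex.ofReal_sum, Complex.norm_real] at this
        refine this.trans ?_
        gcongr
        exact Wd_le f N _
  have e1 : (∑ d ∈ Finset.range D, Wd f N d) * ∑ q ∈ Finset.Icc 1 Q, gq f q = ∑ d ∈ Finset.range D, Wd f N d * ∑ q ∈ Finset.Icc 1 Q, wq q ^ 2 * cr q (Fv f d)
      - ∑ q ∈ Finset.Icc 1 Q, wq q ^ 2 * ∑ d ∈ Finset.range D, Wd f N d * ((cr q (Fv f d) : ℝ) - rho f q) := by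
    simp_rw [Finset.mul_sum, Finset.sum_mul]
    rw [Finset.sum_comm (s := Finset.range D) (t := Finset.Icc 1 Q) (f := fun x i => Wd f N x * (wq i ^ 2 * (cr i (Fv f x) : ℝ))), ← Finset.sum_sub_distrib]
    try rw [Finset.sum_comm (s := Finset.range D)]
    refine Finset.sum_congr rfl fun q _ => ?_
    rw [← Finset.sum_sub_distrib]
    refine Finset.sum_congr rfl fun d _ => ?_
    rw [gq]; ring
  rw [e1, Rc, sub_sub_eq_add_sub, add_sub_right_comm, ← Finset.sum_sub_distrib]
  refine (abs_add_le _ _).trans (add_le_add ?_ ?_)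
  · refine (Finset.abs_sum_le_sum_abs _ _).trans ((Finset.sum_le_sum fun d _ => inner_ls Q N (Fv f d)).trans (by simp))
  · refine (Finset.abs_sum_le_sum_abs _ _).trans ((Finset.sum_le_sum (g := fun _ => (2 * (d0:ℝ) + 6) * N * Q ^ 2) fun q hq => ?_).trans (le_of_eq ?_))
    · rw [abs_mul]
      refine (mul_le_mul_of_nonneg_right ?_ (abs_nonneg _)).trans ((one_mul _).le.trans (key q hq))
      rw [abs_pow]
      exact pow_le_one₀ (abs_nonneg _) (wq_abs1 q)
    · simp; ring

def Kf (f : Polynomial ℤ) : ℕ := ∑ i ∈ Finset.range (f.natDegree + 1), (f.coeff i).natAbs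

theorem Fv_eq (f : Polynomial ℤ) (d : ℕ) : (Fv f d : ℝ) = ∑ i ∈ Finset.range (f.natDegree + 1), (f.coeff i : ℝ) * ((d:ℝ) + 1) ^ i := by
  rw [Fv, Polynomial.eval_eq_sum_range]; push_cast; rfl

theorem Kf_eq (f : Polynomial ℤ) : (Kf f : ℝ) = ∑ i ∈ Finset.range (f.natDegree + 1), |(f.coeff i : ℝ)| := by
  rw [Kf]; push_cast
  refine Finset.sum_congr rfl fun i _ => ?_
  rw [Nat.cast_natAbs]; push_cast; rfl

theorem Fv_abs (f : Polynomial ℤ) (d : ℕ) : |(Fv f d : ℝ)| ≤ Kf f * ((d:ℝ) + 1) ^ f.natDegree := by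
  rw [Fv_eq, Kf_eq, Finset.sum_mul]
  refine (Finset.abs_sum_le_sum_abs _ _).trans (Finset.sum_le_sum fun i hi => ?_)
  rw [abs_mul, abs_of_nonneg (by positivity : (0:ℝ) ≤ ((d:ℝ) + 1) ^ i)]
  gcongr
  · have : (0:ℝ) ≤ d := by positivity
    linarith
  · have := Finset.mem_range.mp hi; omega

theorem Fv_lead (f : Polynomial ℤ) (d : ℕ) : |(Fv f d : ℝ) - f.leadingCoeff * ((d:ℝ) + 1) ^ f.natDegree| ≤ Kf f * ((d:ℝ) + 1) ^ (f.natDegree - 1) := by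
  rw [Fv_eq, Kf_eq, Finset.sum_range_succ, Polynomial.coeff_natDegree, add_sub_cancel_right]
  rw [Finset.sum_range_succ, add_mul]
  have h0 : (0:ℝ) ≤ |(f.coeff f.natDegree : ℝ)| * ((d:ℝ) + 1) ^ (f.natDegree - 1) := by positivity
  refine le_trans ?_ (le_add_of_nonneg_right h0)
  rw [Finset.sum_mul]
  refine (Finset.abs_sum_le_sum_abs _ _).trans (Finset.sum_le_sum fun i hi => ?_)
  rw [abs_mul, abs_of_nonneg (by positivity : (0:ℝ) ≤ ((d:ℝ) + 1) ^ i)]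
  gcongr
  · have : (0:ℝ) ≤ d := by positivity
    linarith
  · have := Finset.mem_range.mp hi; omega

theorem sum_cap (k D : ℕ) (N c a : ℝ) (hN : 0 ≤ N) (hc : 0 < c) (ha : 0 ≤ a) (haD : a ≤ D) (hca : c * a ^ k = N) :
    |∑ d ∈ Finset.range D, max 0 (N - c * ((d:ℝ) + 1) ^ k) - k / (k + 1) * N * a| ≤ N := by
  set φ : ℝ → ℝ := fun x => max 0 (N - c * x ^ k) with hφ
  have hanti : AntitoneOn φ (Set.Icc 0 (0 + (D:ℝ))) := by
    intro x hx y hy hxy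
    refine max_le_max le_rfl ?_
    have := hx.1
    gcongr
  have h1 := hanti.integral_le_sum
  have h2 := hanti.sum_le_integral
  have hcont : Continuous φ := by fun_prop
  have hint : ∫ x in (0:ℝ)..(0 + D), φ x = k / (k + 1) * N * a := by
    rw [zero_add, ← intervalIntegral.integral_add_adjacent_intervals (hcont.intervalIntegrable 0 a) (hcont.intervalIntegrable a D)]
    have e1 : ∫ x in (0:ℝ)..a, φ x = ∫ x in (0:ℝ)..a, (N - c * x ^ k) := by
      refine intervalIntegral.integral_congr fun x hx => ?_
      rw [Set.uIcc_of_le ha] at hx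
      refine max_eq_right ?_
      have : c * x ^ k ≤ c * a ^ k := by
        have := hx.1
        have := hx.2
        gcongr
      linarith
    have e2 : ∫ x in a..(D:ℝ), φ x = ∫ x in a..(D:ℝ), (0:ℝ) := by
      refine intervalIntegral.integral_congr fun x hx => ?_
      rw [Set.uIcc_of_le haD] at hx
      refine max_eq_left ?_
      have : c * a ^ k ≤ c * x ^ k := by
        have := hx.1
        gcongr
      linarith
    rw [e1, e2, intervalIntegral.integral_sub (by simp) (by apply Continuous.intervalIntegrable; fun_prop), intervalIntegral.integral_const_mul, integral_pow]
    simp only [intervalIntegral.integral_const, intervalIntegral.integral_zero, smul_eq_mul]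
    rw [← hca]
    field_simp
    ring
  rw [hint] at h1 h2
  simp only [zero_add] at h1 h2
  have h3 : ∑ i ∈ Finset.range D, φ ((i + 1 : ℕ) : ℝ) = ∑ d ∈ Finset.range D, max 0 (N - c * ((d:ℝ) + 1) ^ k) :=
    Finset.sum_congr rfl fun i _ => by rw [hφ]; push_cast; rfl
  have h4 := Finset.sum_range_succ (fun i : ℕ => φ i) D
  have h5 := Finset.sum_range_succ' (fun i : ℕ => φ i) D
  have h6 : φ D ≥ 0 := le_max_left _ _
  have h7 : φ ((0:ℕ) : ℝ) ≤ N := max_le hN (by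
    have : 0 ≤ c * ((0:ℕ):ℝ) ^ k := by positivity
    linarith)
  rw [abs_le]
  constructor <;> linarith

theorem T_asym (f : Polynomial ℤ) (hk : 1 ≤ f.natDegree) (hc : 0 < f.leadingCoeff) (N D : ℕ) (hN : 1 ≤ N) (hD : N ≤ D ^ f.natDegree) :
    |∑ d ∈ Finset.range D, Wd f N d - (1 / (f.leadingCoeff : ℝ) ^ ((1 : ℝ) / f.natDegree)) * ((f.natDegree : ℝ) / (f.natDegree + 1)) *
          (N : ℝ) ^ (((f.natDegree : ℝ) + 1) / f.natDegree)| ≤ N + Kf f * (D:ℝ) ^ f.natDegree := by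
  set k := f.natDegree with hkd
  set c := (f.leadingCoeff : ℝ) with hcd
  have hc1 : 1 ≤ c := by
    have h1 : (1:ℤ) ≤ f.leadingCoeff := hc
    rw [hcd]; exact_mod_cast h1
  have hN0 : (0:ℝ) < N := by exact_mod_cast hN
  have hk0 : (0:ℝ) < k := by exact_mod_cast hk
  set a : ℝ := (N / c) ^ ((1:ℝ) / k) with ha
  have hak : a ^ k = N / c := by
    rw [ha, one_div, Real.rpow_inv_natCast_pow (by positivity) (by omega)]
  have haD : a ≤ D := by
    refine le_of_pow_le_pow_left₀ (by omega : k ≠ 0) (by positivity) ?_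
    rw [hak]
    calc (N:ℝ) / c ≤ N := div_le_self hN0.le hc1
      _ ≤ _ := by exact_mod_cast hD
  have h1 := sum_cap k D N c a hN0.le (by linarith) (by positivity) haD (by rw [hak]; field_simp)
  have e : (1 / c ^ ((1 : ℝ) / k)) * ((k : ℝ) / (k + 1)) * (N : ℝ) ^ (((k : ℝ) + 1) / k) = k / (k + 1) * N * a := by
    rw [ha, Real.div_rpow hN0.le (by linarith), add_div, div_self hk0.ne', Real.rpow_add hN0, Real.rpow_one]
    ring
  rw [e]
  have h2 : |∑ d ∈ Finset.range D, Wd f N d - ∑ d ∈ Finset.range D, max 0 (N - c * ((d:ℝ) + 1) ^ k)| ≤ Kf f * (D:ℝ) ^ k := by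
    rw [← Finset.sum_sub_distrib]
    have hb : ∀ d ∈ Finset.range D, |Wd f N d - max 0 (N - c * ((d:ℝ) + 1) ^ k)| ≤ Kf f * (D:ℝ) ^ (k - 1) := by
      intro d hd
      have hdD : (d:ℝ) + 1 ≤ D := by exact_mod_cast Finset.mem_range.mp hd
      calc |Wd f N d - max 0 (N - c * ((d:ℝ) + 1) ^ k)| ≤ |((N:ℝ) - |(Fv f d : ℝ)|) - (N - c * ((d:ℝ) + 1) ^ k)| := by
            rw [Wd]
            have := abs_max_sub_max_le_abs ((N:ℝ) - |(Fv f d : ℝ)|) (N - c * ((d:ℝ) + 1) ^ k) 0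
            rwa [max_comm, max_comm _ (0:ℝ)] at this
        _ = abs (|(Fv f d : ℝ)| - |c * ((d:ℝ) + 1) ^ k|) := by
            rw [abs_of_nonneg (by positivity : 0 ≤ c * ((d:ℝ) + 1) ^ k), ← abs_neg]; congr 1; ring
        _ ≤ |(Fv f d : ℝ) - c * ((d:ℝ) + 1) ^ k| := abs_abs_sub_abs_le _ _
        _ ≤ Kf f * ((d:ℝ) + 1) ^ (k - 1) := Fv_lead f d
        _ ≤ _ := by gcongr
    refine (Finset.abs_sum_le_sum_abs _ _).trans ((Finset.sum_le_sum hb).trans (le_of_eq ?_))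
    rw [Finset.sum_const, Finset.card_range, nsmul_eq_mul, ← Nat.sub_add_cancel hk, pow_succ, Nat.add_sub_cancel]
    ring
  calc _ ≤ _ := abs_sub_le _ (∑ d ∈ Finset.range D, max 0 (N - c * ((d:ℝ) + 1) ^ k)) _
    _ ≤ Kf f * (D:ℝ) ^ k + N := add_le_add h2 h1
    _ = _ := by ring

theorem logD (k j : ℕ) (hk : 1 ≤ k) : ∃ C : ℝ, 1 ≤ C ∧ ∀ N D : ℕ, 1 ≤ N → N ≤ D ^ k → Real.log N ^ j ≤ C * D := by
  obtain ⟨C, hC, h⟩ := log_pow_le' (j * k)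
  refine ⟨C, hC, fun N D hN hD => ?_⟩
  have h1 := h N hN
  have hL : 0 ≤ Real.log N := Real.log_natCast_nonneg N
  have hD' : (N:ℝ) ≤ (D:ℝ) ^ k := by exact_mod_cast hD
  have h2 : (Real.log N ^ j) ^ k ≤ (C * D) ^ k := by
    rw [← pow_mul, mul_pow]
    refine h1.trans (mul_le_mul (le_self_pow₀ hC (by omega)) hD' (by positivity) (by positivity))
  exact le_of_pow_le_pow_left₀ (by omega) (by positivity) h2

theorem D_choice (k : ℕ) (hk : 1 ≤ k) (N : ℕ) (hN : 1 ≤ N) : ∃ D : ℕ, 1 ≤ D ∧ 2 * N ≤ D ^ k ∧ (D:ℝ) ≤ 3 * (N:ℝ) ^ ((1:ℝ) / k) := by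
  have hN1 : (1:ℝ) ≤ N := by exact_mod_cast hN
  have hk1 : (1:ℝ) ≤ k := by exact_mod_cast hk
  have ha : (2 * (N:ℝ)) ^ ((1:ℝ)/k) ≤ 2 * (N:ℝ) ^ ((1:ℝ) / k) := by
    rw [Real.mul_rpow (by norm_num) (by positivity)]
    gcongr
    calc (2:ℝ) ^ ((1:ℝ)/k) ≤ 2 ^ (1:ℝ) := Real.rpow_le_rpow_of_exponent_le (by norm_num) (by rw [div_le_one (by positivity)]; exact hk1)
      _ = 2 := by simp
  have h1 : (1:ℝ) ≤ (N:ℝ) ^ ((1:ℝ) / k) := Real.one_le_rpow hN1 (by positivity)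
  have hc := Nat.le_ceil ((2 * (N:ℝ)) ^ ((1:ℝ)/k))
  have hp : 0 < (2 * (N:ℝ)) ^ ((1:ℝ)/k) := by positivity
  refine ⟨⌈(2 * (N:ℝ)) ^ ((1:ℝ)/k)⌉₊, Nat.ceil_pos.mpr hp, ?_, ?_⟩
  · have : ((2 * (N:ℝ)) ^ ((1:ℝ)/k)) ^ k ≤ (⌈(2 * (N:ℝ)) ^ ((1:ℝ)/k)⌉₊ : ℝ) ^ k := pow_le_pow_left₀ hp.le hc k
    rw [one_div, Real.rpow_inv_natCast_pow (by positivity) (by omega)] at this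
    rw [one_div]
    exact_mod_cast this
  · have := Nat.ceil_lt_add_one hp.le
    linarith

theorem Fv_large (f : Polynomial ℤ) (hk : 1 ≤ f.natDegree) (hc : 0 < f.leadingCoeff) : ∀ᶠ N : ℕ in atTop, ∀ D : ℕ, 2 * N ≤ D ^ f.natDegree → ∀ d, D ≤ d → (N:ℤ) ≤ Fv f d := by
  have h1 : (1:ℝ) ≤ f.leadingCoeff := by
    have h1 : (1:ℤ) ≤ f.leadingCoeff := hc
    exact_mod_cast h1
  filter_upwards [eventually_ge_atTop ((2 * Kf f) ^ f.natDegree)] with N hN D hD d hd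
  have hKD : 2 * Kf f ≤ D := by
    by_contra hlt
    push Not at hlt
    have := Nat.pow_lt_pow_left hlt (show f.natDegree ≠ 0 by omega)
    omega
  have hl := Fv_lead f d
  rw [abs_le] at hl
  set x : ℝ := (d:ℝ) + 1 with hx
  have hxD : (D:ℝ) ≤ x := by
    have : (D:ℝ) ≤ d := by exact_mod_cast hd
    linarith
  have hx0 : 0 < x := by positivity
  have hKx : 2 * (Kf f : ℝ) ≤ x := le_trans (by exact_mod_cast hKD) hxD
  have h2 : 2 * (Kf f * x ^ (f.natDegree - 1)) ≤ x ^ f.natDegree := by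
    obtain ⟨j, hj⟩ : ∃ j, f.natDegree = j + 1 := ⟨_, (Nat.sub_add_cancel hk).symm⟩
    rw [hj, Nat.add_sub_cancel, pow_succ]
    nlinarith [pow_pos hx0 j]
  have h3 : x ^ f.natDegree ≤ f.leadingCoeff * x ^ f.natDegree := le_mul_of_one_le_left (by positivity) h1
  have h4 : 2 * (N:ℝ) ≤ x ^ f.natDegree := by
    calc 2 * (N:ℝ) ≤ (D:ℝ) ^ f.natDegree := by exact_mod_cast hD
      _ ≤ _ := pow_le_pow_left₀ (by positivity) hxD _
  have : (N:ℝ) ≤ Fv f d := by linarith [hl.1]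
  exact_mod_cast this

noncomputable def SS (f : Polynomial ℤ) : ℝ := ∏' p : Nat.Primes, (1 + ((zf f (p : ℕ) : ℝ) - 1) / (((p : ℕ) : ℝ) - 1) ^ 2)

noncomputable def TT (f : Polynomial ℤ) (N : ℕ) : ℝ := (1 / (f.leadingCoeff : ℝ) ^ ((1 : ℝ) / f.natDegree)) * ((f.natDegree : ℝ) / (f.natDegree + 1)) *
          (N : ℝ) ^ (((f.natDegree : ℝ) + 1) / f.natDegree)

theorem R_main (f : Polynomial ℤ) (hk : 1 ≤ f.natDegree) (hc : 0 < f.leadingCoeff) : ∃ C : ℝ, 0 ≤ C ∧ ∀ᶠ N : ℕ in atTop, ∀ D : ℕ, 1 ≤ D → 2 * N ≤ D ^ f.natDegree →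
    (D:ℝ) ≤ 3 * (N:ℝ) ^ ((1:ℝ) / f.natDegree) →
    |Rc N D (Fv f) (fun n => ArithmeticFunction.vonMangoldt n) - SS f * TT f N| ≤ C * (D * N / Real.log N) := by
  set k := f.natDegree with hkd
  obtain ⟨B, hB, C1, hC1, h1⟩ := major f hk hc (Kf f * 3 ^ k + 1) (by
    have : (0:ℝ) ≤ Kf f * 3 ^ k := by positivity
    linarith)
  obtain ⟨C2, hC2, h2⟩ := rc_ls f hk hc
  obtain ⟨C3, hC3, h3⟩ := log_pow_le' (6 * B + 1)
  obtain ⟨C4, hC4, h4⟩ := logD k (3 * B + 1) hk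
  obtain ⟨C5, hC5, h5⟩ := gq_tail f hc
  obtain ⟨C6, hC6, h6⟩ := logD k 1 hk
  refine ⟨C1 + (C3 + C2 * C4) + C5 + |SS f| * ((1 + Kf f * 3 ^ k) * C6), by positivity, ?_⟩
  filter_upwards [h1, eventually_ge_atTop 3, ev_log 2] with N h1 hN hL2 D hD1 hD2 hD3
  have hN0 : (0:ℝ) < N := by positivity
  have hD0 : (0:ℝ) < D := by exact_mod_cast hD1
  set L := Real.log N with hLd
  have hL0 : 0 < L := by linarith
  have hDk : (D:ℝ) ^ k ≤ 3 ^ k * N := by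
    calc (D:ℝ) ^ k ≤ (3 * (N:ℝ) ^ ((1:ℝ) / k)) ^ k := pow_le_pow_left₀ hD0.le hD3 k
      _ = 3 ^ k * N := by rw [mul_pow, one_div, Real.rpow_inv_natCast_pow hN0.le (by omega)]
  have hND : N ≤ D ^ k := by omega
  set Q := ⌊L ^ B⌋₊ with hQ
  have hQl : (Q:ℝ) ≤ L ^ B := Nat.floor_le (by positivity)
  have hQ4 : L ^ 4 ≤ Q := by
    have ha : L ^ B - 1 < Q := by have := Nat.lt_floor_add_one (L ^ B); linarith
    have hb : L ^ 4 * 2 ^ 5 ≤ L ^ B := by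
      calc L ^ 4 * 2 ^ 5 ≤ L ^ 4 * L ^ 5 := by gcongr
        _ = L ^ 9 := by ring
        _ ≤ L ^ B := pow_le_pow_right₀ (by linarith) hB
    have : 1 ≤ L ^ 4 := one_le_pow₀ (by linarith)
    linarith
  have hQ1 : 1 ≤ Q := by
    have : (1:ℝ) ≤ Q := (one_le_pow₀ (by linarith)).trans hQ4
    exact_mod_cast this
  have hQr : L ≤ (Q:ℝ) ^ (1/4:ℝ) := by
    calc L = (L ^ 4) ^ (1/4:ℝ) := by
          rw [← Real.rpow_natCast, ← Real.rpow_mul hL0.le]; norm_num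
      _ ≤ _ := Real.rpow_le_rpow (by positivity) hQ4 (by norm_num)
  have e1 := h1 D (Kf f * D ^ k + N) hD1 hND (fun d hd => by
      have h := Fv_abs f d
      have hdD : (d:ℝ) + 1 ≤ D := by exact_mod_cast hd
      have : |(Fv f d : ℝ)| ≤ Kf f * (D:ℝ) ^ k := h.trans (by gcongr)
      have h' : |Fv f d| ≤ Kf f * (D:ℤ) ^ k := by exact_mod_cast this
      push_cast; linarith) (by
      push_cast
      nlinarith [show (0:ℝ) ≤ Kf f by positivity])
  have e2 := h2 N Q D
  have e5 := h5 Q hQ1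
  have e7 := T_asym f hk hc N D (by omega) hND
  rw [← SS] at e5
  rw [← TT] at e7
  set RL := Rc N D (Fv f) (fun n => Ls Q n)
  set RR := Rc N D (Fv f) (fun n => ArithmeticFunction.vonMangoldt n)
  set W := ∑ d ∈ Finset.range D, Wd f N d with hW
  set G := ∑ q ∈ Finset.Icc 1 Q, gq f q
  have hW0 : 0 ≤ W := Finset.sum_nonneg fun d _ => Wd_nonneg f N d
  have hW1 : W ≤ D * N := by
    refine (Finset.sum_le_sum fun d _ => Wd_le f N d).trans ?_
    rw [Finset.sum_const, Finset.card_range, nsmul_eq_mul]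
  have f2 : (D:ℝ) * (Q:ℝ) ^ 6 + C2 * N * (Q:ℝ) ^ 3 ≤ (C3 + C2 * C4) * (D * N / L) := by
    rw [← mul_div_assoc, le_div_iff₀ hL0]
    have ha : (Q:ℝ) ^ 6 * L ≤ C3 * N := by
      calc (Q:ℝ) ^ 6 * L ≤ (L ^ B) ^ 6 * L := by gcongr
        _ = L ^ (6 * B + 1) := by rw [← pow_mul, mul_comm B 6, pow_succ]
        _ ≤ _ := h3 N (by omega)
    have hb : (Q:ℝ) ^ 3 * L ≤ C4 * D := by
      calc (Q:ℝ) ^ 3 * L ≤ (L ^ B) ^ 3 * L := by gcongr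
        _ = L ^ (3 * B + 1) := by rw [← pow_mul, mul_comm B 3, pow_succ]
        _ ≤ _ := h4 N D (by omega) hND
    have := mul_le_mul_of_nonneg_left ha hD0.le
    have := mul_le_mul_of_nonneg_left hb (show 0 ≤ C2 * N by positivity)
    linarith
  have f5 : |W * (G - SS f)| ≤ C5 * (D * N / L) := by
    rw [abs_mul, abs_of_nonneg hW0]
    calc W * |G - SS f| ≤ (D * N) * (C5 / L) := by
          refine mul_le_mul hW1 (e5.trans ?_) (abs_nonneg _) (by positivity)
          gcongr
      _ = _ := by ring
  have f7 : |SS f * (W - TT f N)| ≤ |SS f| * ((1 + Kf f * 3 ^ k) * C6) * (D * N / L) := by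
    rw [abs_mul, mul_assoc]
    gcongr
    refine e7.trans ?_
    rw [← mul_div_assoc, le_div_iff₀ hL0]
    have h6' := h6 N D (by omega) hND
    rw [pow_one] at h6'
    calc (N + Kf f * (D:ℝ) ^ k) * L ≤ (N + Kf f * (3 ^ k * N)) * (C6 * D) := by gcongr
      _ = _ := by ring
  have key : RR - SS f * TT f N = (RR - RL) + (RL - W * G) + W * (G - SS f) + SS f * (W - TT f N) := by ring
  rw [key]
  have t1 := abs_add_le ((RR - RL) + (RL - W * G) + W * (G - SS f)) (SS f * (W - TT f N))
  have t2 := abs_add_le ((RR - RL) + (RL - W * G)) (W * (G - SS f))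
  have t3 := abs_add_le (RR - RL) (RL - W * G)
  have := e2.trans f2
  linarith

noncomputable def iP (n : ℕ) : ℝ := if n.Prime then 1 else 0

theorem iP_nonneg (n : ℕ) : 0 ≤ iP n := by rw [iP]; split_ifs <;> norm_num

theorem iP_le (n : ℕ) : iP n ≤ 1 := by rw [iP]; split_ifs <;> norm_num

theorem one_m (N n : ℕ) (z : ℤ) : ∑ m ∈ Finset.Ioc 0 N, (if (m:ℤ) - n = z then (1:ℝ) else 0) ≤ 1 := by
  rw [← Finset.sum_filter, Finset.sum_const, nsmul_eq_mul, mul_one]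
  have : (Finset.filter (fun m : ℕ => (m:ℤ) - n = z) (Finset.Ioc 0 N)).card ≤ 1 := by
    rw [Finset.card_le_one]
    intro a ha b hb
    simp only [Finset.mem_filter] at ha hb
    omega
  exact_mod_cast this

theorem one_n (N m : ℕ) (z : ℤ) : ∑ n ∈ Finset.Ioc 0 N, (if (m:ℤ) - n = z then (1:ℝ) else 0) ≤ 1 := by
  rw [← Finset.sum_filter, Finset.sum_const, nsmul_eq_mul, mul_one]
  have : (Finset.filter (fun n : ℕ => (m:ℤ) - n = z) (Finset.Ioc 0 N)).card ≤ 1 := by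
    rw [Finset.card_le_one]
    intro a ha b hb
    simp only [Finset.mem_filter] at ha hb
    omega
  exact_mod_cast this

theorem Rc_cmp (N D : ℕ) (F : ℕ → ℤ) (u v w : ℕ → ℝ) (A : ℝ) (hw : ∀ n, 0 ≤ w n)
    (h : ∀ n m, n ∈ Finset.Ioc 0 N → m ∈ Finset.Ioc 0 N → u n * u m ≤ A * (v n * v m) + w n + w m) :
    Rc N D F u ≤ A * Rc N D F v + 2 * D * ∑ n ∈ Finset.Ioc 0 N, w n := by
  have e1 : Rc N D F u ≤ ∑ d ∈ Finset.range D, (A * (∑ n ∈ Finset.Ioc 0 N, ∑ m ∈ Finset.Ioc 0 N, if (m : ℤ) - n = F d then v n * v m else 0) + 2 * ∑ n ∈ Finset.Ioc 0 N, w n) := by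
    rw [Rc]
    refine Finset.sum_le_sum fun d _ => ?_
    have a1 : ∑ n ∈ Finset.Ioc 0 N, ∑ m ∈ Finset.Ioc 0 N, w n * (if (m:ℤ) - n = F d then (1:ℝ) else 0) ≤ ∑ n ∈ Finset.Ioc 0 N, w n := by
      refine Finset.sum_le_sum fun n _ => ?_
      rw [← Finset.mul_sum]
      exact mul_le_of_le_one_right (hw n) (one_m N n _)
    have a2 : ∑ n ∈ Finset.Ioc 0 N, ∑ m ∈ Finset.Ioc 0 N, w m * (if (m:ℤ) - n = F d then (1:ℝ) else 0) ≤ ∑ n ∈ Finset.Ioc 0 N, w n := by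
      rw [Finset.sum_comm]
      refine Finset.sum_le_sum fun n _ => ?_
      rw [← Finset.mul_sum]
      exact mul_le_of_le_one_right (hw n) (one_n N n _)
    have a3 : ∑ n ∈ Finset.Ioc 0 N, ∑ m ∈ Finset.Ioc 0 N, (if (m : ℤ) - n = F d then u n * u m else 0) ≤
        ∑ n ∈ Finset.Ioc 0 N, ∑ m ∈ Finset.Ioc 0 N, (A * (if (m : ℤ) - n = F d then v n * v m else 0) + w n * (if (m:ℤ) - n = F d then (1:ℝ) else 0)
          + w m * (if (m:ℤ) - n = F d then (1:ℝ) else 0)) := by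
      refine Finset.sum_le_sum fun n hn => Finset.sum_le_sum fun m hm => ?_
      have := h n m hn hm
      split_ifs
      · linarith
      · simp
    simp only [Finset.sum_add_distrib, ← Finset.mul_sum] at a3 a1 a2 ⊢
    linarith
  refine e1.trans (le_of_eq ?_)
  rw [Finset.sum_add_distrib, ← Finset.mul_sum, Finset.sum_const, Finset.card_range, nsmul_eq_mul, Rc]
  ring

theorem Rc_nonneg (N D : ℕ) (F : ℕ → ℤ) (u : ℕ → ℝ) (hu : ∀ n, 0 ≤ u n) : 0 ≤ Rc N D F u := by
  rw [Rc]
  refine Finset.sum_nonneg fun d _ => Finset.sum_nonneg fun n _ => Finset.sum_nonneg fun m _ => ?_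
  split_ifs
  · exact mul_nonneg (hu n) (hu m)
  · rfl

theorem Rc_lower (N D : ℕ) (F : ℕ → ℤ) (hN : 3 ≤ N) : Rc N D F (fun n => ArithmeticFunction.vonMangoldt n) ≤
    Real.log N ^ 2 * Rc N D F iP + 4 * D * Real.log N ^ 2 * √N := by
  have hL := one_le_log hN
  have hv : ∀ n ∈ Finset.Ioc 0 N, ArithmeticFunction.vonMangoldt n ≤ Real.log N := fun n hn => by
    rw [Finset.mem_Ioc] at hn
    exact ArithmeticFunction.vonMangoldt_le_log.trans (Real.log_le_log (by exact_mod_cast hn.1) (by exact_mod_cast hn.2))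
  have hv0 : ∀ n : ℕ, 0 ≤ ArithmeticFunction.vonMangoldt n := fun n => ArithmeticFunction.vonMangoldt_nonneg
  have h := Rc_cmp N D F (fun n => ArithmeticFunction.vonMangoldt n) iP (fun n => Real.log N * (if n.Prime then 0 else ArithmeticFunction.vonMangoldt n)) (Real.log N ^ 2)
    (fun n => by
      have := hv0 n
      split_ifs <;> positivity) (fun n m hn hm => by
      have h1 := hv n hn
      have h2 := hv m hm
      have h3 := hv0 n
      have h4 := hv0 m
      simp only [iP]
      split_ifs <;> nlinarith)
  have hs : ∑ n ∈ Finset.Ioc 0 N, Real.log N * (if n.Prime then 0 else ArithmeticFunction.vonMangoldt n) ≤ Real.log N * (2 * √N * Real.log N) := by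
    rw [← Finset.mul_sum]
    gcongr
    have := Chebyshev.psi_sub_theta_le (x := (N:ℝ)) (by exact_mod_cast (by omega : 1 ≤ N))
    rw [Chebyshev.psi_sub_theta_eq_sum_not_prime, Nat.floor_natCast] at this
    refine le_trans (le_of_eq ?_) this
    rw [Finset.sum_filter]
    refine Finset.sum_congr rfl fun n _ => ?_
    split_ifs <;> rfl
  have := mul_le_mul_of_nonneg_left hs (show (0:ℝ) ≤ 2 * D by positivity)
  linarith

theorem Rc_upper (N D : ℕ) (F : ℕ → ℤ) (y : ℝ) (hy : 1 < y) : Rc N D F iP ≤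
    1 / Real.log y ^ 2 * Rc N D F (fun n => ArithmeticFunction.vonMangoldt n) + 2 * D * y := by
  have hl : 0 < Real.log y := Real.log_pos hy
  have h := Rc_cmp N D F iP (fun n => ArithmeticFunction.vonMangoldt n) (fun n => if (n:ℝ) ≤ y then 1 else 0) (1 / Real.log y ^ 2)
    (fun n => by split_ifs <;> norm_num) (fun n m hn hm => by
      have h3 : 0 ≤ ArithmeticFunction.vonMangoldt n := ArithmeticFunction.vonMangoldt_nonneg
      have h4 : 0 ≤ ArithmeticFunction.vonMangoldt m := ArithmeticFunction.vonMangoldt_nonneg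
      have h5 : 0 ≤ 1 / Real.log y ^ 2 * (ArithmeticFunction.vonMangoldt n * ArithmeticFunction.vonMangoldt m) := by positivity
      by_cases hn1 : n.Prime
      swap
      · simp only [iP, if_neg hn1, zero_mul]
        have : ∀ n : ℕ, (0:ℝ) ≤ if (n:ℝ) ≤ y then 1 else 0 := fun n => by split_ifs <;> norm_num
        have := this n
        have := ‹∀ n : ℕ, (0:ℝ) ≤ if (n:ℝ) ≤ y then 1 else 0› m
        linarith
      by_cases hm1 : m.Prime
      swap
      · simp only [iP, if_neg hm1, mul_zero]
        have : ∀ n : ℕ, (0:ℝ) ≤ if (n:ℝ) ≤ y then 1 else 0 := fun n => by split_ifs <;> norm_num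
        have := this n
        have := ‹∀ n : ℕ, (0:ℝ) ≤ if (n:ℝ) ≤ y then 1 else 0› m
        linarith
      simp only [iP, if_pos hn1, if_pos hm1]
      by_cases hn2 : (n:ℝ) ≤ y
      · simp only [if_pos hn2]
        split_ifs <;> linarith
      by_cases hm2 : (m:ℝ) ≤ y
      · simp only [if_pos hm2]
        split_ifs <;> linarith
      simp only [if_neg hn2, if_neg hm2]
      push Not at hn2 hm2
      rw [ArithmeticFunction.vonMangoldt_apply_prime hn1, ArithmeticFunction.vonMangoldt_apply_prime hm1]
      have a1 : Real.log y ≤ Real.log n := Real.log_le_log (by linarith) hn2.le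
      have a2 : Real.log y ≤ Real.log m := Real.log_le_log (by linarith) hm2.le
      have : Real.log y * Real.log y ≤ Real.log n * Real.log m := mul_le_mul a1 a2 hl.le (by linarith)
      have : 1 ≤ 1 / Real.log y ^ 2 * (Real.log n * Real.log m) := by
        rw [one_div, ← div_eq_inv_mul, le_div_iff₀ (by positivity)]
        linarith
      linarith)
  have hs : ∑ n ∈ Finset.Ioc 0 N, (if (n:ℝ) ≤ y then (1:ℝ) else 0) ≤ y := by
    rw [← Finset.sum_filter, Finset.sum_const, nsmul_eq_mul, mul_one]
    calc _ ≤ ((Finset.Ioc 0 ⌊y⌋₊).card : ℝ) := by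
          gcongr
          intro n hn
          rw [Finset.mem_filter, Finset.mem_Ioc] at hn
          rw [Finset.mem_Ioc]
          exact ⟨hn.1.1, Nat.le_floor hn.2⟩
      _ ≤ y := by simpa using Nat.floor_le (by linarith)
  have := mul_le_mul_of_nonneg_left hs (show (0:ℝ) ≤ 2 * D by positivity)
  linarith

open Classical in
theorem rf_sum (f : Polynomial ℤ) (N D : ℕ) (h : ∀ d, D ≤ d → (N:ℤ) ≤ Fv f d) :
    (rf f N : ℝ) = ∑ n ∈ Finset.Ioc 0 N, ∑ m ∈ Finset.Ioc 0 N, iP n * iP m * (if ∃ d ∈ Finset.range D, (m:ℤ) - n = Fv f d then 1 else 0) := by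
  have e : rf f N = ((Finset.Ioc 0 N ×ˢ Finset.Ioc 0 N).filter fun x : ℕ × ℕ => x.1.Prime ∧ x.2.Prime ∧ ∃ d ∈ Finset.range D, (x.2:ℤ) - x.1 = Fv f d).card := by
    rw [rf]
    rw [← Nat.card_eq_finsetCard]
    refine Nat.card_congr ((Equiv.prodComm ℕ ℕ).subtypeEquiv fun x => ?_)
    simp only [Equiv.prodComm_apply, Prod.fst_swap, Prod.snd_swap, Finset.mem_filter, Finset.mem_product, Finset.mem_Ioc, Finset.mem_range]
    constructor
    · rintro ⟨h1, h2, h3, h4, d, hd, hd2⟩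
      refine ⟨⟨⟨h3.pos, h4⟩, h1.pos, h2⟩, h3, h1, d - 1, ?_, ?_⟩
      · by_contra hlt
        push Not at hlt
        have h5 := h _ hlt
        rw [Fv] at h5
        rw [show ((d - 1 : ℕ) : ℤ) + 1 = d by omega, hd2] at h5
        have := h3.pos
        omega
      · rw [Fv, show ((d - 1 : ℕ) : ℤ) + 1 = d by omega, hd2]
    · rintro ⟨⟨⟨_, h4⟩, _, h2⟩, h3, h1, d, hd, hd2⟩
      refine ⟨h1, h2, h3, h4, d + 1, by omega, ?_⟩
      rw [hd2, Fv]; push_cast; rfl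
  rw [e, Finset.card_filter, Finset.sum_product]
  push_cast
  refine Finset.sum_congr rfl fun n _ => Finset.sum_congr rfl fun m _ => ?_
  simp only [iP]
  by_cases h1 : n.Prime <;> by_cases h2 : m.Prime <;> simp [h1, h2]

theorem Rc_swap (N D : ℕ) (F : ℕ → ℤ) (u : ℕ → ℝ) : Rc N D F u = ∑ n ∈ Finset.Ioc 0 N, ∑ m ∈ Finset.Ioc 0 N, u n * u m * ∑ d ∈ Finset.range D, (if (m:ℤ) - n = F d then (1:ℝ) else 0) := by
  rw [Rc, Finset.sum_comm]
  refine Finset.sum_congr rfl fun n _ => ?_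
  rw [Finset.sum_comm]
  refine Finset.sum_congr rfl fun m _ => ?_
  rw [Finset.mul_sum]
  refine Finset.sum_congr rfl fun d _ => ?_
  split_ifs <;> simp

open Classical in
theorem rf_cmp (f : Polynomial ℤ) (hk : 1 ≤ f.natDegree) (hc : 0 < f.leadingCoeff) : ∃ C : ℝ, 0 ≤ C ∧ ∀ᶠ N : ℕ in atTop, ∀ D : ℕ, 2 * N ≤ D ^ f.natDegree →
    |(rf f N : ℝ) - Rc N D (Fv f) iP| ≤ C * N := by
  obtain ⟨d0, hd0⟩ := Fv_smono f hk hc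
  have hinj : ∀ a b, d0 ≤ a → a < b → Fv f a < Fv f b := by
    intro a b ha hab
    induction b with
    | zero => omega
    | succ b ih =>
      rcases Nat.lt_or_ge a b with h | h
      · exact (ih h).trans (hd0 b (by omega)).2
      · have : a = b := by omega
        rw [this]; exact (hd0 b (by omega)).2
  refine ⟨d0, by positivity, ?_⟩
  filter_upwards [Fv_large f hk hc] with N hN D hD
  rw [rf_sum f N D (hN D hD), Rc_swap, abs_sub_comm]
  have key : ∀ z : ℤ, (if ∃ d ∈ Finset.range D, z = Fv f d then (1:ℝ) else 0) ≤ ∑ d ∈ Finset.range D, (if z = Fv f d then (1:ℝ) else 0) ∧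
      ∑ d ∈ Finset.range D, (if z = Fv f d then (1:ℝ) else 0) ≤ (if ∃ d ∈ Finset.range D, z = Fv f d then (1:ℝ) else 0) + ∑ d ∈ Finset.range d0, (if z = Fv f d then (1:ℝ) else 0) := by
    intro z
    have nn : ∀ d, (0:ℝ) ≤ (if z = Fv f d then (1:ℝ) else 0) := fun d => by split_ifs <;> norm_num
    by_cases h : ∃ d ∈ Finset.range D, z = Fv f d
    · simp only [if_pos h]
      obtain ⟨d, hd, hz⟩ := h
      constructor
      · have := Finset.single_le_sum (f := fun d => (if z = Fv f d then (1:ℝ) else 0)) (fun d _ => nn d) hd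
        simpa [hz] using this
      · rw [← Finset.sum_filter, ← Finset.sum_filter, Finset.sum_const, Finset.sum_const, nsmul_eq_mul, nsmul_eq_mul, mul_one, mul_one]
        have h1 : ((Finset.range D).filter fun d => z = Fv f d).card ≤ 1 + ((Finset.range d0).filter fun d => z = Fv f d).card := by
          calc _ ≤ (((Finset.range D).filter fun d => d0 ≤ d ∧ z = Fv f d) ∪ ((Finset.range d0).filter fun d => z = Fv f d)).card := by
                apply Finset.card_le_card
                intro x hx
                simp only [Finset.mem_union, Finset.mem_filter, Finset.mem_range] at hx ⊢
                rcases Nat.lt_or_ge x d0 with h | h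
                · exact Or.inr ⟨h, hx.2⟩
                · exact Or.inl ⟨hx.1, h, hx.2⟩
            _ ≤ _ := Finset.card_union_le _ _
            _ ≤ _ := by
                gcongr
                rw [Finset.card_le_one]
                intro a ha b hb
                simp only [Finset.mem_filter] at ha hb
                rcases lt_trichotomy a b with h | h | h
                · have := hinj a b ha.2.1 h; omega
                · exact h
                · have := hinj b a hb.2.1 h; omega
        exact_mod_cast h1
    · simp only [if_neg h]
      push Not at h
      rw [Finset.sum_eq_zero fun d hd => if_neg (h d hd)]
      exact ⟨le_rfl, by rw [zero_add]; exact Finset.sum_nonneg fun d _ => nn d⟩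
  rw [← Finset.sum_sub_distrib]
  simp only [← Finset.sum_sub_distrib, ← mul_sub]
  rw [abs_of_nonneg]
  · calc _ ≤ ∑ n ∈ Finset.Ioc 0 N, ∑ m ∈ Finset.Ioc 0 N, ∑ d ∈ Finset.range d0, (if (m:ℤ) - n = Fv f d then (1:ℝ) else 0) := by
          refine Finset.sum_le_sum fun n _ => Finset.sum_le_sum fun m _ => ?_
          have h1 := key ((m:ℤ) - n)
          have h2 : iP n * iP m ≤ 1 := mul_le_one₀ (iP_le n) (iP_nonneg m) (iP_le m)
          have h3 := mul_le_mul_of_nonneg_right h2 (sub_nonneg.mpr h1.1)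
          linarith [h1.2]
      _ = ∑ n ∈ Finset.Ioc 0 N, ∑ d ∈ Finset.range d0, ∑ m ∈ Finset.Ioc 0 N, (if (m:ℤ) - n = Fv f d then (1:ℝ) else 0) :=
          Finset.sum_congr rfl fun n _ => Finset.sum_comm
      _ ≤ ∑ n ∈ Finset.Ioc 0 N, ∑ d ∈ Finset.range d0, (1:ℝ) := by
          gcongr with n _ d _
          exact one_m N n _
      _ = _ := by simp; ring
  · refine Finset.sum_nonneg fun n _ => Finset.sum_nonneg fun m _ => ?_
    exact mul_nonneg (mul_nonneg (iP_nonneg n) (iP_nonneg m)) (sub_nonneg.mpr (key _).1)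

set_option maxHeartbeats 1000000 in
theorem fin_aux (f : Polynomial ℤ) (hk : 1 ≤ f.natDegree) (hc : 0 < f.leadingCoeff) : ∃ C : ℝ, ∀ᶠ N : ℕ in atTop,
    |(rf f N : ℝ) - SS f * TT f N / Real.log N ^ 2| ≤ C * ((N : ℝ) ^ (((f.natDegree : ℝ) + 1) / f.natDegree) * Real.log (Real.log N) / Real.log N ^ 3) := by
  set k := f.natDegree with hkd
  obtain ⟨C1, hC1, h1⟩ := R_main f hk hc
  obtain ⟨C2, hC2, h2⟩ := rf_cmp f hk hc
  obtain ⟨C3, hC3, h3⟩ := logD k 3 hk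
  obtain ⟨C4, hC4, h4⟩ := log_pow_le 3
  set c0 : ℝ := (1 / (f.leadingCoeff : ℝ) ^ ((1 : ℝ) / f.natDegree)) * ((f.natDegree : ℝ) / (f.natDegree + 1)) with hc0
  set CR : ℝ := |SS f * c0| + 3 * C1 with hCR
  refine ⟨3 * C1 + C2 * (3 * C3) + 12 * C4 + 24 * CR + 6, ?_⟩
  filter_upwards [h1, h2, eventually_ge_atTop 3, ev_log 144] with N h1 h2 hN hL
  obtain ⟨D, hD1, hD2, hD3⟩ := D_choice k hk N (by omega)
  have hN0 : (0:ℝ) < N := by positivity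
  have hD0 : (0:ℝ) < D := by exact_mod_cast hD1
  have r1 := h1 D hD1 hD2 hD3
  have r2 := h2 D hD2
  have r3 := h3 N D (by omega) (by omega)
  have r4 := h4 N (by exact_mod_cast (by omega : 1 ≤ N))
  have hTT : TT f N = c0 * (N : ℝ) ^ (((k : ℝ) + 1) / k) := rfl
  set X := (N : ℝ) ^ (((k : ℝ) + 1) / k) with hX
  have hX0 : 0 < X := by positivity
  have hDX : D * N ≤ 3 * X := by
    have hkk : (0:ℝ) < k := by exact_mod_cast hk
    have : X = N * (N:ℝ) ^ ((1:ℝ) / k) := by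
      rw [hX, add_div, div_self hkk.ne', Real.rpow_add hN0, Real.rpow_one]
    rw [this]
    nlinarith
  have s1 := Rc_lower N D (Fv f) hN
  have hR0 := Rc_nonneg N D (Fv f) (fun n => ArithmeticFunction.vonMangoldt n) (fun n => ArithmeticFunction.vonMangoldt_nonneg)
  set R := Rc N D (Fv f) (fun n => ArithmeticFunction.vonMangoldt n)
  set L := Real.log N with hLd
  set l := Real.log L with hl
  have hL0 : 0 < L := by linarith
  have hl1 : 1 ≤ l := by
    rw [hl, Real.le_log_iff_exp_le hL0]
    linarith [Real.exp_one_lt_d9]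
  have hl6 : 6 * l ≤ L := by
    have a1 := Real.log_le_sub_one_of_pos (Real.sqrt_pos.mpr hL0)
    rw [Real.log_sqrt hL0.le, ← hl] at a1
    have a2 : 12 ≤ √L := Real.le_sqrt_of_sq_le (by norm_num; linarith)
    have a3 := Real.mul_self_sqrt hL0.le
    nlinarith
  have hly : Real.log (N / L ^ 3) = L - 3 * l := by
    rw [Real.log_div hN0.ne' (by positivity), Real.log_pow, ← hLd, ← hl]; norm_num
  have hy : 1 < N / L ^ 3 := by
    rw [← Real.log_pos_iff (by positivity), hly]
    linarith
  have s2 := Rc_upper N D (Fv f) _ hy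
  rw [hly] at s2
  set A := L - 3 * l with hA
  have hA2 : L / 2 ≤ A := by linarith
  have hA0 : 0 < A := by linarith
  set P := Rc N D (Fv f) iP
  set Z := X / L ^ 3 with hZ
  have hZ0 : 0 < Z := by positivity
  have hY : X * l / L ^ 3 = Z * l := by rw [hZ]; ring
  rw [hY]
  have hZY : Z ≤ Z * l := le_mul_of_one_le_right hZ0.le hl1
  have hDN : D * N / L ^ 3 ≤ 3 * Z := by
    rw [hZ, ← mul_div_assoc]
    gcongr
  have q1 : |R / L ^ 2 - SS f * TT f N / L ^ 2| ≤ 3 * C1 * Z := by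
    rw [← sub_div, abs_div, abs_of_pos (show 0 < L ^ 2 by positivity)]
    calc _ ≤ C1 * (D * N / L) / L ^ 2 := by gcongr
      _ = C1 * (D * N / L ^ 3) := by field_simp
      _ ≤ C1 * (3 * Z) := by gcongr
      _ = _ := by ring
  have q2 : C2 * N ≤ C2 * (3 * C3) * Z := by
    rw [mul_assoc]
    gcongr
    calc (N:ℝ) = (N * L ^ 3) / L ^ 3 := by field_simp
      _ ≤ (N * (C3 * D)) / L ^ 3 := by gcongr
      _ = C3 * (D * N / L ^ 3) := by ring
      _ ≤ C3 * (3 * Z) := by gcongr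
      _ = _ := by ring
  have q3 : D * √N ≤ 3 * C4 * Z := by
    have hs : √(N:ℝ) * L ^ 3 ≤ C4 * N := by
      have a := Real.mul_self_sqrt hN0.le
      have := mul_le_mul_of_nonneg_left r4 (Real.sqrt_nonneg (N:ℝ))
      nlinarith
    calc (D:ℝ) * √N = D * (√N * L ^ 3) / L ^ 3 := by field_simp
      _ ≤ D * (C4 * N) / L ^ 3 := by gcongr
      _ = C4 * (D * N / L ^ 3) := by ring
      _ ≤ C4 * (3 * Z) := by gcongr
      _ = _ := by ring
  have q4 : R / L ^ 2 ≤ P + 12 * C4 * Z := by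
    rw [div_le_iff₀ (by positivity)]
    have := mul_le_mul_of_nonneg_left q3 (show 0 ≤ 4 * L ^ 2 by positivity)
    linarith
  have q5 : R ≤ CR * X := by
    have a1 := (abs_le.mp r1).2
    have a2 : C1 * (D * N / L) ≤ C1 * (3 * X) := by
      gcongr
      refine (div_le_self (by positivity) (by linarith)).trans hDX
    have a3 : SS f * TT f N ≤ |SS f * c0| * X := by
      rw [hTT, ← mul_assoc]
      gcongr
      exact le_abs_self _
    rw [hCR]
    linarith
  have q6 : 1 / A ^ 2 * R ≤ R / L ^ 2 + 24 * CR * (Z * l) := by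
    have b1 : 1 / A ^ 2 - 1 / L ^ 2 ≤ 24 * l / L ^ 3 := by
      have : 1 / A ^ 2 - 1 / L ^ 2 = (L ^ 2 - A ^ 2) / (A ^ 2 * L ^ 2) := by field_simp
      rw [this]
      calc (L ^ 2 - A ^ 2) / (A ^ 2 * L ^ 2) ≤ (6 * l * L) / ((L / 2) ^ 2 * L ^ 2) := by
            apply div_le_div₀ (by positivity) _ (by positivity) (by gcongr)
            rw [hA]; nlinarith
        _ = _ := by field_simp; norm_num
    have b2 := mul_le_mul_of_nonneg_right b1 hR0
    have b3 : 24 * l / L ^ 3 * R ≤ 24 * l / L ^ 3 * (CR * X) := by gcongr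
    have b4 : 24 * l / L ^ 3 * (CR * X) = 24 * CR * (Z * l) := by rw [hZ]; ring
    have b5 : R / L ^ 2 = 1 / L ^ 2 * R := by ring
    rw [b5]
    linarith
  have q7 : 2 * D * (N / L ^ 3) ≤ 6 * Z := by
    have : 2 * (D:ℝ) * (N / L ^ 3) = 2 * (D * N / L ^ 3) := by ring
    linarith
  have hCR0 : 0 ≤ CR := by positivity
  have w1 : 3 * C1 * Z ≤ 3 * C1 * (Z * l) := by gcongr
  have w2 : C2 * (3 * C3) * Z ≤ C2 * (3 * C3) * (Z * l) := by gcongr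
  have w3 : 12 * C4 * Z ≤ 12 * C4 * (Z * l) := by gcongr
  have w4 : 0 ≤ 24 * CR * (Z * l) := by positivity
  have w5 : 0 ≤ 12 * C4 * (Z * l) := by positivity
  rw [abs_le] at q1 r2 ⊢
  constructor <;> linarith [q1.1, q1.2, r2.1, r2.2]

theorem stmt0 (f : Polynomial ℤ) (k : ℕ) (hk : 1 ≤ k)
    (hdeg : f.natDegree = k) (hlead : 0 < f.leadingCoeff) :
    (fun N : ℕ => (rf f N : ℝ) -
        (∏' p : Nat.Primes, (1 + ((zf f (p : ℕ) : ℝ) - 1) / (((p : ℕ) : ℝ) - 1) ^ 2)) *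
          (1 / (f.leadingCoeff : ℝ) ^ ((1 : ℝ) / k)) * ((k : ℝ) / (k + 1)) *
          ((N : ℝ) ^ (((k : ℝ) + 1) / k) / Real.log N ^ 2))
      =O[atTop]
    (fun N : ℕ => (N : ℝ) ^ (((k : ℝ) + 1) / k) * Real.log (Real.log N) / Real.log N ^ 3) := by
  subst hdeg
  obtain ⟨C, hC⟩ := fin_aux f hk hlead
  refine IsBigO.of_bound |C| ?_
  filter_upwards [hC] with N hN
  rw [Real.norm_eq_abs, Real.norm_eq_abs, ← abs_mul]
  refine le_trans (le_of_eq ?_) (hN.trans (le_abs_self _))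
  congr 2
  rw [SS, TT]
  ring
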